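/- Let A be free and H ∈ A. Then A' := A \ {H} is free if and only if for every X ∈ L(A^H), the number s_X := −(|A_X| − |A_X^H|)^{−1} is a non-zero root of the Poincaré polynomial π(A_X;t). -/

import Mathlib

open MvPolynomial

noncomputable section

attribute [local instance] Classical.propDecidable

namespace ArrPOG

variable (K : Type) [Field K] (ℓ : ℕ)

/-- A polynomial vector field on `K^ℓ`: `θ = Σ θᵢ ∂/∂xᵢ`, identified with its
coefficient vector `(θ₁,…,θ_ℓ)` in `S = K[x₁,…,x_ℓ]`. -/
abbrev Deriv : Type := Fin ℓ → MvPolynomial (Fin ℓ) K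

variable {K ℓ}

/-- The linear polynomial `α_H ∈ S` associated to a linear form `φ ∈ V*`. -/
def linPoly (φ : Module.Dual K (Fin ℓ → K)) : MvPolynomial (Fin ℓ) K :=
  ∑ i, MvPolynomial.C (φ (Pi.single i 1)) * MvPolynomial.X i

/-- `θ(α)` for a derivation `θ` and the linear form `α` given by `φ ∈ V*`. -/
def applyLin (θ : Deriv K ℓ) (φ : Module.Dual K (Fin ℓ → K)) : MvPolynomial (Fin ℓ) K :=
  ∑ i, MvPolynomial.C (φ (Pi.single i 1)) * θ i

/-- An arrangement: a finite set of hyperplanes (kernels of nonzero linear forms). -/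
def IsArrangement (A : Finset (Submodule K (Fin ℓ → K))) : Prop :=
  ∀ H ∈ A, ∃ φ : Module.Dual K (Fin ℓ → K), φ ≠ 0 ∧ LinearMap.ker φ = H

/-- Essential: the common intersection of all members is `0`. -/
def Essential (A : Finset (Submodule K (Fin ℓ → K))) : Prop :=
  A.inf id = ⊥

/-- Membership in the logarithmic derivation module `D(A)`:
`θ(α_H) ∈ S·α_H` for every `H ∈ A`. -/
def InD (A : Finset (Submodule K (Fin ℓ → K))) (θ : Deriv K ℓ) : Prop :=
  ∀ H ∈ A, ∀ φ : Module.Dual K (Fin ℓ → K), LinearMap.ker φ = H → linPoly φ ∣ applyLin θ φ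

/-- A derivation is homogeneous of degree `n` if all its coefficients are. -/
def HomogDeriv (θ : Deriv K ℓ) (n : ℕ) : Prop := ∀ i, (θ i).IsHomogeneous n

/-- `θ₁,…,θₙ` generate `D(A)` as an `S`-module. -/
def GeneratesD {n : ℕ} (A : Finset (Submodule K (Fin ℓ → K))) (θ : Fin n → Deriv K ℓ) : Prop :=
  (∀ i, InD A (θ i)) ∧
    ∀ η, InD A η → ∃ c : Fin n → MvPolynomial (Fin ℓ) K, η = ∑ i, c i • θ i

/-- `S`-linear independence of a family of derivations. -/
def IndepD {n : ℕ} (θ : Fin n → Deriv K ℓ) : Prop :=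
  ∀ c : Fin n → MvPolynomial (Fin ℓ) K, (∑ i, c i • θ i) = 0 → ∀ i, c i = 0

/-- `A` is free with exponents `e`: `D(A)` has a homogeneous basis of degrees `e i`. -/
def IsFreeExp (A : Finset (Submodule K (Fin ℓ → K))) (e : Fin ℓ → ℕ) : Prop :=
  ∃ θ : Fin ℓ → Deriv K ℓ, (∀ i, HomogDeriv (θ i) (e i)) ∧ GeneratesD A θ ∧ IndepD θ

/-- `A` is free. -/
def IsFree (A : Finset (Submodule K (Fin ℓ → K))) : Prop := ∃ e, IsFreeExp A e

/-- `A` is plus-one generated with exponents `e`, level `lev`, realized by the minimal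
homogeneous generators `θ₁,…,θ_ℓ, φ` whose unique syzygy is `Σ fᵢ•θᵢ + α•φ = 0`:
this encodes the minimal free resolution
`0 → S[-lev-1] → S[-lev] ⊕ (⊕ S[-eᵢ]) → D(A) → 0`. -/
def IsPOGWith (A : Finset (Submodule K (Fin ℓ → K))) (e : Fin ℓ → ℕ) (lev : ℕ)
    (θ : Fin ℓ → Deriv K ℓ) (φ : Deriv K ℓ)
    (f : Fin ℓ → MvPolynomial (Fin ℓ) K) (α : MvPolynomial (Fin ℓ) K) : Prop :=
  (∀ i, InD A (θ i)) ∧ InD A φ ∧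
  (∀ i, HomogDeriv (θ i) (e i)) ∧ HomogDeriv φ lev ∧
  (∀ η, InD A η → ∃ (c : Fin ℓ → MvPolynomial (Fin ℓ) K) (g : MvPolynomial (Fin ℓ) K),
      η = (∑ i, c i • θ i) + g • φ) ∧
  α.IsHomogeneous 1 ∧
  (∀ i, (f i).IsHomogeneous (lev + 1 - e i)) ∧
  (∀ i, MvPolynomial.constantCoeff (f i) = 0) ∧
  ((∑ i, f i • θ i) + α • φ = 0) ∧
  (¬ (α = 0 ∧ ∀ i, f i = 0)) ∧
  (∀ (g : Fin ℓ → MvPolynomial (Fin ℓ) K) (h : MvPolynomial (Fin ℓ) K),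
      ((∑ i, g i • θ i) + h • φ = 0) →
      ∃ q : MvPolynomial (Fin ℓ) K, (∀ i, g i = q * f i) ∧ h = q * α)

/-- Plus-one generated with exponents `e` and level `lev`. -/
def IsPOG (A : Finset (Submodule K (Fin ℓ → K))) (e : Fin ℓ → ℕ) (lev : ℕ) : Prop :=
  ∃ θ φ f α, IsPOGWith A e lev θ φ f α

/-- Strictly plus-one generated: the level coefficient `α` is nonzero. -/
def IsSPOG (A : Finset (Submodule K (Fin ℓ → K))) (e : Fin ℓ → ℕ) (lev : ℕ) : Prop :=
  ∃ θ φ f α, IsPOGWith A e lev θ φ f α ∧ α ≠ 0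

/-- The restriction `A^H = {L ⊓ H | L ∈ A \ {H}}`. -/
def restrict (A : Finset (Submodule K (Fin ℓ → K))) (H : Submodule K (Fin ℓ → K)) :
    Finset (Submodule K (Fin ℓ → K)) :=
  (A.erase H).image (fun L => L ⊓ H)

/-- The localization `A_X = {L ∈ A | X ⊆ L}`. -/
def localize (A : Finset (Submodule K (Fin ℓ → K))) (X : Submodule K (Fin ℓ → K)) :
    Finset (Submodule K (Fin ℓ → K)) :=
  A.filter (fun L => X ≤ L)

/-- The intersection lattice of `A`, inside the ambient space `T`. -/
def latticeOf (T : Submodule K (Fin ℓ → K)) (A : Finset (Submodule K (Fin ℓ → K))) :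
    Finset (Submodule K (Fin ℓ → K)) :=
  A.powerset.image (fun B => T ⊓ B.inf id)

/-- The Möbius function of the poset `L` (intersection lattice with top `T`). -/
def mob (T : Submodule K (Fin ℓ → K)) (L : Finset (Submodule K (Fin ℓ → K)))
    (X : Submodule K (Fin ℓ → K)) : ℤ :=
  if X = T then 1
  else - ∑ Y ∈ (L.filter fun Z => X < Z).attach, mob T L Y.1
termination_by (L.filter fun Z => X < Z).card
decreasing_by
  obtain ⟨Y, hY⟩ := Y
  simp only [Finset.mem_filter] at hY
  apply Finset.card_lt_card
  rw [Finset.ssubset_def]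
  constructor
  · intro Z hZ
    simp only [Finset.mem_filter] at hZ ⊢
    exact ⟨hZ.1, lt_trans hY.2 hZ.2⟩
  · intro hsub
    have h2 := hsub (Finset.mem_filter.mpr ⟨hY.1, hY.2⟩)
    simp only [Finset.mem_filter] at h2
    exact lt_irrefl Y h2.2

/-- The characteristic polynomial `χ(A;t) = Σ_{X ∈ L(A)} μ(X) t^{dim X}`
of an arrangement inside the ambient space `T`. -/
def charPoly (T : Submodule K (Fin ℓ → K)) (A : Finset (Submodule K (Fin ℓ → K))) :
    Polynomial ℤ :=
  ∑ X ∈ latticeOf T A,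
    Polynomial.C (mob T (latticeOf T A) X) * Polynomial.X ^ (Module.finrank K X)

/-- The Betti number `b_i(A)`: `χ(A;t) = Σ (-1)^i b_i(A) t^{ℓ-i}`. -/
def bNum (A : Finset (Submodule K (Fin ℓ → K))) (i : ℕ) : ℤ :=
  (-1) ^ i * (charPoly (⊤ : Submodule K (Fin ℓ → K)) A).coeff (ℓ - i)

/-- Evaluation of the Poincaré polynomial `π(A;t) = Σ μ(X) (-t)^{codim X}` at `t : ℚ`. -/
def poincareEval (A : Finset (Submodule K (Fin ℓ → K))) (t : ℚ) : ℚ :=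
  ∑ X ∈ latticeOf ⊤ A,
    (mob (⊤ : Submodule K (Fin ℓ → K)) (latticeOf ⊤ A) X : ℚ) *
      (-t) ^ (ℓ - Module.finrank K X)

/-- The Euler derivation `θ_E = Σ xᵢ ∂/∂xᵢ`. -/
def eulerD : Deriv K ℓ := fun i => MvPolynomial.X i

/-- `A` is locally free: `A_X` is free for every `X ∈ L(A)` other than `∩_{H∈A} H`. -/
def LocallyFree (A : Finset (Submodule K (Fin ℓ → K))) : Prop :=
  ∀ X ∈ latticeOf ⊤ A, X ≠ A.inf id → IsFree (localize A X)

/-- Transport a finite set of subspaces contained in `T` to `K^m` along a linear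
isomorphism `T ≃ K^m`. -/
def transport {m : ℕ} (T : Submodule K (Fin ℓ → K)) (eqv : T ≃ₗ[K] (Fin m → K))
    (A : Finset (Submodule K (Fin ℓ → K))) : Finset (Submodule K (Fin m → K)) :=
  A.image fun L => (L.comap T.subtype).map eqv.toLinearMap

/-- An arrangement inside the subspace `T` is free with exponents `e`, i.e. it is free
after identifying `T` with a coordinate space. -/
def RestrFreeExp {m : ℕ} (T : Submodule K (Fin ℓ → K))
    (A : Finset (Submodule K (Fin ℓ → K))) (e : Fin m → ℕ) : Prop :=
  ∃ eqv : T ≃ₗ[K] (Fin m → K), IsFreeExp (transport T eqv A) e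

/-- The multiset of exponents. -/
def expMS {n : ℕ} (e : Fin n → ℕ) : Multiset ℕ := Finset.univ.val.map e

/-- `D(A)` has projective dimension at most 1: some finite generating set has a free
(possibly zero) syzygy module, i.e. there is a free resolution
`0 → S^m → S^n → D(A) → 0`. -/
def PdimLEOne (A : Finset (Submodule K (Fin ℓ → K))) : Prop :=
  ∃ (n m : ℕ) (θ : Fin n → Deriv K ℓ) (r : Fin m → Fin n → MvPolynomial (Fin ℓ) K),
    GeneratesD A θ ∧
    (∀ j, (∑ i, r j i • θ i) = 0) ∧
    (∀ c : Fin n → MvPolynomial (Fin ℓ) K, (∑ i, c i • θ i) = 0 →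
      ∃ q : Fin m → MvPolynomial (Fin ℓ) K, ∀ i, c i = ∑ j, q j * r j i) ∧
    (∀ q : Fin m → MvPolynomial (Fin ℓ) K, (∀ i, (∑ j, q j * r j i) = 0) → ∀ j, q j = 0)

/-- `A` has a free filtration `∅ = A₀ ⊂ A₁ ⊂ ⋯ ⊂ A_n = A`, `|A_i| = i`, each `A_i` free. -/
def HasFreeFiltration (A : Finset (Submodule K (Fin ℓ → K))) : Prop :=
  ∃ c : ℕ → Finset (Submodule K (Fin ℓ → K)),
    c A.card = A ∧ (∀ i ≤ A.card, (c i).card = i ∧ IsFree (c i)) ∧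
    ∀ i < A.card, c i ⊆ c (i + 1)

/-- The intersection lattices of `A` and `B` are isomorphic: there is a bijection of
hyperplanes preserving the rank of every subset (equivalently, a lattice isomorphism). -/
def LatticeEquiv (A B : Finset (Submodule K (Fin ℓ → K))) : Prop :=
  ∃ σ : Submodule K (Fin ℓ → K) → Submodule K (Fin ℓ → K),
    Set.BijOn σ ↑A ↑B ∧
    ∀ T ⊆ A, Module.finrank K ((T.inf id : Submodule K (Fin ℓ → K))) =
      Module.finrank K (((T.image σ).inf id : Submodule K (Fin ℓ → K)))



def lpL : Module.Dual K (Fin ℓ → K) →ₗ[K] MvPolynomial (Fin ℓ) K where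
  toFun := linPoly
  map_add' φ ψ := by simp [linPoly, add_mul, Finset.sum_add_distrib]
  map_smul' c φ := by simp [linPoly, Finset.smul_sum, MvPolynomial.smul_eq_C_mul, mul_assoc]

theorem lpL_apply (φ : Module.Dual K (Fin ℓ → K)) : lpL φ = linPoly φ := rfl

def apL (θ : Deriv K ℓ) : Module.Dual K (Fin ℓ → K) →ₗ[K] MvPolynomial (Fin ℓ) K where
  toFun := applyLin θ
  map_add' φ ψ := by simp [applyLin, add_mul, Finset.sum_add_distrib]
  map_smul' c φ := by simp [applyLin, Finset.smul_sum, MvPolynomial.smul_eq_C_mul, mul_assoc]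

theorem apL_apply (θ : Deriv K ℓ) (φ : Module.Dual K (Fin ℓ → K)) : apL θ φ = applyLin θ φ := rfl

/-- `applyLin` as an `S`-linear map in the derivation. -/
def apS (φ : Module.Dual K (Fin ℓ → K)) : Deriv K ℓ →ₗ[MvPolynomial (Fin ℓ) K] MvPolynomial (Fin ℓ) K where
  toFun θ := applyLin θ φ
  map_add' θ η := by simp [applyLin, mul_add, Finset.sum_add_distrib]
  map_smul' c θ := by
    simp only [applyLin, Pi.smul_apply, smul_eq_mul, Finset.mul_sum, RingHom.id_apply]
    exact Finset.sum_congr rfl fun i _ => by ring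

theorem apS_apply (θ : Deriv K ℓ) (φ : Module.Dual K (Fin ℓ → K)) : apS φ θ = applyLin θ φ := rfl

theorem applyLin_add (θ η : Deriv K ℓ) (φ : Module.Dual K (Fin ℓ → K)) :
    applyLin (θ + η) φ = applyLin θ φ + applyLin η φ := (apS φ).map_add θ η
theorem applyLin_sub (θ η : Deriv K ℓ) (φ : Module.Dual K (Fin ℓ → K)) :
    applyLin (θ - η) φ = applyLin θ φ - applyLin η φ := (apS φ).map_sub θ η
theorem applyLin_smul (c : MvPolynomial (Fin ℓ) K) (θ : Deriv K ℓ)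
    (φ : Module.Dual K (Fin ℓ → K)) :
    applyLin (c • θ) φ = c * applyLin θ φ := (apS φ).map_smul c θ
theorem applyLin_sum {ι : Type*} (s : Finset ι) (θ : ι → Deriv K ℓ)
    (φ : Module.Dual K (Fin ℓ → K)) :
    applyLin (∑ i ∈ s, θ i) φ = ∑ i ∈ s, applyLin (θ i) φ := map_sum (apS φ) θ s

theorem dual_apply_eq (φ : Module.Dual K (Fin ℓ → K)) (v : Fin ℓ → K) :
    φ v = ∑ i, φ (Pi.single i 1) * v i := by
  conv_lhs => rw [← LinearMap.sum_single_apply (fun _ => K) v]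
  rw [map_sum]
  refine Finset.sum_congr rfl fun i _ => ?_
  have : (Pi.single i (v i) : Fin ℓ → K) = v i • Pi.single i 1 := by
    rw [← Pi.single_smul, smul_eq_mul, mul_one]
  rw [this, map_smul, smul_eq_mul, mul_comm]

theorem coeff_linPoly (φ : Module.Dual K (Fin ℓ → K)) (i : Fin ℓ) :
    coeff (Finsupp.single i 1) (linPoly φ) = φ (Pi.single i 1) := by
  simp only [linPoly, coeff_sum, coeff_C_mul, coeff_X']
  rw [Finset.sum_eq_single i]
  · simp
  · intro b _ hb
    simp [Finsupp.single_left_inj, hb]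
  · simp

theorem linPoly_injective : Function.Injective (linPoly (K := K) (ℓ := ℓ)) := by
  intro φ ψ h
  refine LinearMap.ext fun v => ?_
  rw [dual_apply_eq φ, dual_apply_eq ψ]
  refine Finset.sum_congr rfl fun i _ => ?_
  rw [← coeff_linPoly, h, coeff_linPoly]

theorem linPoly_zero : linPoly (0 : Module.Dual K (Fin ℓ → K)) = 0 := lpL.map_zero

theorem linPoly_ne_zero {φ : Module.Dual K (Fin ℓ → K)} (h : φ ≠ 0) : linPoly φ ≠ 0 := by
  intro h0
  exact h (linPoly_injective (h0.trans linPoly_zero.symm))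

theorem linPoly_homog (φ : Module.Dual K (Fin ℓ → K)) : (linPoly φ).IsHomogeneous 1 :=
  IsHomogeneous.sum _ _ _ fun i _ => isHomogeneous_C_mul_X _ _

theorem linPoly_proj (i : Fin ℓ) : linPoly (LinearMap.proj i : Module.Dual K (Fin ℓ → K)) = X i := by
  simp only [linPoly, LinearMap.proj_apply]
  rw [Finset.sum_eq_single i]
  · simp
  · intro b _ hb
    rw [Pi.single_eq_of_ne (Ne.symm hb)]; simp
  · simp

theorem linPoly_totalDegree {φ : Module.Dual K (Fin ℓ → K)} (h : φ ≠ 0) :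
    (linPoly φ).totalDegree = 1 := (linPoly_homog φ).totalDegree (linPoly_ne_zero h)

theorem linPoly_irreducible {φ : Module.Dual K (Fin ℓ → K)} (h : φ ≠ 0) :
    Irreducible (linPoly φ) := by
  apply irreducible_of_totalDegree_eq_one (linPoly_totalDegree h)
  intro x hx
  have : ∃ i, φ (Pi.single i 1) ≠ 0 := by
    by_contra hc
    push Not at hc
    apply h
    refine LinearMap.ext fun v => ?_
    rw [dual_apply_eq]; simp [hc]
  obtain ⟨i, hi⟩ := this
  have h1 := hx (Finsupp.single i 1)
  rw [coeff_linPoly] at h1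
  exact isUnit_of_dvd_unit h1 (isUnit_iff_ne_zero.2 hi)

theorem linPoly_prime {φ : Module.Dual K (Fin ℓ → K)} (h : φ ≠ 0) : Prime (linPoly φ) :=
  (linPoly_irreducible h).prime

theorem dvd_linPoly {φ ψ : Module.Dual K (Fin ℓ → K)} (hψ : ψ ≠ 0)
    (h : linPoly φ ∣ linPoly ψ) : LinearMap.ker φ = LinearMap.ker ψ := by
  obtain ⟨g, hg⟩ := h
  have hφ : φ ≠ 0 := by
    rintro rfl
    rw [linPoly_zero, zero_mul] at hg
    exact linPoly_ne_zero hψ hg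
  have hg0 : g ≠ 0 := by
    rintro rfl
    rw [mul_zero] at hg
    exact linPoly_ne_zero hψ hg
  have hd := totalDegree_mul_of_isDomain (linPoly_ne_zero hφ) hg0
  rw [← hg, linPoly_totalDegree hφ, linPoly_totalDegree hψ] at hd
  have hg1 : g = C (coeff 0 g) := (totalDegree_eq_zero_iff_eq_C).1 (by omega)
  set c := coeff 0 g
  have hc : c ≠ 0 := by
    intro hc; rw [hc] at hg1; exact hg0 (by rw [hg1]; simp)
  have : ψ = c • φ := by
    apply linPoly_injective
    rw [hg, hg1, ← lpL_apply (c • φ), map_smul, lpL_apply, smul_eq_C_mul, mul_comm]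
  rw [this, LinearMap.ker_smul _ _ hc]

theorem ker_eq_smul {φ ψ : Module.Dual K (Fin ℓ → K)}
    (h : LinearMap.ker φ = LinearMap.ker ψ) : ∃ c : K, ψ = c • φ := by
  have := FiniteDimensional.mem_span_of_iInf_ker_le_ker (𝕜 := K) (L := fun _ : Unit => φ) (K := ψ)
    (by simp [h])
  simp only [Set.range_const] at this
  obtain ⟨c, hc⟩ := Submodule.mem_span_singleton.1 this
  exact ⟨c, hc.symm⟩

/-- A chosen linear form with kernel `H`. -/
def frm (H : Submodule K (Fin ℓ → K)) : Module.Dual K (Fin ℓ → K) :=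
  if h : ∃ φ : Module.Dual K (Fin ℓ → K), φ ≠ 0 ∧ LinearMap.ker φ = H then h.choose else 0

def lf (H : Submodule K (Fin ℓ → K)) : MvPolynomial (Fin ℓ) K := linPoly (frm H)

section
variable {A : Finset (Submodule K (Fin ℓ → K))}
  {H L : Submodule K (Fin ℓ → K)}

theorem frm_ne (hA : IsArrangement A) (hH : H ∈ A) : frm H ≠ 0 := by
  have h := hA H hH
  rw [frm, dif_pos h]; exact h.choose_spec.1

theorem frm_ker (hA : IsArrangement A) (hH : H ∈ A) : LinearMap.ker (frm H) = H := by
  have h := hA H hH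
  rw [frm, dif_pos h]; exact h.choose_spec.2

theorem lf_ne (hA : IsArrangement A) (hH : H ∈ A) : lf H ≠ 0 := linPoly_ne_zero (frm_ne hA hH)
theorem lf_prime (hA : IsArrangement A) (hH : H ∈ A) : Prime (lf H) := linPoly_prime (frm_ne hA hH)
theorem lf_dvd (hA : IsArrangement A) (hH : H ∈ A) (hL : L ∈ A) (h : lf H ∣ lf L) : H = L := by
  have := dvd_linPoly (frm_ne hA hL) h
  rwa [frm_ker hA hH, frm_ker hA hL] at this

theorem lf_relPrime (hA : IsArrangement A) (hH : H ∈ A) (hL : L ∈ A) (h : H ≠ L) : IsRelPrime (lf H) (lf L) := by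
  rw [(lf_prime hA hH).irreducible.isRelPrime_iff_not_dvd]
  exact fun hd => h (lf_dvd hA hH hL hd)

theorem inD_iff (hA : IsArrangement A) (θ : Deriv K ℓ) : InD A θ ↔ ∀ H ∈ A, lf H ∣ applyLin θ (frm H) := by
  constructor
  · intro h H hH
    exact h H hH _ (frm_ker hA hH)
  · intro h H hH φ hφ
    rw [← frm_ker hA hH] at hφ
    obtain ⟨c, hc⟩ := ker_eq_smul hφ
    have h1 := h H hH
    have h2 : lf H = c • linPoly φ := by
      rw [lf, ← lpL_apply, hc, map_smul]; rfl
    have h3 : applyLin θ (frm H) = c • applyLin θ φ := by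
      rw [← apL_apply, hc, map_smul]; rfl
    rw [h2, h3, smul_eq_C_mul, smul_eq_C_mul] at h1
    have hc0 : c ≠ 0 := by
      rintro rfl
      exact frm_ne hA hH (by rw [hc, zero_smul])
    have hu : IsUnit (C c : MvPolynomial (Fin ℓ) K) := (isUnit_iff_ne_zero.2 hc0).map C
    rw [hu.mul_left_dvd, hu.dvd_mul_left] at h1
    exact h1

theorem IsArrangement.mono {B : Finset (Submodule K (Fin ℓ → K))} (hA : IsArrangement A)
    (h : B ⊆ A) : IsArrangement B := fun H hH => hA H (h hH)

end

/-- `D(A)` as a submodule. -/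
def DM (A : Finset (Submodule K (Fin ℓ → K))) :
    Submodule (MvPolynomial (Fin ℓ) K) (Deriv K ℓ) where
  carrier := {θ | InD A θ}
  add_mem' {a b} ha hb := by
    intro H hH φ hφ
    rw [applyLin_add]
    exact dvd_add (ha H hH φ hφ) (hb H hH φ hφ)
  zero_mem' := by
    intro H hH φ hφ
    rw [← apS_apply, map_zero]; exact dvd_zero _
  smul_mem' c x hx := by
    intro H hH φ hφ
    rw [applyLin_smul]
    exact (hx H hH φ hφ).mul_left c

theorem mem_DM {A : Finset (Submodule K (Fin ℓ → K))} {θ : Deriv K ℓ} :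
    θ ∈ DM A ↔ InD A θ := Iff.rfl

theorem DM_anti {A B : Finset (Submodule K (Fin ℓ → K))} (h : B ⊆ A) : DM A ≤ DM B :=
  fun _ hθ H hH => hθ H (h hH)

/-- Product of the defining forms. -/
def QQ (A : Finset (Submodule K (Fin ℓ → K))) : MvPolynomial (Fin ℓ) K := ∏ H ∈ A, lf H

theorem QQ_homog (A : Finset (Submodule K (Fin ℓ → K))) : (QQ A).IsHomogeneous A.card := by
  have := IsHomogeneous.prod A lf (fun _ => 1) (fun i _ => linPoly_homog (frm i))
  simpa [QQ] using this

theorem QQ_ne {A : Finset (Submodule K (Fin ℓ → K))} (hA : IsArrangement A) : QQ A ≠ 0 :=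
  Finset.prod_ne_zero_iff.2 fun _ h => lf_ne hA h

theorem QQ_dvd {A : Finset (Submodule K (Fin ℓ → K))} (hA : IsArrangement A)
    {f : MvPolynomial (Fin ℓ) K} (h : ∀ H ∈ A, lf H ∣ f) : QQ A ∣ f := by
  apply Finset.prod_dvd_of_isRelPrime _ h
  intro H hH L hL hne
  exact lf_relPrime hA hH hL hne

/-- `Q_{A \ B}` multiplies `D(B)` into `D(A)`. -/
theorem QQ_smul_mem {A B : Finset (Submodule K (Fin ℓ → K))} (hA : IsArrangement A)
    (hB : B ⊆ A) {θ : Deriv K ℓ} (hθ : θ ∈ DM B) : QQ (A \ B) • θ ∈ DM A := by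
  rw [mem_DM, inD_iff hA]
  intro H hH
  rw [applyLin_smul]
  by_cases h : H ∈ B
  · exact ((inD_iff (hA.mono hB) θ).1 hθ H h).mul_left _
  · exact (Finset.dvd_prod_of_mem lf (Finset.mem_sdiff.2 ⟨hH, h⟩)).mul_right _

/-- homogeneous component and multiplication by a homogeneous element -/
theorem homComp_mul {a f : MvPolynomial (Fin ℓ) K} {m : ℕ} (ha : a.IsHomogeneous m) (n : ℕ) :
    homogeneousComponent n (a * f) =
      if m ≤ n then a * homogeneousComponent (n - m) f else 0 := by
  have key : a * f = ∑ i ∈ Finset.range (f.totalDegree + 1), a * homogeneousComponent i f := by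
    rw [← Finset.mul_sum, sum_homogeneousComponent]
  have hmem : ∀ i, a * homogeneousComponent i f ∈ homogeneousSubmodule (Fin ℓ) K (m + i) :=
    fun i => ha.mul (homogeneousComponent_isHomogeneous i f)
  rw [key, map_sum]
  simp only [homogeneousComponent_of_mem (hmem _)]
  split_ifs with h
  · by_cases h2 : n - m ∈ Finset.range (f.totalDegree + 1)
    · rw [Finset.sum_eq_single_of_mem _ h2, if_pos (by omega)]
      intro b _ hb
      rw [if_neg (by omega)]
    · rw [homogeneousComponent_eq_zero (n - m) f (by simp at h2; omega), mul_zero]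
      apply Finset.sum_eq_zero
      intro b hb
      rw [if_neg]
      rintro rfl
      apply h2
      simpa using hb
  · apply Finset.sum_eq_zero
    intro b _
    rw [if_neg (by omega)]

theorem homComp_dvd {a f : MvPolynomial (Fin ℓ) K} {m : ℕ} (ha : a.IsHomogeneous m) (n : ℕ)
    (h : a ∣ f) : a ∣ homogeneousComponent n f := by
  obtain ⟨g, rfl⟩ := h
  rw [homComp_mul ha]
  split_ifs
  · exact dvd_mul_right _ _
  · exact dvd_zero _

/-- component of a derivation -/
def dComp (n : ℕ) (θ : Deriv K ℓ) : Deriv K ℓ := fun i => homogeneousComponent n (θ i)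

theorem dComp_homog (n : ℕ) (θ : Deriv K ℓ) : HomogDeriv (dComp n θ) n :=
  fun i => homogeneousComponent_isHomogeneous n (θ i)

theorem applyLin_dComp (n : ℕ) (θ : Deriv K ℓ) (φ : Module.Dual K (Fin ℓ → K)) :
    applyLin (dComp n θ) φ = homogeneousComponent n (applyLin θ φ) := by
  simp only [applyLin, dComp, map_sum, homogeneousComponent_C_mul]

theorem dComp_mem {A : Finset (Submodule K (Fin ℓ → K))} (n : ℕ) {θ : Deriv K ℓ}
    (h : θ ∈ DM A) : dComp n θ ∈ DM A := by
  intro H hH φ hφ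
  rw [applyLin_dComp]
  exact homComp_dvd (linPoly_homog φ) n (h H hH φ hφ)

theorem dComp_add (n : ℕ) (θ η : Deriv K ℓ) : dComp n (θ + η) = dComp n θ + dComp n η := by
  funext i; simp [dComp]

theorem dComp_sum {ι : Type*} (n : ℕ) (s : Finset ι) (θ : ι → Deriv K ℓ) :
    dComp n (∑ j ∈ s, θ j) = ∑ j ∈ s, dComp n (θ j) := by
  funext i; simp [dComp]

theorem dComp_self {n : ℕ} {θ : Deriv K ℓ} (h : HomogDeriv θ n) : dComp n θ = θ := by
  funext i; exact homogeneousComponent_eq_self (h i)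

theorem dComp_smul_left {a : MvPolynomial (Fin ℓ) K} {m : ℕ} (ha : a.IsHomogeneous m) (n : ℕ)
    (θ : Deriv K ℓ) : dComp n (a • θ) = if m ≤ n then a • dComp (n - m) θ else 0 := by
  funext i
  simp only [dComp, Pi.smul_apply, smul_eq_mul, homComp_mul ha]
  split_ifs <;> rfl

theorem dComp_smul_right {θ : Deriv K ℓ} {m : ℕ} (hθ : HomogDeriv θ m) (n : ℕ)
    (a : MvPolynomial (Fin ℓ) K) :
    dComp n (a • θ) = (if m ≤ n then homogeneousComponent (n - m) a else 0) • θ := by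
  funext i
  simp only [dComp, Pi.smul_apply, smul_eq_mul]
  rw [mul_comm, homComp_mul (hθ i)]
  split_ifs
  · rw [mul_comm]
  · rw [zero_mul]

/-! Restriction to a subspace via a projector. -/

def res (π : (Fin ℓ → K) →ₗ[K] (Fin ℓ → K)) :
    MvPolynomial (Fin ℓ) K →ₐ[K] MvPolynomial (Fin ℓ) K :=
  aeval (fun i => linPoly ((LinearMap.proj i : Module.Dual K (Fin ℓ → K)) ∘ₗ π))

theorem res_linPoly (π : (Fin ℓ → K) →ₗ[K] (Fin ℓ → K)) (φ : Module.Dual K (Fin ℓ → K)) :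
    res π (linPoly φ) = linPoly (φ ∘ₗ π) := by
  have h : φ ∘ₗ π = ∑ i, φ (Pi.single i 1) •
      ((LinearMap.proj i : Module.Dual K (Fin ℓ → K)) ∘ₗ π) := by
    refine LinearMap.ext fun v => ?_
    simp only [LinearMap.comp_apply, LinearMap.sum_apply, LinearMap.smul_apply,
      LinearMap.proj_apply, smul_eq_mul]
    exact dual_apply_eq φ (π v)
  rw [h, ← lpL_apply (∑ i, _), map_sum]
  simp only [linPoly, map_sum, map_mul, res, aeval_X, map_smul, smul_eq_C_mul]
  refine Finset.sum_congr rfl fun i _ => ?_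
  rw [MvPolynomial.algHom_C]; rfl

/-- Modulo linear forms vanishing on the range of the projector, `res` is the identity. -/
theorem sub_res_mem (π : (Fin ℓ → K) →ₗ[K] (Fin ℓ → K)) (I : Ideal (MvPolynomial (Fin ℓ) K))
    (hI : ∀ φ : Module.Dual K (Fin ℓ → K), linPoly (φ - φ ∘ₗ π) ∈ I)
    (f : MvPolynomial (Fin ℓ) K) : f - res π f ∈ I := by
  rw [← Ideal.Quotient.eq]
  have : ((Ideal.Quotient.mkₐ K I)) = (Ideal.Quotient.mkₐ K I).comp (res π) := by
    apply MvPolynomial.algHom_ext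
    intro i
    have := hI (LinearMap.proj i)
    rw [← lpL_apply, map_sub, lpL_apply, lpL_apply, linPoly_proj, ← Ideal.Quotient.eq] at this
    simpa [res] using this
  exact congrArg (fun g => g f) this

theorem exists_projector (Y : Submodule K (Fin ℓ → K)) :
    ∃ π : (Fin ℓ → K) →ₗ[K] (Fin ℓ → K), (∀ v, π v ∈ Y) ∧ ∀ v ∈ Y, π v = v := by
  obtain ⟨g, hg⟩ := Y.subtype.exists_leftInverse_of_injective Y.ker_subtype
  refine ⟨Y.subtype ∘ₗ g, fun v => (g v).2, fun v hv => ?_⟩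
  have := LinearMap.congr_fun hg ⟨v, hv⟩
  simpa using congrArg Subtype.val this

/-- Linear forms vanishing on `⨅ ker` of a finite family lie in any ideal containing them. -/
theorem linPoly_mem_of_family {ι : Type*} (φ : ι → Module.Dual K (Fin ℓ → K))
    {I : Ideal (MvPolynomial (Fin ℓ) K)} (hI : ∀ i, linPoly (φ i) ∈ I)
    {ψ : Module.Dual K (Fin ℓ → K)} (h : ⨅ i, LinearMap.ker (φ i) ≤ LinearMap.ker ψ) :
    linPoly ψ ∈ I := by
  have := FiniteDimensional.mem_span_of_iInf_ker_le_ker h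
  refine Submodule.span_induction (p := fun ψ _ => linPoly ψ ∈ I) ?_ ?_ ?_ ?_ this
  · rintro _ ⟨i, rfl⟩; exact hI i
  · rw [linPoly_zero]; exact I.zero_mem
  · intro x y _ _ hx hy
    rw [← lpL_apply, map_add]; exact I.add_mem hx hy
  · intro c x _ hx
    rw [← lpL_apply, map_smul, lpL_apply, smul_eq_C_mul]; exact I.mul_mem_left _ hx


theorem ex_coord {φ : Module.Dual K (Fin ℓ → K)} (h : φ ≠ 0) : ∃ i, φ (Pi.single i 1) ≠ 0 := by
  by_contra hc
  push Not at hc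
  apply h
  refine LinearMap.ext fun v => ?_
  rw [dual_apply_eq]; simp [hc]

theorem isUnit_C' {c : K} (hc : c ≠ 0) : IsUnit (C c : MvPolynomial (Fin ℓ) K) :=
  (isUnit_iff_ne_zero.2 hc).map C

abbrev dmat (θ : Fin ℓ → Deriv K ℓ) : Matrix (Fin ℓ) (Fin ℓ) (MvPolynomial (Fin ℓ) K) :=
  Matrix.of θ

theorem det_homog {θ : Fin ℓ → Deriv K ℓ} {e : Fin ℓ → ℕ} (h : ∀ i, HomogDeriv (θ i) (e i)) :
    (dmat θ).det.IsHomogeneous (∑ i, e i) := by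
  rw [← Matrix.det_transpose, Matrix.det_apply]
  apply IsHomogeneous.sum
  intro σ _
  have h1 : (∏ i, (dmat θ).transpose (σ i) i).IsHomogeneous (∑ i, e i) :=
    IsHomogeneous.prod _ _ _ fun i _ => h i (σ i)
  rcases Int.units_eq_one_or (Equiv.Perm.sign σ) with hs | hs
  · rw [hs, one_smul]; exact h1
  · rw [hs, Units.neg_smul, one_smul]; exact h1.neg

theorem saito_dvd {A : Finset (Submodule K (Fin ℓ → K))} (hA : IsArrangement A)
    {θ : Fin ℓ → Deriv K ℓ} (h : ∀ i, θ i ∈ DM A) : QQ A ∣ (dmat θ).det := by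
  apply QQ_dvd hA
  intro L hL
  obtain ⟨j, hj⟩ := ex_coord (frm_ne hA hL)
  set a : Fin ℓ → MvPolynomial (Fin ℓ) K := fun i => C (frm L (Pi.single i 1))
  have h1 : ∀ i, lf L ∣ ((dmat θ).mulVec a) i := by
    intro i
    have := (inD_iff hA _).1 (h i) L hL
    convert this using 1
    simp [Matrix.mulVec, dotProduct, applyLin, a, mul_comm]
  have h2 : (dmat θ).det * a j = ((dmat θ).adjugate.mulVec ((dmat θ).mulVec a)) j := by
    rw [Matrix.mulVec_mulVec, Matrix.adjugate_mul, Matrix.smul_mulVec, Matrix.one_mulVec]; rfl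
  have h3 : lf L ∣ (dmat θ).det * a j := by
    rw [h2]
    show _ ∣ ∑ i : Fin ℓ, (dmat θ).adjugate j i * _
    exact Finset.dvd_sum fun i _ => (h1 i).mul_left _
  exact ((isUnit_C' hj).dvd_mul_right).1 h3

theorem saito_basis {A : Finset (Submodule K (Fin ℓ → K))} (hA : IsArrangement A)
    {θ : Fin ℓ → Deriv K ℓ} (h : ∀ i, θ i ∈ DM A) {c : K} (hc : c ≠ 0)
    (hdet : (dmat θ).det = C c * QQ A) : GeneratesD A θ ∧ IndepD θ := by
  have hne : (dmat θ).det ≠ 0 := by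
    rw [hdet]; exact mul_ne_zero (isUnit_C' hc).ne_zero (QQ_ne hA)
  refine ⟨⟨h, fun η hη => ?_⟩, fun c hc => ?_⟩
  · have h1 : ∀ i, QQ A ∣ (Matrix.cramer (dmat θ).transpose η) i := by
      intro i
      rw [Matrix.cramer_transpose_apply]
      have : (dmat θ).updateRow i η = dmat (Function.update θ i η) := by
        rfl
      rw [this]
      apply saito_dvd hA
      intro k
      by_cases hk : k = i
      · subst hk; rw [Function.update_self]; exact hη
      · simpa [hk] using h k
    choose g hg using h1
    have h2 := Matrix.mulVec_cramer (dmat θ).transpose η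
    rw [Matrix.det_transpose, hdet] at h2
    have h3 : (C c : MvPolynomial (Fin ℓ) K) • η = ∑ i, g i • θ i := by
      funext j
      apply mul_left_cancel₀ (QQ_ne hA)
      have := congrFun h2 j
      simp only [Matrix.mulVec, dotProduct, Matrix.transpose_apply, Matrix.of_apply, hg,
        Pi.smul_apply, smul_eq_mul] at this
      rw [Finset.sum_apply, Pi.smul_apply, smul_eq_mul, ← mul_assoc, mul_comm _ (C c), ← this,
        Finset.mul_sum]
      refine Finset.sum_congr rfl fun i _ => ?_
      simp only [Pi.smul_apply, smul_eq_mul]; ring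
    refine ⟨fun i => C c⁻¹ * g i, ?_⟩
    simp only [mul_smul]
    rw [← Finset.smul_sum, ← h3, smul_smul, ← C_mul, inv_mul_cancel₀ hc, C_1, one_smul]
  · have : Matrix.vecMul c (dmat θ) = 0 := by
      funext j
      have := congrFun hc j
      rw [Finset.sum_apply] at this
      simpa [Matrix.vecMul, dotProduct] using this
    exact fun i => congrFun (Matrix.eq_zero_of_vecMul_eq_zero hne this) i

theorem gen_det_dvd {A : Finset (Submodule K (Fin ℓ → K))}
    {θ η : Fin ℓ → Deriv K ℓ} (hg : GeneratesD A θ) (h : ∀ i, η i ∈ DM A) :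
    (dmat θ).det ∣ (dmat η).det := by
  choose c hc using fun i => hg.2 (η i) (h i)
  have : dmat η = (Matrix.of c) * dmat θ := by
    ext1 i j
    have := congrFun (hc i) j
    rw [Finset.sum_apply] at this
    simpa [Matrix.mul_apply] using this
  rw [this, Matrix.det_mul]
  exact dvd_mul_left _ _

theorem smul_QQ_mem {A : Finset (Submodule K (Fin ℓ → K))} (hA : IsArrangement A) (θ : Deriv K ℓ) :
    QQ A • θ ∈ DM A := by
  have := QQ_smul_mem hA (Finset.empty_subset A) (θ := θ) (by intro H hH; simp at hH)
  simpa using this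

theorem saito_det {A : Finset (Submodule K (Fin ℓ → K))} (hA : IsArrangement A)
    {θ : Fin ℓ → Deriv K ℓ} (hg : GeneratesD A θ) :
    ∃ c : K, c ≠ 0 ∧ (dmat θ).det = C c * QQ A := by
  obtain ⟨g, hgd⟩ := saito_dvd hA hg.1
  have hpow : g ∣ QQ A ^ ℓ := by
    have h1 := gen_det_dvd hg (η := fun i => QQ A • Pi.single i 1) (fun i => smul_QQ_mem hA _)
    have h2 : dmat (fun i => QQ A • (Pi.single i 1 : Deriv K ℓ)) = QQ A • 1 := by
      ext1 i j
      simp [Matrix.one_apply, Pi.single_apply, eq_comm]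
    rw [h2, Matrix.det_smul, Matrix.det_one, mul_one, Fintype.card_fin] at h1
    exact (Dvd.intro_left _ hgd.symm).trans h1
  have hgne : g ≠ 0 := fun h0 => by
    rw [h0, zero_dvd_iff] at hpow
    exact pow_ne_zero _ (QQ_ne hA) hpow
  have hL : ∀ L ∈ A, ¬ lf L ∣ g := by
    intro L hL hdvd
    obtain ⟨j0, hj⟩ := ex_coord (frm_ne hA hL)
    set a := fun i => frm L (Pi.single i 1) with ha
    set v : Fin ℓ → MvPolynomial (Fin ℓ) K :=
      fun i => if i = j0 then lf L else - C (a i / a j0) with hv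
    set N : Matrix (Fin ℓ) (Fin ℓ) (MvPolynomial (Fin ℓ) K) := Matrix.updateCol 1 j0 v with hN
    have hNdet : N.det = lf L := by
      rw [hN, ← Matrix.cramer_apply, Matrix.cramer_one]; simp [hv]
    have hsub : ({L} : Finset _) ⊆ A := by simpa using hL
    have h1 := gen_det_dvd hg (η := fun i => QQ (A \ {L}) • N i) (by
      intro i
      apply QQ_smul_mem hA hsub
      rw [mem_DM, inD_iff (hA.mono hsub)]
      intro H hH
      rw [Finset.mem_singleton] at hH
      subst hH
      have h2 : applyLin (N i) (frm H) = C (a i) * (if i = j0 then 0 else 1) + C (a j0) * v i := by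
        have : N i = fun k => if k = j0 then v i else if k = i then 1 else 0 := by
          funext k
          simp only [hN, Matrix.updateCol_apply, Matrix.one_apply]
          by_cases hk : k = j0
          · simp [hk]
          · simp [hk, eq_comm]
        rw [this, applyLin, ← Finset.add_sum_erase _ _ (Finset.mem_univ j0), if_pos rfl, add_comm]
        congr 1
        by_cases hi : i = j0
        · rw [if_pos hi, mul_zero]
          apply Finset.sum_eq_zero
          intro k hk
          have hk' := Finset.ne_of_mem_erase hk
          rw [if_neg hk', if_neg (by rw [hi]; exact hk'), mul_zero]
        · rw [if_neg hi, Finset.sum_eq_single i]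
          · rw [if_neg hi, if_pos rfl]
          · intro k hk hki
            rw [if_neg (Finset.ne_of_mem_erase hk), if_neg hki, mul_zero]
          · intro hh; exact absurd (Finset.mem_erase.2 ⟨hi, Finset.mem_univ _⟩) hh
      rw [h2]
      by_cases hi : i = j0
      · simp [hv, hi]
      · simp only [hv, hi, if_false, mul_one, mul_neg, ← C_mul]
        rw [show a j0 * (a i / a j0) = a i from mul_div_cancel₀ _ hj]
        simp)
    have h2 : dmat (fun i => QQ (A \ {L}) • N i) = QQ (A \ {L}) • N := rfl
    have hQ : QQ A = lf L * QQ (A \ {L}) := by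
      rw [QQ, ← Finset.prod_sdiff hsub, mul_comm]; simp [QQ]
    rw [h2, Matrix.det_smul, hNdet, hgd, hQ, mul_comm (_ ^ _), mul_assoc] at h1
    have h3 := (mul_dvd_mul_iff_left (lf_ne hA hL)).1 h1
    have h4 : lf L ∣ QQ (A \ {L}) ^ Fintype.card (Fin ℓ) :=
      (hdvd.trans (dvd_mul_left _ _)).trans h3
    have h5 := (lf_prime hA hL).dvd_of_dvd_pow h4
    obtain ⟨M, hM, hd⟩ := ((lf_prime hA hL).dvd_finsetProd_iff _).1 h5
    rw [Finset.mem_sdiff, Finset.mem_singleton] at hM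
    exact hM.2 (lf_dvd hA hL hM.1 hd).symm
  have hu : IsUnit g := by
    by_contra hnu
    obtain ⟨p, hp, hpg⟩ := WfDvdMonoid.exists_irreducible_factor hnu hgne
    obtain ⟨M, hM, hd⟩ := (hp.prime.dvd_finsetProd_iff _).1 (hp.prime.dvd_of_dvd_pow (hpg.trans hpow))
    exact hL M hM (((hp.associated_of_dvd (lf_prime hA hM).irreducible hd).symm.dvd).trans hpg)
  obtain ⟨c, hc, hcg⟩ := MvPolynomial.isUnit_iff_eq_C_of_isReduced.1 hu
  exact ⟨c, hc.ne_zero, by rw [hgd, hcg, mul_comm]⟩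


theorem loc_sub (A : Finset (Submodule K (Fin ℓ → K))) (X : Submodule K (Fin ℓ → K)) :
    localize A X ⊆ A := Finset.filter_subset _ _

def sg {d : ℕ} (v : Fin d → Fin ℓ → K) :
    MvPolynomial (Fin ℓ) K →ₐ[K] Polynomial (MvPolynomial (Fin ℓ) K) :=
  aeval (fun i => Polynomial.C (X i) +
    ∑ j : Fin d, Polynomial.C (C (v j i)) * Polynomial.X ^ (j : ℕ))

theorem sg_linPoly {d : ℕ} (v : Fin d → Fin ℓ → K) (φ : Module.Dual K (Fin ℓ → K)) :
    sg v (linPoly φ) = Polynomial.C (linPoly φ) +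
      ∑ j : Fin d, Polynomial.C (C (φ (v j))) * Polynomial.X ^ (j : ℕ) := by
  have hC : ∀ c : K, sg v (C c) = Polynomial.C (C c) := fun c => MvPolynomial.algHom_C _ c
  have h2 : ∀ j, φ (v j) = ∑ i, φ (Pi.single i 1) * v j i := fun j => dual_apply_eq φ (v j)
  simp only [h2, linPoly, map_sum, map_mul, hC, Finset.sum_mul]
  rw [Finset.sum_comm, ← Finset.sum_add_distrib]
  refine Finset.sum_congr rfl fun i _ => ?_
  simp only [sg, aeval_X, mul_add, Finset.mul_sum, mul_assoc]

def sgE {d : ℕ} (v : Fin d → Fin ℓ → K) (m k : ℕ) (θ : Deriv K ℓ) : Deriv K ℓ :=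
  fun i => homogeneousComponent k ((sg v (θ i)).coeff m)

theorem sgE_mem {d : ℕ} {v : Fin d → Fin ℓ → K} {A : Finset (Submodule K (Fin ℓ → K))}
    (hA : IsArrangement A) {X : Submodule K (Fin ℓ → K)} (hv : ∀ j, v j ∈ X) (m k : ℕ)
    {θ : Deriv K ℓ} (hθ : θ ∈ DM A) : sgE v m k θ ∈ DM (localize A X) := by
  rw [mem_DM, inD_iff (hA.mono (loc_sub A X))]
  intro L hL
  have hL' := Finset.mem_filter.1 hL
  have h1 : applyLin (sgE v m k θ) (frm L) =
      homogeneousComponent k ((sg v (applyLin θ (frm L))).coeff m) := by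
    simp only [applyLin, sgE, map_sum, map_mul, Polynomial.finsetSum_coeff]
    refine Finset.sum_congr rfl fun i _ => ?_
    rw [show sg v (C ((frm L) (Pi.single i 1))) = Polynomial.C (C _) from MvPolynomial.algHom_C _ _,
      Polynomial.coeff_C_mul, homogeneousComponent_C_mul]
  rw [h1]
  apply homComp_dvd (linPoly_homog (frm L))
  obtain ⟨g, hg⟩ := (inD_iff hA _).1 hθ L hL'.1
  rw [hg, map_mul, lf, sg_linPoly]
  have : ∀ j, frm L (v j) = 0 := fun j => by
    have := hL'.2 (hv j)
    rw [← frm_ker hA hL'.1] at this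
    exact this
  simp [this]

theorem sg_QQ_ne {d : ℕ} {v : Fin d → Fin ℓ → K} {B : Finset (Submodule K (Fin ℓ → K))}
    (hB : IsArrangement B) (hv : ∀ L ∈ B, ∃ j, v j ∉ L) :
    ∃ M, constantCoeff ((sg v (QQ B)).coeff M) ≠ 0 := by
  have : Polynomial.map constantCoeff (sg v (QQ B)) ≠ 0 := by
    rw [QQ, map_prod, Polynomial.map_prod, Finset.prod_ne_zero_iff]
    intro L hL h0
    obtain ⟨j, hj⟩ := hv L hL
    have h1 := congrArg (fun p => Polynomial.coeff p (j : ℕ)) h0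
    simp only [lf, sg_linPoly, Polynomial.map_add, Polynomial.map_sum, Polynomial.map_mul,
      Polynomial.map_pow, Polynomial.map_C, Polynomial.map_X, constantCoeff_C,
      Polynomial.coeff_add, Polynomial.finsetSum_coeff, Polynomial.coeff_C_mul,
      Polynomial.coeff_X_pow, Polynomial.coeff_zero] at h1
    have h2 : constantCoeff (linPoly (frm L)) = 0 := by simp [linPoly]
    rw [h2, map_zero, Polynomial.coeff_zero, zero_add, Finset.sum_eq_single j] at h1
    · rw [if_pos rfl, mul_one] at h1
      apply hj
      rw [← frm_ker hB hL]; exact h1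
    · intro b _ hb
      rw [if_neg (fun h => hb (Fin.ext h.symm)), mul_zero]
    · simp
  by_contra hc
  push Not at hc
  apply this
  ext n
  rw [Polynomial.coeff_map, hc, Polynomial.coeff_zero]

theorem poly_expand (p : Polynomial (MvPolynomial (Fin ℓ) K)) {N N' : ℕ} (hN : p.natDegree < N)
    (hN' : ∀ m, (p.coeff m).totalDegree < N') :
    p = ∑ r : Fin N × Fin N', Polynomial.X ^ (r.1 : ℕ) *
      Polynomial.C (homogeneousComponent (r.2 : ℕ) (p.coeff r.1)) := by
  rw [Fintype.sum_prod_type]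
  conv_lhs => rw [p.as_sum_range' N hN]
  rw [← Fin.sum_univ_eq_sum_range (fun i => Polynomial.monomial i (p.coeff i))]
  refine Finset.sum_congr rfl fun m _ => ?_
  dsimp only
  rw [← Finset.mul_sum, ← map_sum, mul_comm, Polynomial.C_mul_X_pow_eq_monomial]
  congr 1
  rw [Fin.sum_univ_eq_sum_range (fun i => homogeneousComponent i (p.coeff m))]
  conv_lhs => rw [← sum_homogeneousComponent (p.coeff m)]
  apply Finset.sum_subset
  · intro a ha
    have := hN' m
    simp only [Finset.mem_range] at *; omega
  · intro a _ ha
    apply homogeneousComponent_eq_zero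
    simpa using ha

theorem free_localize {A : Finset (Submodule K (Fin ℓ → K))} (hA : IsArrangement A)
    (hf : IsFree A) (X : Submodule K (Fin ℓ → K)) : IsFree (localize A X) := by
  obtain ⟨e, θ, hθ, hgen, hind⟩ := hf
  obtain ⟨c, hc, hdet⟩ := saito_det hA hgen
  set v : Fin (Module.finrank K X) → Fin ℓ → K := fun j => (Module.finBasis K X j : Fin ℓ → K)
  have hvX : ∀ j, v j ∈ X := fun j => (Module.finBasis K X j).2
  have hsub : localize A X ⊆ A := Finset.filter_subset _ _
  have hAX := hA.mono hsub
  have hv : ∀ L ∈ A \ localize A X, ∃ j, v j ∉ L := by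
    intro L hL
    rw [Finset.mem_sdiff] at hL
    by_contra hcon
    push Not at hcon
    apply hL.2
    refine Finset.mem_filter.2 ⟨hL.1, ?_⟩
    intro x hx
    have := (Module.finBasis K X).sum_repr ⟨x, hx⟩
    have := congrArg Subtype.val this
    simp only [Submodule.coe_sum, Submodule.coe_smul] at this
    rw [← this]
    exact Submodule.sum_mem _ fun j _ => Submodule.smul_mem _ _ (hcon j)
  obtain ⟨M, hM⟩ := sg_QQ_ne (hA.mono Finset.sdiff_subset) hv
  obtain ⟨N, hN⟩ : ∃ N, ∀ i j, (sg v (θ i j)).natDegree < N := by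
    refine ⟨(∑ i, ∑ j, (sg v (θ i j)).natDegree) + 1, fun i j => Nat.lt_succ_of_le ?_⟩
    refine le_trans ?_ (Finset.single_le_sum (f := fun i => ∑ j, (sg v (θ i j)).natDegree)
      (fun _ _ => Nat.zero_le _) (Finset.mem_univ i))
    exact Finset.single_le_sum (f := fun j => (sg v (θ i j)).natDegree)
      (fun _ _ => Nat.zero_le _) (Finset.mem_univ j)
  obtain ⟨N', hN'⟩ : ∃ N', ∀ i j m, ((sg v (θ i j)).coeff m).totalDegree < N' := by
    have h1 : ∀ i j, ∃ n, ∀ m, ((sg v (θ i j)).coeff m).totalDegree < n := by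
      intro i j
      refine ⟨(∑ m ∈ Finset.range N, ((sg v (θ i j)).coeff m).totalDegree) + 1, fun m => ?_⟩
      by_cases hm : m < N
      · exact Nat.lt_succ_of_le (Finset.single_le_sum
          (f := fun m => ((sg v (θ i j)).coeff m).totalDegree)
          (fun _ _ => Nat.zero_le _) (Finset.mem_range.2 hm))
      · rw [Polynomial.coeff_eq_zero_of_natDegree_lt (lt_of_lt_of_le (hN i j) (not_lt.1 hm))]
        simp
    choose n hn using h1
    refine ⟨∑ i, ∑ j, n i j, fun i j m => lt_of_lt_of_le (hn i j m) ?_⟩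
    refine le_trans ?_ (Finset.single_le_sum (f := fun i => ∑ j, n i j)
      (fun _ _ => Nat.zero_le _) (Finset.mem_univ i))
    exact Finset.single_le_sum (f := fun j => n i j)
      (fun _ _ => Nat.zero_le _) (Finset.mem_univ j)
  set D : (Fin ℓ → Fin N × Fin N') → MvPolynomial (Fin ℓ) K :=
    fun r => (dmat (fun i => sgE v (r i).1 (r i).2 (θ i))).det with hD
  have hexp : sg v (dmat θ).det = ∑ r : Fin ℓ → Fin N × Fin N',
      Polynomial.X ^ (∑ i, ((r i).1 : ℕ)) * Polynomial.C (D r) := by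
    have h1 : sg v (dmat θ).det = Matrix.detRowAlternating.toMultilinearMap (fun i =>
        ∑ r : Fin N × Fin N', (fun j => Polynomial.X ^ (r.1 : ℕ) *
          Polynomial.C (sgE v r.1 r.2 (θ i) j) : Fin ℓ → Polynomial (MvPolynomial (Fin ℓ) K))) := by
      rw [AlgHom.map_det]
      show Matrix.det _ = Matrix.det _
      congr 1
      ext1 i j
      rw [Finset.sum_apply]
      exact poly_expand _ (hN i j) (hN' i j)
    rw [h1, MultilinearMap.map_sum]
    refine Finset.sum_congr rfl fun r _ => ?_
    show Matrix.det _ = _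
    have h2 := Matrix.det_mul_column (fun i => (Polynomial.X : Polynomial (MvPolynomial (Fin ℓ) K)) ^ ((r i).1 : ℕ))
      (Polynomial.C.mapMatrix (dmat (fun i => sgE v (r i).1 (r i).2 (θ i))))
    rw [Finset.prod_pow_eq_pow_sum, ← RingHom.map_det] at h2
    rw [hD, ← h2]
    rfl
  obtain ⟨r, hr1, hr2⟩ : ∃ r, D r ≠ 0 ∧ ∑ i, ((r i).2 : ℕ) = (localize A X).card := by
    by_contra hcon
    push Not at hcon
    have hhom : ∀ r, (D r).IsHomogeneous (∑ i, ((r i).2 : ℕ)) := fun r =>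
      det_homog fun i j => homogeneousComponent_isHomogeneous _ _
    have h0 : homogeneousComponent (localize A X).card ((sg v (dmat θ).det).coeff M) = 0 := by
      rw [hexp, Polynomial.finsetSum_coeff, map_sum]
      apply Finset.sum_eq_zero
      intro r _
      by_cases hr : D r = 0
      · simp [hr]
      · rw [Polynomial.coeff_mul_C, Polynomial.coeff_X_pow]
        split_ifs
        · rw [one_mul, homogeneousComponent_of_mem (hhom r), if_neg (Ne.symm (hcon r hr))]
        · simp
    have hQ : QQ A = QQ (localize A X) * QQ (A \ localize A X) := by
      rw [QQ, ← Finset.prod_sdiff hsub, mul_comm]; rfl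
    have hs : sg v (QQ (localize A X)) = Polynomial.C (QQ (localize A X)) := by
      rw [QQ, map_prod, map_prod]
      refine Finset.prod_congr rfl fun L hL => ?_
      have hL' := Finset.mem_filter.1 hL
      have : ∀ j, frm L (v j) = 0 := fun j => by
        have := hL'.2 (hvX j)
        rw [← frm_ker hA hL'.1] at this
        exact this
      rw [lf, sg_linPoly]; simp [this]
    rw [hdet, map_mul, show sg v (C c) = Polynomial.C (C c) from MvPolynomial.algHom_C _ _, hQ,
      map_mul, hs, Polynomial.coeff_C_mul, Polynomial.coeff_C_mul, homogeneousComponent_C_mul,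
      homComp_mul (QQ_homog _), if_pos le_rfl, Nat.sub_self, homogeneousComponent_zero] at h0
    rcases mul_eq_zero.1 h0 with h | h
    · exact (isUnit_C' hc).ne_zero h
    rcases mul_eq_zero.1 h with h | h
    · exact QQ_ne hAX h
    · exact hM (by rwa [C_eq_zero] at h)
  have hmem : ∀ i, sgE v (r i).1 (r i).2 (θ i) ∈ DM (localize A X) := fun i =>
    sgE_mem hA hvX _ _ (hgen.1 i)
  obtain ⟨g, hg⟩ := saito_dvd hAX hmem
  have hhom : (D r).IsHomogeneous (∑ i, ((r i).2 : ℕ)) :=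
      det_homog fun i j => homogeneousComponent_isHomogeneous _ _
  have hg' : D r = QQ (localize A X) * C (coeff 0 g) := by
    have h1 := homogeneousComponent_eq_self hhom
    rw [hr2] at h1
    rw [← h1]
    show homogeneousComponent _ (dmat _).det = _
    rw [hg, homComp_mul (QQ_homog _), if_pos le_rfl, Nat.sub_self, homogeneousComponent_zero]
  refine ⟨fun i => (r i).2, fun i => sgE v (r i).1 (r i).2 (θ i),
    fun i j => homogeneousComponent_isHomogeneous _ _, ?_⟩
  refine saito_basis hAX hmem (c := coeff 0 g) ?_ ?_
  · intro h
    rw [h, C_0, mul_zero] at hg'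
    exact hr1 hg'
  · rw [mul_comm]; exact hg'


theorem loc_arr {A : Finset (Submodule K (Fin ℓ → K))} (hA : IsArrangement A)
    (X : Submodule K (Fin ℓ → K)) : IsArrangement (localize A X) := hA.mono (loc_sub A X)

theorem erase_arr {A : Finset (Submodule K (Fin ℓ → K))} (hA : IsArrangement A)
    (X : Submodule K (Fin ℓ → K)) : IsArrangement (A.erase X) := hA.mono (Finset.erase_subset _ _)

/-- chosen projector onto a subspace -/
def pj (Y : Submodule K (Fin ℓ → K)) : (Fin ℓ → K) →ₗ[K] (Fin ℓ → K) :=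
  (exists_projector Y).choose
theorem pj_mem (Y : Submodule K (Fin ℓ → K)) (v : Fin ℓ → K) : pj Y v ∈ Y :=
  (exists_projector Y).choose_spec.1 v
theorem pj_self (Y : Submodule K (Fin ℓ → K)) {v : Fin ℓ → K} (h : v ∈ Y) : pj Y v = v :=
  (exists_projector Y).choose_spec.2 v h

theorem res_pj_eq_zero (Y : Submodule K (Fin ℓ → K)) (φ : Module.Dual K (Fin ℓ → K)) :
    res (pj Y) (linPoly φ) = 0 ↔ Y ≤ LinearMap.ker φ := by
  rw [res_linPoly]
  constructor
  · intro h v hv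
    have h0 : φ ∘ₗ pj Y = 0 := linPoly_injective (h.trans linPoly_zero.symm)
    have := LinearMap.congr_fun h0 v
    rw [LinearMap.comp_apply, pj_self Y hv] at this
    exact this
  · intro h
    have : φ ∘ₗ pj Y = 0 := LinearMap.ext fun v => h (pj_mem Y v)
    rw [this, linPoly_zero]

theorem res_sub_mem {ι : Type*} (ψ : ι → Module.Dual K (Fin ℓ → K))
    {Y : Submodule K (Fin ℓ → K)} (hY : ⨅ i, LinearMap.ker (ψ i) ≤ Y)
    {I : Ideal (MvPolynomial (Fin ℓ) K)} (hI : ∀ i, linPoly (ψ i) ∈ I) (f : MvPolynomial (Fin ℓ) K) :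
    f - res (pj Y) f ∈ I := by
  apply sub_res_mem
  intro φ
  apply linPoly_mem_of_family ψ hI
  intro v hv
  have := hY hv
  simp [pj_self Y this]

theorem res_H_eq_zero {A : Finset (Submodule K (Fin ℓ → K))} (hA : IsArrangement A)
    {H : Submodule K (Fin ℓ → K)} (hH : H ∈ A) (f : MvPolynomial (Fin ℓ) K) :
    res (pj H) f = 0 ↔ lf H ∣ f := by
  constructor
  · intro h
    have := res_sub_mem (fun _ : Unit => frm H) (Y := H) (by simp [frm_ker hA hH])
      (I := Ideal.span {lf H}) (fun _ => Ideal.subset_span rfl) f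
    rwa [h, sub_zero, Ideal.mem_span_singleton] at this
  · rintro ⟨g, rfl⟩
    rw [map_mul, lf, (res_pj_eq_zero H _).2 (by rw [frm_ker hA hH]), zero_mul]

theorem res_res {A : Finset (Submodule K (Fin ℓ → K))} (hA : IsArrangement A)
    {H : Submodule K (Fin ℓ → K)} (hH : H ∈ A) (f : MvPolynomial (Fin ℓ) K) :
    res (pj H) (res (pj H) f) = res (pj H) f := by
  have := res_sub_mem (fun _ : Unit => frm H) (Y := H) (by simp [frm_ker hA hH])
      (I := Ideal.span {lf H}) (fun _ => Ideal.subset_span rfl) f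
  rw [Ideal.mem_span_singleton, ← res_H_eq_zero hA hH, map_sub, sub_eq_zero] at this
  exact this.symm

/-- distinct kernels of nonzero forms are not contained in each other -/
theorem ker_le_eq {φ ψ : Module.Dual K (Fin ℓ → K)} (hψ : ψ ≠ 0)
    (h : LinearMap.ker φ ≤ LinearMap.ker ψ) : LinearMap.ker φ = LinearMap.ker ψ := by
  have := FiniteDimensional.mem_span_of_iInf_ker_le_ker (𝕜 := K) (L := fun _ : Unit => φ) (K := ψ)
    (by simpa using h)
  simp only [Set.range_const] at this
  obtain ⟨c, hc⟩ := Submodule.mem_span_singleton.1 this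
  have hc0 : c ≠ 0 := by
    rintro rfl; exact hψ (by rw [← hc, zero_smul])
  rw [← hc, LinearMap.ker_smul _ _ hc0]

theorem arr_le_eq {A : Finset (Submodule K (Fin ℓ → K))} (hA : IsArrangement A)
    {H L : Submodule K (Fin ℓ → K)} (hH : H ∈ A) (hL : L ∈ A) (h : H ≤ L) : H = L := by
  rw [← frm_ker hA hH, ← frm_ker hA hL] at h ⊢
  exact ker_le_eq (frm_ne hA hL) h

def fib (A : Finset (Submodule K (Fin ℓ → K))) (H X : Submodule K (Fin ℓ → K)) :
    Finset (Submodule K (Fin ℓ → K)) := (A.erase H).filter (fun L => L ⊓ H = X)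

def pick (A : Finset (Submodule K (Fin ℓ → K))) (H X : Submodule K (Fin ℓ → K)) :
    Submodule K (Fin ℓ → K) := if h : ∃ L, L ∈ fib A H X then h.choose else ⊥

theorem pick_mem {A : Finset (Submodule K (Fin ℓ → K))} {H X : Submodule K (Fin ℓ → K)}
    (h : X ∈ restrict A H) : pick A H X ∈ fib A H X := by
  obtain ⟨L, hL, hX⟩ := Finset.mem_image.1 h
  have : ∃ L, L ∈ fib A H X := ⟨L, Finset.mem_filter.2 ⟨hL, hX⟩⟩
  rw [pick, dif_pos this]; exact this.choose_spec

theorem mem_fib {A : Finset (Submodule K (Fin ℓ → K))} {H X L : Submodule K (Fin ℓ → K)} :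
    L ∈ fib A H X ↔ (L ≠ H ∧ L ∈ A) ∧ L ⊓ H = X := by
  rw [fib, Finset.mem_filter, Finset.mem_erase]

/-- Terao's polynomial. -/
def Bp (A : Finset (Submodule K (Fin ℓ → K))) (H : Submodule K (Fin ℓ → K)) :
    MvPolynomial (Fin ℓ) K :=
  ∏ X ∈ restrict A H, ∏ L ∈ (fib A H X).erase (pick A H X), lf L

theorem Bp_mul (A : Finset (Submodule K (Fin ℓ → K))) (H : Submodule K (Fin ℓ → K)) :
    Bp A H * ∏ X ∈ restrict A H, lf (pick A H X) = QQ (A.erase H) := by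
  rw [Bp, ← Finset.prod_mul_distrib, QQ]
  have := Finset.prod_fiberwise_of_maps_to (s := A.erase H) (t := restrict A H)
    (g := fun L => L ⊓ H) (fun L hL => Finset.mem_image_of_mem _ hL) lf
  rw [← this]
  refine Finset.prod_congr rfl fun X hX => ?_
  rw [Finset.prod_erase_mul _ _ (pick_mem hX)]
  rfl

theorem card_restrict_le (A : Finset (Submodule K (Fin ℓ → K))) (H : Submodule K (Fin ℓ → K)) :
    (restrict A H).card ≤ (A.erase H).card := Finset.card_image_le

theorem Bp_ne {A : Finset (Submodule K (Fin ℓ → K))} (hA : IsArrangement A)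
    (H : Submodule K (Fin ℓ → K)) : Bp A H ≠ 0 := by
  intro h
  have := Bp_mul A H
  rw [h, zero_mul] at this
  exact QQ_ne (erase_arr hA H) this.symm

theorem Bp_homog (A : Finset (Submodule K (Fin ℓ → K)))
    (H : Submodule K (Fin ℓ → K)) :
    (Bp A H).IsHomogeneous ((A.erase H).card - (restrict A H).card) := by
  have h1 : (Bp A H).IsHomogeneous
      (∑ X ∈ restrict A H, ∑ L ∈ (fib A H X).erase (pick A H X), 1) := by
    apply IsHomogeneous.prod
    intro X _
    apply IsHomogeneous.prod
    intro L _
    exact linPoly_homog _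
  convert h1 using 1
  have h2 : (A.erase H).card = ∑ X ∈ restrict A H, (fib A H X).card :=
    Finset.card_eq_sum_card_fiberwise (fun L hL => Finset.mem_image_of_mem _ hL)
  have h3 : ∑ X ∈ restrict A H, (fib A H X).card =
      ∑ X ∈ restrict A H, (((fib A H X).erase (pick A H X)).card + 1) :=
    Finset.sum_congr rfl fun X hX => (Finset.card_erase_add_one (pick_mem hX)).symm
  rw [h2, h3, Finset.sum_add_distrib]
  simp

theorem res_relPrime {A : Finset (Submodule K (Fin ℓ → K))} (hA : IsArrangement A)
    {H L L' : Submodule K (Fin ℓ → K)} (hH : H ∈ A) (hL : L ∈ A) (hL' : L' ∈ A)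
    (hLH : L ≠ H) (hLH' : L' ≠ H)
    (h : L ⊓ H ≠ L' ⊓ H) : IsRelPrime (res (pj H) (lf L)) (res (pj H) (lf L')) := by
  have hne : ∀ M ∈ A, M ≠ H → frm M ∘ₗ pj H ≠ 0 := by
    intro M hM hMH h0
    apply hMH
    refine (arr_le_eq hA hH hM ?_).symm
    intro v hv
    rw [← frm_ker hA hM]
    have := LinearMap.congr_fun h0 v
    rwa [LinearMap.comp_apply, pj_self H hv] at this
  have hk : ∀ M ∈ A, ∀ v ∈ H, v ∈ M ↔ v ∈ LinearMap.ker (frm M ∘ₗ pj H) := by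
    intro M hM v hv
    rw [LinearMap.mem_ker, LinearMap.comp_apply, pj_self H hv, ← LinearMap.mem_ker, frm_ker hA hM]
  rw [lf, lf, res_linPoly, res_linPoly, (linPoly_prime (hne L hL hLH)).irreducible.isRelPrime_iff_not_dvd]
  intro hd
  have := dvd_linPoly (hne L' hL' hLH') hd
  apply h
  ext v
  simp only [Submodule.mem_inf]
  constructor
  · rintro ⟨h1, h2⟩
    exact ⟨(hk L' hL' v h2).2 (this ▸ (hk L hL v h2).1 h1), h2⟩
  · rintro ⟨h1, h2⟩
    exact ⟨(hk L hL v h2).2 (this ▸ (hk L' hL' v h2).1 h1), h2⟩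

/-- two hyperplanes with the same intersection with `H` -/
theorem fib_comb {A : Finset (Submodule K (Fin ℓ → K))} (hA : IsArrangement A)
    {H L M : Submodule K (Fin ℓ → K)} (hH : H ∈ A) (hL : L ∈ A) (hM : M ∈ A)
    (hLH : L ≠ H) (h : M ⊓ H ≤ L) :
    ∃ a b : K, a ≠ 0 ∧ frm L = a • frm M + b • frm H := by
  have := FiniteDimensional.mem_span_of_iInf_ker_le_ker (𝕜 := K)
    (L := fun i : Bool => if i then frm M else frm H) (K := frm L)
    (by
      intro v hv
      rw [Submodule.mem_iInf] at hv
      rw [frm_ker hA hL]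
      apply h
      have h1 := hv true
      have h2 := hv false
      simp only [if_true, Bool.false_eq_true, if_false] at h1 h2
      rw [frm_ker hA hM] at h1
      rw [frm_ker hA hH] at h2
      exact ⟨h1, h2⟩)
  have hr : Set.range (fun i : Bool => if i then frm M else frm H) = {frm H, frm M} := by
    ext x; simp [eq_comm, or_comm]
  rw [hr, Submodule.mem_span_pair] at this
  obtain ⟨b, a, hab⟩ := this
  refine ⟨a, b, ?_, by rw [← hab, add_comm]⟩
  rintro rfl
  rw [zero_smul, add_zero] at hab
  apply hLH
  have hle : H ≤ L := by
    rw [← frm_ker hA hL, ← frm_ker hA hH, ← hab]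
    intro v hv
    simp only [LinearMap.mem_ker] at hv
    simp [hv]
  exact (arr_le_eq hA hH hL hle).symm

theorem terao_dvd {A : Finset (Submodule K (Fin ℓ → K))} (hA : IsArrangement A)
    {H : Submodule K (Fin ℓ → K)} (hH : H ∈ A) {θ : Deriv K ℓ} (hθ : θ ∈ DM (A.erase H)) :
    res (pj H) (Bp A H) ∣ res (pj H) (applyLin θ (frm H)) := by
  rw [Bp, map_prod]
  apply Finset.prod_dvd_of_isRelPrime
  · intro X hX Y hY hne
    simp only [map_prod]
    refine IsRelPrime.prod_left fun L hL => IsRelPrime.prod_right fun M hM => ?_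
    have h1 := mem_fib.1 (Finset.mem_of_mem_erase hL)
    have h2 := mem_fib.1 (Finset.mem_of_mem_erase hM)
    exact res_relPrime hA hH h1.1.2 h2.1.2 h1.1.1 h2.1.1 (by rw [h1.2, h2.2]; exact hne)
  · intro X hX
    have hp := pick_mem hX
    have hp' := mem_fib.1 hp
    set M := pick A H X
    have hdv : (∏ L ∈ fib A H X, lf L) ∣
        lf H * applyLin θ (frm M) - lf M * applyLin θ (frm H) := by
      apply Finset.prod_dvd_of_isRelPrime
      · intro L hL L' hL' hne
        exact lf_relPrime hA (mem_fib.1 hL).1.2 (mem_fib.1 hL').1.2 hne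
      · intro L hL
        have hL' := mem_fib.1 hL
        obtain ⟨a, b, ha, hab⟩ := fib_comb hA hH hL'.1.2 hp'.1.2 hL'.1.1
          (by rw [hp'.2, ← hL'.2]; exact inf_le_left)
        have e1 : lf L = C a * lf M + C b * lf H := by
          rw [lf, hab, ← lpL_apply, map_add, map_smul, map_smul]
          simp [smul_eq_C_mul, lpL_apply, lf]
        have e2 : applyLin θ (frm L) = C a * applyLin θ (frm M) + C b * applyLin θ (frm H) := by
          rw [hab, ← apL_apply, map_add, map_smul, map_smul]
          simp [smul_eq_C_mul, apL_apply]
        have e3 : C a * (lf H * applyLin θ (frm M) - lf M * applyLin θ (frm H)) =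
            lf H * applyLin θ (frm L) - lf L * applyLin θ (frm H) := by
          rw [e1, e2]; ring
        have h4 : lf L ∣ applyLin θ (frm L) :=
          (inD_iff (erase_arr hA H) θ).1 hθ L (Finset.mem_erase.2 hL'.1)
        have h5 : lf L ∣ C a * (lf H * applyLin θ (frm M) - lf M * applyLin θ (frm H)) := by
          rw [e3]
          exact dvd_sub (h4.mul_left _) (dvd_mul_right _ _)
        exact ((isUnit_C' ha).dvd_mul_left).1 h5
    have h6 := map_dvd (res (pj H)) hdv
    rw [map_sub, map_mul, map_mul, (res_H_eq_zero hA hH (lf H)).2 dvd_rfl, zero_mul, zero_sub,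
      dvd_neg, ← Finset.mul_prod_erase _ _ hp, map_mul] at h6
    refine (mul_dvd_mul_iff_left ?_).1 h6
    intro h0
    rw [res_H_eq_zero hA hH] at h0
    exact hp'.1.1 (lf_dvd hA hH hp'.1.2 h0).symm


theorem ex_vec {A : Finset (Submodule K (Fin ℓ → K))} (hA : IsArrangement A)
    {H : Submodule K (Fin ℓ → K)} (hH : H ∈ A) (L : Submodule K (Fin ℓ → K))
    (h : ¬ L ≤ H) : ∃ v ∈ L, frm H v = 1 := by
  obtain ⟨w, hw, hwH⟩ := SetLike.not_le_iff_exists.1 h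
  rw [← frm_ker hA hH, LinearMap.mem_ker] at hwH
  exact ⟨(frm H w)⁻¹ • w, L.smul_mem _ hw, by simp [hwH]⟩

/-- constant derivation -/
def cD (v : Fin ℓ → K) : Deriv K ℓ := fun i => C (v i)

theorem applyLin_cD (v : Fin ℓ → K) (φ : Module.Dual K (Fin ℓ → K)) :
    applyLin (cD v) φ = C (φ v) := by
  rw [dual_apply_eq φ v, applyLin, map_sum]
  simp [cD]

def InI (A : Finset (Submodule K (Fin ℓ → K))) (H : Submodule K (Fin ℓ → K))
    (g : MvPolynomial (Fin ℓ) K) : Prop :=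
  ∃ θ ∈ DM (A.erase H), lf H ∣ applyLin θ (frm H) - g * Bp A H

theorem inI_base {A : Finset (Submodule K (Fin ℓ → K))} (hA : IsArrangement A)
    {H : Submodule K (Fin ℓ → K)} (hH : H ∈ A) {X : Submodule K (Fin ℓ → K)}
    (hX : X ∈ restrict A H) : InI A H (∏ Y ∈ (restrict A H).erase X, lf (pick A H Y)) := by
  have hp := mem_fib.1 (pick_mem hX)
  set M := pick A H X with hM
  obtain ⟨v, hv, hv1⟩ := ex_vec hA hH M (fun hle => hp.1.1 (arr_le_eq hA hp.1.2 hH hle))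
  have hsub : ({M} : Finset _) ⊆ A.erase H := by
    simpa using hp.1
  refine ⟨QQ (A.erase H \ {M}) • cD v, ?_, ?_⟩
  · apply QQ_smul_mem (erase_arr hA H) hsub
    rw [mem_DM, inD_iff ((erase_arr hA H).mono hsub)]
    intro L hL
    rw [Finset.mem_singleton] at hL
    subst hL
    rw [applyLin_cD]
    rw [← frm_ker hA hp.1.2, LinearMap.mem_ker] at hv
    rw [hv, C_0]; exact dvd_zero _
  · rw [applyLin_smul, applyLin_cD, hv1, C_1, mul_one]
    have h1 := Bp_mul A H
    rw [← Finset.mul_prod_erase _ _ hX, ← hM] at h1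
    have h2 : QQ (A.erase H) = QQ (A.erase H \ {M}) * lf M := by
      rw [QQ, ← Finset.prod_sdiff hsub]; simp [QQ]
    have h3 : QQ (A.erase H \ {M}) =
        (∏ Y ∈ (restrict A H).erase X, lf (pick A H Y)) * Bp A H := by
      apply mul_right_cancel₀ (lf_ne hA hp.1.2)
      rw [← h2, ← h1]; ring
    rw [h3, sub_self]; exact dvd_zero _

theorem mem_DM_of_erase {A : Finset (Submodule K (Fin ℓ → K))} (hA : IsArrangement A)
    {H : Submodule K (Fin ℓ → K)} {θ : Deriv K ℓ} (h : θ ∈ DM (A.erase H))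
    (h2 : lf H ∣ applyLin θ (frm H)) : θ ∈ DM A := by
  rw [mem_DM, inD_iff hA]
  intro L hL
  by_cases hLH : L = H
  · rw [hLH]; exact h2
  · exact (inD_iff (erase_arr hA H) θ).1 h L (Finset.mem_erase.2 ⟨hLH, hL⟩)

theorem inI_step {A : Finset (Submodule K (Fin ℓ → K))} (hA : IsArrangement A) (hf : IsFree A)
    {H : Submodule K (Fin ℓ → K)} (hH : H ∈ A) {X X' : Submodule K (Fin ℓ → K)}
    (hX : X ∈ restrict A H) (hX' : X' ∈ restrict A H) (hne : X ≠ X') {g : MvPolynomial (Fin ℓ) K}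
    (h1 : InI A H (g * lf (pick A H X))) (h2 : InI A H (g * lf (pick A H X'))) : InI A H g := by
  have hp := mem_fib.1 (pick_mem hX)
  have hp' := mem_fib.1 (pick_mem hX')
  set M := pick A H X
  set M' := pick A H X'
  have hMM : M ≠ M' := fun h => hne (by rw [← hp.2, ← hp'.2, h])
  obtain ⟨e, θ, hθ, hgen, hind⟩ := hf
  obtain ⟨ta, hta, ka, hka⟩ := h1
  obtain ⟨tb, htb, kb, hkb⟩ := h2
  rw [sub_eq_iff_eq_add] at hka hkb
  have hbig : lf M' • ta - lf M • tb ∈ DM A := by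
    apply mem_DM_of_erase hA (Submodule.sub_mem _ (Submodule.smul_mem _ _ hta)
      (Submodule.smul_mem _ _ htb))
    rw [applyLin_sub, applyLin_smul, applyLin_smul, hka, hkb]
    exact ⟨lf M' * ka - lf M * kb, by ring⟩
  have hmul : ∀ t ∈ DM (A.erase H), lf H • t ∈ DM A := fun t ht => by
    apply mem_DM_of_erase hA (Submodule.smul_mem _ _ ht)
    rw [applyLin_smul]; exact dvd_mul_right _ _
  obtain ⟨c, hc⟩ := hgen.2 _ hbig
  obtain ⟨a, ha⟩ := hgen.2 _ (hmul _ hta)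
  obtain ⟨b, hb⟩ := hgen.2 _ (hmul _ htb)
  have hrel : ∀ j, lf H * c j = lf M' * a j - lf M * b j := by
    intro j
    have h0 : ∑ i, (lf H * c i - (lf M' * a i - lf M * b i)) • θ i = 0 := by
      simp only [sub_smul, mul_smul, Finset.sum_sub_distrib, ← Finset.smul_sum]
      rw [← hc, ← ha, ← hb, smul_sub, smul_comm (lf M'), smul_comm (lf M), sub_self]
    exact sub_eq_zero.1 (hind _ h0 j)
  have hnle : ¬ M ⊓ M' ≤ H := by
    intro hle
    obtain ⟨x, y, hx, hxy⟩ := fib_comb hA hp'.1.2 hH hp.1.2 (fun h => hp'.1.1 h.symm) hle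
    have hy : y ≠ 0 := by
      rintro rfl
      rw [zero_smul, add_zero] at hxy
      apply hp.1.1
      rw [← frm_ker hA hH, ← frm_ker hA hp.1.2, hxy, LinearMap.ker_smul _ _ hx]
    apply hne
    rw [← hp.2, ← hp'.2]
    ext v
    simp only [Submodule.mem_inf]
    rw [← frm_ker hA hH, ← frm_ker hA hp.1.2, ← frm_ker hA hp'.1.2]
    simp only [LinearMap.mem_ker]
    constructor
    · rintro ⟨h1, h2⟩
      refine ⟨?_, h2⟩
      rw [hxy] at h2
      simpa [h1, hy] using h2
    · rintro ⟨h1, h2⟩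
      refine ⟨?_, h2⟩
      rw [hxy] at h2
      simpa [h1, hx] using h2
  have hcu : ∀ j, ∃ u w, c j = lf M' * u - lf M * w := by
    intro j
    have hr : res (pj (M ⊓ M')) (c j) = 0 := by
      have h3 := congrArg (res (pj (M ⊓ M'))) (hrel j)
      rw [map_mul, map_sub, map_mul, map_mul,
        show res (pj (M ⊓ M')) (lf M) = 0 from (res_pj_eq_zero _ _).2
          (by rw [frm_ker hA hp.1.2]; exact inf_le_left),
        show res (pj (M ⊓ M')) (lf M') = 0 from (res_pj_eq_zero _ _).2
          (by rw [frm_ker hA hp'.1.2]; exact inf_le_right), zero_mul, zero_mul, sub_zero] at h3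
      rcases mul_eq_zero.1 h3 with h | h
      · rw [lf, res_pj_eq_zero, frm_ker hA hH] at h
        exact absurd h hnle
      · exact h
    have hm := res_sub_mem (fun i : Bool => if i then frm M else frm M') (Y := M ⊓ M')
      (by
        intro v hv
        rw [Submodule.mem_iInf] at hv
        have h1 := hv true
        have h2 := hv false
        simp only [if_true, Bool.false_eq_true, if_false] at h1 h2
        rw [frm_ker hA hp.1.2] at h1
        rw [frm_ker hA hp'.1.2] at h2
        exact ⟨h1, h2⟩) (I := Ideal.span {lf M, lf M'})
      (by
        intro i
        cases i
        · exact Ideal.subset_span (by simp [lf])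
        · exact Ideal.subset_span (by simp [lf])) (c j)
    rw [hr, sub_zero, Ideal.mem_span_pair] at hm
    obtain ⟨w, u, hwu⟩ := hm
    exact ⟨u, -w, by rw [← hwu]; ring⟩
  choose u w huw using hcu
  have hkey : lf M' • (ta - ∑ j, u j • θ j) = lf M • (tb - ∑ j, w j • θ j) := by
    rw [smul_sub, smul_sub, sub_eq_sub_iff_sub_eq_sub, hc, Finset.smul_sum, Finset.smul_sum,
      ← Finset.sum_sub_distrib]
    refine Finset.sum_congr rfl fun j _ => ?_
    rw [huw, sub_smul, mul_smul, mul_smul]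
  have hdv : ∀ i, lf M ∣ (ta - ∑ j, u j • θ j) i := by
    intro i
    have h3 : lf M ∣ lf M' * (ta - ∑ j, u j • θ j) i := ⟨_, congrFun hkey i⟩
    rcases (lf_prime hA hp.1.2).dvd_or_dvd h3 with h | h
    · exact absurd (lf_dvd hA hp.1.2 hp'.1.2 h) hMM
    · exact h
  choose ψ hψ using hdv
  have hψ1 : lf M • ψ = ta - ∑ j, u j • θ j := funext fun i => (hψ i).symm
  have hψ2 : lf M' • ψ = tb - ∑ j, w j • θ j := by
    funext i
    apply mul_left_cancel₀ (lf_ne hA hp.1.2)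
    have := congrFun hkey i
    rw [← hψ1] at this
    simp only [Pi.smul_apply, smul_eq_mul] at this ⊢
    rw [← this]; ring
  have hsum : ∀ z : Fin ℓ → MvPolynomial (Fin ℓ) K, ∑ j, z j • θ j ∈ DM A := fun z =>
    Submodule.sum_mem _ fun j _ => Submodule.smul_mem _ _ (hgen.1 j)
  have hle := DM_anti (A := A) (Finset.erase_subset H A)
  have hm1 : lf M • ψ ∈ DM (A.erase H) := by
    rw [hψ1]; exact Submodule.sub_mem _ hta (hle (hsum _))
  have hm2 : lf M' • ψ ∈ DM (A.erase H) := by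
    rw [hψ2]; exact Submodule.sub_mem _ htb (hle (hsum _))
  refine ⟨ψ, ?_, ?_⟩
  · rw [mem_DM, inD_iff (erase_arr hA H)]
    intro L hL
    have hLA := Finset.mem_of_mem_erase hL
    have gen : ∀ N ∈ A, L ≠ N → lf N • ψ ∈ DM (A.erase H) → lf L ∣ applyLin ψ (frm L) := by
      intro N hN hLN hm
      have h4 := (inD_iff (erase_arr hA H) _).1 hm L hL
      rw [applyLin_smul] at h4
      exact ((lf_prime hA hLA).dvd_or_dvd h4).resolve_left
        fun h => hLN (lf_dvd hA hLA hN h)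
    by_cases hLM : L = M
    · exact gen M' hp'.1.2 (by rw [hLM]; exact hMM) hm2
    · exact gen M hp.1.2 hLM hm1
  · have h5 : lf H ∣ applyLin (∑ j, u j • θ j) (frm H) := (inD_iff hA _).1 (hsum u) H hH
    have h6 : lf H ∣ lf M * (applyLin ψ (frm H) - g * Bp A H) := by
      rw [mul_sub, ← applyLin_smul, hψ1, applyLin_sub, hka]
      obtain ⟨z, hz⟩ := h5
      rw [hz]
      exact ⟨ka - z, by ring⟩
    exact ((lf_prime hA hH).dvd_or_dvd h6).resolve_left
      fun h => hp.1.1 (lf_dvd hA hH hp.1.2 h).symm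

theorem inI_one {A : Finset (Submodule K (Fin ℓ → K))} (hA : IsArrangement A) (hf : IsFree A)
    {H : Submodule K (Fin ℓ → K)} (hH : H ∈ A) : InI A H 1 := by
  have key : ∀ n : ℕ, ∀ T : Finset (Submodule K (Fin ℓ → K)), T ⊆ restrict A H →
      (restrict A H \ T).card = n + 1 → InI A H (∏ Y ∈ T, lf (pick A H Y)) := by
    intro n
    induction n with
    | zero =>
      intro T hT hc
      obtain ⟨X, hX⟩ := Finset.card_eq_one.1 hc
      have hXm : X ∈ restrict A H \ T := by rw [hX]; simp
      have : T = (restrict A H).erase X := by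
        ext Y
        have h1 : Y ∈ restrict A H \ T ↔ Y = X := by rw [hX]; simp
        rw [Finset.mem_sdiff] at h1
        rw [Finset.mem_erase]
        constructor
        · intro h; exact ⟨fun h2 => (h1.2 h2).2 h, hT h⟩
        · rintro ⟨h2, h3⟩
          by_contra h4
          exact h2 (h1.1 ⟨h3, h4⟩)
      rw [this]
      exact inI_base hA hH (Finset.mem_sdiff.1 hXm).1
    | succ n ih =>
      intro T hT hc
      obtain ⟨X, hX, X', hX', hne⟩ := Finset.one_lt_card.1 (show 1 < (restrict A H \ T).card by omega)
      rw [Finset.mem_sdiff] at hX hX'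
      have hst : ∀ Z ∈ restrict A H, Z ∉ T → InI A H ((∏ Y ∈ T, lf (pick A H Y)) * lf (pick A H Z)) := by
        intro Z hZ hZT
        rw [mul_comm, ← Finset.prod_insert (f := fun Y => lf (pick A H Y)) hZT]
        apply ih
        · exact Finset.insert_subset hZ hT
        · rw [Finset.sdiff_insert, Finset.card_erase_of_mem (Finset.mem_sdiff.2 ⟨hZ, hZT⟩), hc]
          rfl
      exact inI_step hA hf hH hX.1 hX'.1 hne (hst X hX.1 hX.2) (hst X' hX'.1 hX'.2)
  by_cases h0 : restrict A H = ∅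
  · have hE : A.erase H = ∅ := by
      rw [restrict, Finset.image_eq_empty] at h0; exact h0
    have hB : Bp A H = 1 := by rw [Bp, h0, Finset.prod_empty]
    obtain ⟨v, -, hv⟩ := ex_vec hA hH ⊤ (by
      intro hle
      apply frm_ne hA hH
      refine LinearMap.ext fun v => ?_
      have := hle (Submodule.mem_top (x := v))
      rw [← frm_ker hA hH] at this
      exact this)
    refine ⟨cD v, ?_, ?_⟩
    · rw [hE]; intro L hL; simp at hL
    · rw [applyLin_cD, hv, hB]; simp
  · obtain ⟨n, hn⟩ : ∃ n, (restrict A H).card = n + 1 :=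
      ⟨(restrict A H).card - 1, by
        have := Finset.card_pos.2 (Finset.nonempty_iff_ne_empty.2 h0); omega⟩
    have := key n ∅ (Finset.empty_subset _) (by rw [Finset.sdiff_empty, hn])
    simpa using this

/-- degree of the extra generator -/
def dd (A : Finset (Submodule K (Fin ℓ → K))) (H : Submodule K (Fin ℓ → K)) : ℕ :=
  (A.erase H).card - (restrict A H).card

theorem exists_phi {A : Finset (Submodule K (Fin ℓ → K))} (hA : IsArrangement A) (hf : IsFree A)
    {H : Submodule K (Fin ℓ → K)} (hH : H ∈ A) :
    ∃ φ ∈ DM (A.erase H), HomogDeriv φ (dd A H) ∧ lf H ∣ applyLin φ (frm H) - Bp A H := by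
  obtain ⟨φ, hφ, h⟩ := inI_one hA hf hH
  rw [one_mul] at h
  refine ⟨dComp (dd A H) φ, dComp_mem _ hφ, dComp_homog _ _, ?_⟩
  have := homComp_dvd (linPoly_homog (frm H)) (dd A H) h
  rwa [map_sub, ← applyLin_dComp,
    show homogeneousComponent (dd A H) (Bp A H) = Bp A H from
      homogeneousComponent_eq_self (Bp_homog A H)] at this

theorem lf_not_dvd_Bp {A : Finset (Submodule K (Fin ℓ → K))} (hA : IsArrangement A)
    {H : Submodule K (Fin ℓ → K)} (hH : H ∈ A) : ¬ lf H ∣ Bp A H := by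
  intro h
  have h2 : lf H ∣ QQ (A.erase H) := by rw [← Bp_mul]; exact h.mul_right _
  obtain ⟨M, hM, hd⟩ := ((lf_prime hA hH).dvd_finsetProd_iff _).1 h2
  rw [Finset.mem_erase] at hM
  exact hM.1 (lf_dvd hA hH hM.2 hd).symm

theorem phi_decomp {A : Finset (Submodule K (Fin ℓ → K))} (hA : IsArrangement A)
    {H : Submodule K (Fin ℓ → K)} (hH : H ∈ A) {φ : Deriv K ℓ} (hφ : φ ∈ DM (A.erase H))
    (hφB : lf H ∣ applyLin φ (frm H) - Bp A H) {η : Deriv K ℓ} (hη : η ∈ DM (A.erase H)) :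
    ∃ h : MvPolynomial (Fin ℓ) K, η - h • φ ∈ DM A := by
  obtain ⟨k, hk⟩ := terao_dvd hA hH hη
  refine ⟨k, mem_DM_of_erase hA (Submodule.sub_mem _ hη (Submodule.smul_mem _ _ hφ)) ?_⟩
  rw [← res_H_eq_zero hA hH, map_sub, sub_eq_zero] at hφB
  rw [← res_H_eq_zero hA hH, applyLin_sub, applyLin_smul, map_sub, map_mul, hφB]
  have := congrArg (res (pj H)) hk
  rw [map_mul, res_res hA hH, res_res hA hH] at this
  rw [this]; ring


/-- Deletion data: homogeneous basis `θ` of `D(A)` and the extra generator `φ`. -/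
structure Del (A : Finset (Submodule K (Fin ℓ → K))) (H : Submodule K (Fin ℓ → K))
    (e : Fin ℓ → ℕ) (θ : Fin ℓ → Deriv K ℓ) (φ : Deriv K ℓ)
    (f : Fin ℓ → MvPolynomial (Fin ℓ) K) : Prop where
  hA : IsArrangement A
  hH : H ∈ A
  hom : ∀ i, HomogDeriv (θ i) (e i)
  gen : GeneratesD A θ
  ind : IndepD θ
  phi : φ ∈ DM (A.erase H)
  phiHom : HomogDeriv φ (dd A H)
  phiB : lf H ∣ applyLin φ (frm H) - Bp A H
  rel : lf H • φ = ∑ j, f j • θ j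
  fHom : ∀ j, e j ≤ dd A H + 1 → (f j).IsHomogeneous (dd A H + 1 - e j)
  fZero : ∀ j, dd A H + 1 < e j → f j = 0

theorem exists_del {A : Finset (Submodule K (Fin ℓ → K))} (hA : IsArrangement A)
    {H : Submodule K (Fin ℓ → K)} (hH : H ∈ A) {e : Fin ℓ → ℕ} {θ : Fin ℓ → Deriv K ℓ}
    (hom : ∀ i, HomogDeriv (θ i) (e i)) (gen : GeneratesD A θ) (ind : IndepD θ) :
    ∃ φ f, Del A H e θ φ f := by
  obtain ⟨φ, hφ, hφh, hφB⟩ := exists_phi hA ⟨e, θ, hom, gen, ind⟩ hH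
  have hm : lf H • φ ∈ DM A := by
    apply mem_DM_of_erase hA (Submodule.smul_mem _ _ hφ)
    rw [applyLin_smul]; exact dvd_mul_right _ _
  obtain ⟨g, hg⟩ := gen.2 _ hm
  refine ⟨φ, fun j => if e j ≤ dd A H + 1 then homogeneousComponent (dd A H + 1 - e j) (g j) else 0,
    hA, hH, hom, gen, ind, hφ, hφh, hφB, ?_, ?_, ?_⟩
  · have h1 := congrArg (dComp (dd A H + 1)) hg
    rw [dComp_smul_left (show (lf H).IsHomogeneous 1 from linPoly_homog _), if_pos (by omega),
      Nat.add_sub_cancel, dComp_self hφh, dComp_sum] at h1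
    rw [h1]
    exact Finset.sum_congr rfl fun j _ => dComp_smul_right (hom j) _ _
  · intro j hj
    rw [if_pos hj]
    exact homogeneousComponent_isHomogeneous _ _
  · intro j hj
    rw [if_neg (by omega)]

namespace Del
variable {A : Finset (Submodule K (Fin ℓ → K))} {H : Submodule K (Fin ℓ → K)}
    {e : Fin ℓ → ℕ} {θ : Fin ℓ → Deriv K ℓ} {φ : Deriv K ℓ} {f : Fin ℓ → MvPolynomial (Fin ℓ) K}

theorem relation (D : Del A H e θ φ f) {g : Fin ℓ → MvPolynomial (Fin ℓ) K}
    {h : MvPolynomial (Fin ℓ) K} (hr : ∑ j, g j • θ j + h • φ = 0) :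
    ∃ q, h = q * lf H ∧ ∀ j, g j = - (q * f j) := by
  have h1 := congrArg (fun η => applyLin η (frm H)) hr
  simp only [applyLin_add, applyLin_smul] at h1
  rw [show applyLin (0 : Deriv K ℓ) (frm H) = 0 from (apS (frm H)).map_zero] at h1
  have h2 : lf H ∣ applyLin (∑ j, g j • θ j) (frm H) := (inD_iff D.hA _).1
    (mem_DM.1 (Submodule.sum_mem (DM A) fun j _ => Submodule.smul_mem _ _ (D.gen.1 j))) H D.hH
  have h3 : lf H ∣ h * applyLin φ (frm H) := (dvd_add_right h2).1 (by rw [h1]; exact dvd_zero _)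
  have h4 : lf H ∣ h := by
    refine ((lf_prime D.hA D.hH).dvd_or_dvd h3).resolve_right fun h5 => ?_
    exact lf_not_dvd_Bp D.hA D.hH ((dvd_sub_right h5).1 D.phiB)
  obtain ⟨q, rfl⟩ := h4
  refine ⟨q, mul_comm _ _, fun j => ?_⟩
  have h5 : ∑ j, (g j + q * f j) • θ j = 0 := by
    rw [mul_comm, mul_smul, D.rel, Finset.smul_sum, ← Finset.sum_add_distrib] at hr
    rw [← hr]
    refine Finset.sum_congr rfl fun j _ => ?_
    rw [add_smul, mul_smul]
  exact eq_neg_of_add_eq_zero_left (D.ind _ h5 j)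

theorem free_of_const (D : Del A H e θ φ f) {j : Fin ℓ} (hj : constantCoeff (f j) ≠ 0) :
    IsFree (A.erase H) := by
  have h1 : e j = dd A H + 1 := by
    by_contra hne
    apply hj
    rcases lt_or_gt_of_ne hne with h | h
    · have := D.fHom j h.le
      rw [constantCoeff_eq]
      refine this.coeff_eq_zero ?_
      simp; omega
    · rw [D.fZero j h, map_zero]
  have h2 : f j = C (constantCoeff (f j)) := by
    have := D.fHom j h1.le
    rw [h1, Nat.sub_self] at this
    rw [← homogeneousComponent_eq_self this, homogeneousComponent_zero]
    simp [constantCoeff_eq]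
  obtain ⟨c, hc, hdet⟩ := saito_det D.hA D.gen
  refine ⟨Function.update e j (dd A H), Function.update θ j φ, ?_, ?_⟩
  · intro i
    by_cases hi : i = j
    · subst hi; simp only [Function.update_self]; exact D.phiHom
    · simp only [Function.update_of_ne hi]; exact D.hom i
  · apply saito_basis (erase_arr D.hA H) (c := constantCoeff (f j) * c)
    · intro i
      by_cases hi : i = j
      · subst hi; simp only [Function.update_self]; exact D.phi
      · simp only [Function.update_of_ne hi]
        exact DM_anti (Finset.erase_subset _ _) (D.gen.1 i)
    · exact mul_ne_zero hj hc
    · apply mul_left_cancel₀ (lf_ne D.hA D.hH)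
      have e1 : dmat (Function.update θ j φ) = (dmat θ).updateRow j φ := rfl
      have e2 := Matrix.det_updateRow_smul (dmat θ) j (lf H) φ
      rw [e1, ← e2, D.rel]
      have e3 := Matrix.det_updateRow_sum (dmat θ) j f
      have e4 : (∑ k, f k • (dmat θ) k) = ∑ k, f k • θ k := rfl
      rw [e4] at e3
      rw [e3, smul_eq_mul, hdet, C_mul, ← h2]
      have : QQ A = lf H * QQ (A.erase H) := (Finset.mul_prod_erase A lf D.hH).symm
      rw [this]; ring

theorem sup_eq (D : Del A H e θ φ f) {j : Fin ℓ} (hj : constantCoeff (f j) ≠ 0) :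
    e j = dd A H + 1 := by
  by_contra hne
  apply hj
  rcases lt_or_gt_of_ne hne with h | h
  · have := D.fHom j h.le
    rw [constantCoeff_eq]
    refine this.coeff_eq_zero ?_
    simp; omega
  · rw [D.fZero j h, map_zero]

theorem nonvanish (D : Del A H e θ φ f) {F : Type} [Field F] [Algebra K F] (p : Fin ℓ → F)
    (hp : aeval p (lf H) = 0)
    (hfr : IsFree ((A.filter fun L => aeval p (lf L) = 0).erase H)) :
    ∃ j, aeval p (f j) ≠ 0 := by
  by_contra hcon
  push Not at hcon
  set Ap := A.filter fun L => aeval p (lf L) = 0 with hAp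
  have hApA : Ap ⊆ A := Finset.filter_subset _ _
  have hsub : Ap.erase H ⊆ A.erase H := Finset.erase_subset_erase _ hApA
  obtain ⟨e', ψ, hψh, hψg, hψi⟩ := hfr
  have hQne : aeval p (QQ (A.erase H \ Ap.erase H)) ≠ 0 := by
    rw [QQ, map_prod, Finset.prod_ne_zero_iff]
    intro L hL h0
    rw [Finset.mem_sdiff, Finset.mem_erase] at hL
    apply hL.2
    rw [Finset.mem_erase]
    exact ⟨hL.1.1, Finset.mem_filter.2 ⟨hL.1.2, h0⟩⟩
  set Q := QQ (A.erase H \ Ap.erase H)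
  set Θ : Option (Fin ℓ) → Deriv K ℓ := fun o => o.elim φ θ with hΘ
  have hΘm : ∀ o, Θ o ∈ DM (Ap.erase H) := by
    intro o
    apply DM_anti hsub
    cases o with
    | none => exact D.phi
    | some i => exact DM_anti (Finset.erase_subset _ _) (D.gen.1 i)
  choose T hT using fun o => hψg.2 (Θ o) (hΘm o)
  have hN : ∀ i, ∃ N : Option (Fin ℓ) → MvPolynomial (Fin ℓ) K, Q • ψ i = ∑ o, N o • Θ o := by
    intro i
    have hm : Q • ψ i ∈ DM (A.erase H) := QQ_smul_mem (erase_arr D.hA H) hsub (hψg.1 i)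
    obtain ⟨h, hh⟩ := phi_decomp D.hA D.hH D.phi D.phiB hm
    obtain ⟨c, hc⟩ := D.gen.2 _ hh
    refine ⟨fun o => o.elim h c, ?_⟩
    rw [Fintype.sum_option]
    simp only [hΘ, Option.elim]
    rw [← hc]; abel
  choose N hN using hN
  have hrel : ∀ g : Option (Fin ℓ) → MvPolynomial (Fin ℓ) K, ∑ o, g o • Θ o = 0 →
      ∀ o, aeval p (g o) = 0 := by
    intro g hg o
    rw [Fintype.sum_option, add_comm] at hg
    obtain ⟨q, h1, h2⟩ := D.relation (g := fun i => g (some i)) (h := g none) hg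
    cases o with
    | none => rw [h1, map_mul, hp, mul_zero]
    | some i => rw [h2, map_neg, map_mul, hcon, mul_zero, neg_zero]
  have hprod : ∀ o o', aeval p (∑ i, T o i * N i o') = if o' = o then aeval p Q else 0 := by
    intro o o'
    have h0 : ∑ o', ((∑ i, T o i * N i o') - if o' = o then Q else 0) • Θ o' = 0 := by
      simp only [sub_smul, Finset.sum_sub_distrib, ite_smul, zero_smul, Finset.sum_ite_eq',
        Finset.mem_univ, if_true, Finset.sum_smul]
      rw [Finset.sum_comm]
      simp only [mul_smul, ← Finset.smul_sum, ← hN]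
      conv_lhs => rw [hT o]
      rw [Finset.smul_sum, ← Finset.sum_sub_distrib]
      exact Finset.sum_eq_zero fun i _ => by rw [smul_comm, sub_self]
    have := hrel _ h0 o'
    rw [map_sub, sub_eq_zero] at this
    rw [this]
    split_ifs <;> simp
  set Mp : Matrix (Fin ℓ) (Option (Fin ℓ)) F := Matrix.of fun i o => aeval p (N i o)
  set Cp : Matrix (Option (Fin ℓ)) (Fin ℓ) F := Matrix.of fun o i => aeval p (T o i)
  have hCM : Cp * Mp = aeval p Q • 1 := by
    ext o o'
    have := hprod o o'
    rw [map_sum] at this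
    simp only [map_mul] at this
    simp only [Matrix.mul_apply, Cp, Mp, Matrix.of_apply, Matrix.smul_apply, smul_eq_mul,
      Matrix.one_apply]
    rw [this]
    by_cases hoo : o' = o
    · simp [hoo]
    · simp [hoo, Ne.symm hoo]
  have hinj : Function.Injective Mp.mulVecLin := by
    rw [← LinearMap.ker_eq_bot, LinearMap.ker_eq_bot']
    intro x hx
    rw [Matrix.mulVecLin_apply] at hx
    have h3 : (Cp * Mp).mulVec x = 0 := by
      rw [← Matrix.mulVec_mulVec, hx, Matrix.mulVec_zero]
    rw [hCM, Matrix.smul_mulVec, Matrix.one_mulVec] at h3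
    exact (smul_eq_zero.1 h3).resolve_left hQne
  have := LinearMap.finrank_le_finrank_of_injective hinj
  simp at this

end Del

/-- For free `A`: if the deletion is free, some exponent is `|A| - |A^H|`. -/
theorem exp_of_del_free {A : Finset (Submodule K (Fin ℓ → K))} (hA : IsArrangement A)
    {H : Submodule K (Fin ℓ → K)} (hH : H ∈ A) {e : Fin ℓ → ℕ} (he : IsFreeExp A e)
    (hd : IsFree (A.erase H)) : ∃ j, e j = dd A H + 1 := by
  obtain ⟨θ, hom, gen, ind⟩ := he
  obtain ⟨φ, f, D⟩ := exists_del hA hH hom gen ind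
  have h0 : ∀ L : Submodule K (Fin ℓ → K), aeval (0 : Fin ℓ → K) (lf L) = 0 := by
    intro L; simp [lf, linPoly]
  obtain ⟨j, hj⟩ := D.nonvanish (0 : Fin ℓ → K) (h0 H) (by
    rw [Finset.filter_true_of_mem fun L _ => h0 L]; exact hd)
  refine ⟨j, D.sup_eq (j := j) ?_⟩
  intro h
  apply hj
  rw [aeval_zero, h, map_zero]


theorem applyLin_euler (φ : Module.Dual K (Fin ℓ → K)) : applyLin eulerD φ = linPoly φ := rfl

theorem eulerD_mem (A : Finset (Submodule K (Fin ℓ → K))) : eulerD ∈ DM A :=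
  mem_DM.2 fun _ _ φ _ => dvd_of_eq (applyLin_euler φ).symm

theorem cD_mem {A : Finset (Submodule K (Fin ℓ → K))} (hA : IsArrangement A) {v : Fin ℓ → K}
    (hv : v ∈ A.inf id) : cD v ∈ DM A := by
  rw [mem_DM, inD_iff hA]
  intro L hL
  have h1 : v ∈ L := (Finset.inf_le hL : A.inf id ≤ id L) hv
  rw [← frm_ker hA hL, LinearMap.mem_ker] at h1
  rw [applyLin_cD, h1, map_zero]; exact dvd_zero _

theorem applyLin_homog {θ : Deriv K ℓ} {n : ℕ} (h : HomogDeriv θ n)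
    (φ : Module.Dual K (Fin ℓ → K)) : (applyLin θ φ).IsHomogeneous n :=
  IsHomogeneous.sum _ _ _ fun i _ => by simpa using (isHomogeneous_C (Fin ℓ) _).mul (h i)

theorem homog_zero_eq {f : MvPolynomial (Fin ℓ) K} (h : f.IsHomogeneous 0) :
    f = C (constantCoeff f) := by
  conv_lhs => rw [← homogeneousComponent_eq_self h, homogeneousComponent_zero]
  simp [constantCoeff_eq]

theorem cc_homog {f : MvPolynomial (Fin ℓ) K} {n : ℕ} (h : f.IsHomogeneous n) (hn : n ≠ 0) :
    constantCoeff f = 0 := by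
  rw [constantCoeff_eq]
  refine h.coeff_eq_zero ?_
  simp; omega

theorem homog_zero_apply {A : Finset (Submodule K (Fin ℓ → K))} (hA : IsArrangement A)
    {θ : Deriv K ℓ} (hθ : θ ∈ DM A) (h : HomogDeriv θ 0) {L} (hL : L ∈ A) :
    applyLin θ (frm L) = 0 := by
  have h1 := (inD_iff hA _).1 (mem_DM.1 hθ) L hL
  rw [homog_zero_eq (applyLin_homog h (frm L))] at h1 ⊢
  by_contra hne
  have hne' : constantCoeff (applyLin θ (frm L)) ≠ 0 := fun h => hne (by rw [h, map_zero])
  exact (lf_prime hA hL).not_unit (isUnit_of_dvd_unit h1 (isUnit_C' hne'))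

theorem homog_zero_cD {A : Finset (Submodule K (Fin ℓ → K))} (hA : IsArrangement A)
    {θ : Deriv K ℓ} (hθ : θ ∈ DM A) (h : HomogDeriv θ 0) :
    ∃ w ∈ A.inf id, θ = cD w := by
  have h1 : θ = cD (fun i => constantCoeff (θ i)) := by
    funext i; exact homog_zero_eq (h i)
  refine ⟨_, ?_, h1⟩
  have : ∀ L ∈ A, (fun i => constantCoeff (θ i)) ∈ L := by
    intro L hL
    rw [← frm_ker hA hL, LinearMap.mem_ker]
    have := homog_zero_apply hA hθ h hL
    rw [h1, applyLin_cD] at this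
    exact (C_injective (Fin ℓ) K) (this.trans (map_zero _).symm)
  simpa [Finset.inf_eq_iInf, Submodule.mem_iInf] using this

theorem zeros_ge {A : Finset (Submodule K (Fin ℓ → K))} (hA : IsArrangement A)
    {e : Fin ℓ → ℕ} {θ : Fin ℓ → Deriv K ℓ}
    (hom : ∀ i, HomogDeriv (θ i) (e i)) (gen : GeneratesD A θ) :
    Module.finrank K (A.inf id : Submodule K (Fin ℓ → K)) ≤ (Finset.univ.filter fun j => e j = 0).card := by
  set w : Fin ℓ → Fin ℓ → K := fun j i => constantCoeff (θ j i)
  have : A.inf id ≤ Submodule.span K ((Finset.univ.filter fun j => e j = 0).image w : Set (Fin ℓ → K)) := by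
    intro v hv
    obtain ⟨c, hc⟩ := gen.2 _ (mem_DM.1 (cD_mem hA hv))
    have : v = ∑ j, constantCoeff (c j) • w j := by
      funext i
      have h := congrArg constantCoeff (congrFun hc i)
      simpa [cD, w, Finset.sum_apply] using h
    rw [this]
    refine Submodule.sum_mem _ fun j _ => Submodule.smul_mem _ _ ?_
    by_cases hj : e j = 0
    · apply Submodule.subset_span
      simp only [Finset.coe_image, Set.mem_image]
      exact ⟨j, by simp [hj], rfl⟩
    · have : w j = 0 := by
        funext i; exact cc_homog (hom j i) hj
      rw [this]; exact Submodule.zero_mem _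
  calc _ ≤ _ := Submodule.finrank_mono this
    _ ≤ _ := finrank_span_finset_le_card _
    _ ≤ _ := Finset.card_image_le

theorem euler_coeff {A : Finset (Submodule K (Fin ℓ → K))} (hA : IsArrangement A) (hne : A.Nonempty)
    {e : Fin ℓ → ℕ} {θ : Fin ℓ → Deriv K ℓ}
    (hom : ∀ i, HomogDeriv (θ i) (e i)) (gen : GeneratesD A θ) :
    ∃ (u : Fin ℓ → MvPolynomial (Fin ℓ) K) (j : Fin ℓ) (a : K),
      e j = 1 ∧ a ≠ 0 ∧ u j = C a ∧ eulerD = ∑ j, u j • θ j := by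
  obtain ⟨u, hu⟩ := gen.2 _ (mem_DM.1 (eulerD_mem A))
  have hE : HomogDeriv (eulerD (K := K) (ℓ := ℓ)) 1 := fun i => isHomogeneous_X _ _
  have h1 := congrArg (dComp 1) hu
  rw [dComp_self hE, dComp_sum, Finset.sum_congr rfl fun j _ => dComp_smul_right (hom j) 1 (u j)] at h1
  by_contra hcon
  push Not at hcon
  obtain ⟨L, hL⟩ := hne
  have h2 := congrArg (fun η => applyLin η (frm L)) h1
  simp only [applyLin_sum, applyLin_euler, applyLin_smul] at h2
  apply lf_ne hA hL
  rw [lf, h2]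
  apply Finset.sum_eq_zero
  intro j _
  rcases Nat.lt_trichotomy (e j) 1 with h | h | h
  · have : e j = 0 := by omega
    rw [homog_zero_apply hA (gen.1 j) (this ▸ hom j) hL, mul_zero]
  · rw [if_pos h.le, h]
    have := fun ha => hcon _ j (constantCoeff (u j)) h ha (by
      rw [if_pos h.le, h, Nat.sub_self, homogeneousComponent_zero]; simp [constantCoeff_eq]) h1
    have h0 : constantCoeff (u j) = 0 := by by_contra h; exact this h
    rw [Nat.sub_self, homogeneousComponent_zero, ← constantCoeff_eq, h0]; simp
  · rw [if_neg (by omega), zero_mul]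

theorem euler_basis {A : Finset (Submodule K (Fin ℓ → K))} (hA : IsArrangement A) (hne : A.Nonempty)
    {e : Fin ℓ → ℕ} (he : IsFreeExp A e) : ∃ θ : Fin ℓ → Deriv K ℓ,
    (∀ i, HomogDeriv (θ i) (e i)) ∧ GeneratesD A θ ∧ IndepD θ ∧ ∃ j, e j = 1 ∧ θ j = eulerD := by
  obtain ⟨θ, hom, gen, ind⟩ := he
  obtain ⟨u, j, a, hj, ha, huj, hu⟩ := euler_coeff hA hne hom gen
  obtain ⟨c, hc, hdet⟩ := saito_det hA gen
  have hsb : GeneratesD A (Function.update θ j eulerD) ∧ IndepD (Function.update θ j eulerD) := by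
    apply saito_basis hA (c := a * c)
    · intro i
      by_cases hi : i = j
      · subst hi; simp only [Function.update_self]; exact eulerD_mem A
      · simp only [Function.update_of_ne hi]
        exact gen.1 i
    · exact mul_ne_zero ha hc
    · have e1 : dmat (Function.update θ j eulerD) = (dmat θ).updateRow j eulerD := rfl
      have e3 := Matrix.det_updateRow_sum (dmat θ) j u
      have e4 : (∑ k, u k • (dmat θ) k) = ∑ k, u k • θ k := rfl
      rw [e4, ← hu] at e3
      rw [e1, e3, smul_eq_mul, hdet, C_mul, huj, mul_assoc]
  refine ⟨Function.update θ j eulerD, ?_, hsb.1, hsb.2, j, hj, Function.update_self _ _ _⟩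
  intro i
  by_cases hi : i = j
  · subst hi; simp only [Function.update_self]; rw [hj]; exact fun i => isHomogeneous_X _ _
  · simp only [Function.update_of_ne hi]; exact hom i

theorem pj_ker_le (Y : Submodule K (Fin ℓ → K)) {P : Ideal (MvPolynomial (Fin ℓ) K)}
    (h : ∀ φ : Module.Dual K (Fin ℓ → K), Y ≤ LinearMap.ker φ → linPoly φ ∈ P) :
    RingHom.ker (res (pj Y)) ≤ P := by
  intro f hf
  have := res_sub_mem (fun φ : {φ : Module.Dual K (Fin ℓ → K) // Y ≤ LinearMap.ker φ} => φ.1) (Y := Y)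
    (by
      intro v hv
      by_contra hvY
      obtain ⟨g, hg, hle⟩ := Submodule.exists_le_ker_of_notMem hvY
      rw [Submodule.mem_iInf] at hv
      exact hg (hv ⟨g, hle⟩)) (I := P) (fun φ => h φ.1 φ.2) f
  rwa [RingHom.mem_ker.1 hf, sub_zero] at this

theorem height_pj (n : ℕ) : ∀ (Y : Submodule K (Fin ℓ → K)), Module.finrank K Y + n = ℓ →
    (n : ℕ∞) ≤ (RingHom.ker (res (pj Y))).height := by
  induction n with
  | zero => intro Y _; simp
  | succ n ih =>
    intro Y hY
    have hlt : Y < ⊤ := by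
      rw [lt_top_iff_ne_top]; rintro rfl
      rw [finrank_top, Module.finrank_fin_fun] at hY; omega
    obtain ⟨v, -, hv⟩ := SetLike.exists_of_lt hlt
    have hd : Module.finrank K (Y ⊔ Submodule.span K {v} : Submodule K (Fin ℓ → K)) = Module.finrank K Y + 1 := by
      have h1 := Submodule.finrank_sup_add_finrank_inf_eq Y (Submodule.span K {v})
      have hv0 : v ≠ 0 := by rintro rfl; exact hv (Submodule.zero_mem _)
      have h2 : Y ⊓ Submodule.span K {v} = ⊥ := by
        rw [← disjoint_iff, Submodule.disjoint_span_singleton' hv0]; exact hv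
      rw [h2, finrank_span_singleton hv0, finrank_bot] at h1
      omega
    have h1 := ih (Y ⊔ Submodule.span K {v}) (by omega)
    haveI : (RingHom.ker (res (pj Y))).IsPrime := RingHom.ker_isPrime _
    haveI : (RingHom.ker (res (pj (Y ⊔ Submodule.span K {v})))).IsPrime := RingHom.ker_isPrime _
    have h2 : RingHom.ker (res (pj (Y ⊔ Submodule.span K {v}))) < RingHom.ker (res (pj Y)) := by
      refine lt_of_le_of_ne (pj_ker_le _ fun φ hφ => ?_) fun heq => ?_
      · exact RingHom.mem_ker.2 ((res_pj_eq_zero _ _).2 (le_sup_left.trans hφ))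
      · obtain ⟨g, hg, hle⟩ := Submodule.exists_le_ker_of_notMem hv
        have h3 : linPoly g ∈ RingHom.ker (res (pj Y)) := RingHom.mem_ker.2 ((res_pj_eq_zero _ _).2 hle)
        rw [← heq, RingHom.mem_ker, res_pj_eq_zero] at h3
        exact hg (h3 (le_sup_right (a := Y) (Submodule.mem_span_singleton_self v)))
    have h3 := Ideal.height_add_one_le_of_lt_of_isPrime h2
    push_cast
    exact le_trans (by gcongr) h3


theorem const_dual {e : Fin ℓ → ℕ} {θ : Fin ℓ → Deriv K ℓ}
    (hom : ∀ i, HomogDeriv (θ i) (e i)) (ind : IndepD θ) {z : Fin ℓ} (hz : e z = 0) :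
    ∃ (ξ : Module.Dual K (Fin ℓ → K)) (a : K), a ≠ 0 ∧ applyLin (θ z) ξ = C a ∧
      ∀ j, j ≠ z → e j = 0 → applyLin (θ j) ξ = 0 := by
  set w : Fin ℓ → Fin ℓ → K := fun j i => constantCoeff (θ j i) with hw
  have hcD : ∀ j, e j = 0 → θ j = cD (w j) := by
    intro j hj; funext i; exact homog_zero_eq (hj ▸ hom j i)
  have h1 : w z ∉ Submodule.span K (w '' {j | j ≠ z ∧ e j = 0}) := by
    intro hmem
    have : ∀ v ∈ Submodule.span K (w '' {j | j ≠ z ∧ e j = 0}),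
        ∃ c : Fin ℓ → MvPolynomial (Fin ℓ) K, c z = 0 ∧ cD v = ∑ j, c j • θ j := by
      intro v hv
      induction hv using Submodule.span_induction with
      | mem x h =>
        obtain ⟨j, ⟨hj, hj0⟩, rfl⟩ := h
        refine ⟨Pi.single j 1, Pi.single_eq_of_ne hj.symm _, ?_⟩
        rw [Finset.sum_eq_single j]
        · rw [Pi.single_eq_same, one_smul, hcD j hj0]
        · intro b _ hb; rw [Pi.single_eq_of_ne hb, zero_smul]
        · simp
      | zero => exact ⟨0, rfl, by funext i; simp [cD]⟩
      | add x y _ _ hx hy =>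
        obtain ⟨c, hc, h⟩ := hx
        obtain ⟨c', hc', h'⟩ := hy
        refine ⟨c + c', by simp [hc, hc'], ?_⟩
        simp only [Pi.add_apply, add_smul, Finset.sum_add_distrib, ← h, ← h']
        funext i; simp [cD]
      | smul a x _ hx =>
        obtain ⟨c, hc, h⟩ := hx
        refine ⟨fun j => C a * c j, by simp [hc], ?_⟩
        simp only [mul_smul, ← Finset.smul_sum, ← h]
        funext i; simp [cD]
    obtain ⟨c, hc, h⟩ := this _ hmem
    rw [← hcD z hz] at h
    have := ind (fun j => c j - Pi.single (M := fun _ => MvPolynomial (Fin ℓ) K) z 1 j) (by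
      simp only [sub_smul, Finset.sum_sub_distrib, ← h]
      rw [Finset.sum_eq_single z]
      · simp
      · intro b _ hb; rw [Pi.single_eq_of_ne hb, zero_smul]
      · simp) z
    simp [hc] at this
  obtain ⟨ξ, hξ, hle⟩ := Submodule.exists_le_ker_of_notMem h1
  refine ⟨ξ, ξ (w z), hξ, by rw [hcD z hz, applyLin_cD], fun j hj hj0 => ?_⟩
  have : ξ (w j) = 0 := hle (Submodule.subset_span ⟨j, ⟨hj, hj0⟩, rfl⟩)
  rw [hcD j hj0, applyLin_cD, this, map_zero]

theorem back_step {A : Finset (Submodule K (Fin ℓ → K))} (hA : IsArrangement A)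
    {H : Submodule K (Fin ℓ → K)} (hH : H ∈ A) {e : Fin ℓ → ℕ} (he : IsFreeExp A e)
    (hi : ∃ i, e i = dd A H + 1)
    (hloc : ∀ B ⊆ A, A.inf id < B.inf id → B.inf id ≤ H →
      IsFree ((localize A (B.inf id)).erase H)) : IsFree (A.erase H) := by
  obtain ⟨θ, hom, gen, ind, j1, hj1, hE⟩ := euler_basis hA ⟨H, hH⟩ he
  obtain ⟨i, hi⟩ := hi
  obtain ⟨φ, f, D⟩ := exists_del hA hH hom gen ind
  by_contra hnf
  have hcc : ∀ j, constantCoeff (f j) = 0 := by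
    intro j; by_contra hj; exact hnf (D.free_of_const hj)
  have hf0 : ∀ j, dd A H + 1 ≤ e j → f j = 0 := by
    intro j hj
    rcases hj.eq_or_lt with h | h
    · have := D.fHom j h.ge
      rw [← h, Nat.sub_self] at this
      rw [homog_zero_eq this, hcc, map_zero]
    · exact D.fZero j h
  have happ : ∀ β : Module.Dual K (Fin ℓ → K),
      lf H * applyLin φ β = ∑ j, f j * applyLin (θ j) β := by
    intro β
    have := congrArg (fun η => applyLin η β) D.rel
    simpa only [applyLin_sum, applyLin_smul] using this
  have hij : i ≠ j1 := by
    rintro rfl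
    have hd : dd A H = 0 := by omega
    have h1 := happ (frm H)
    rw [Finset.sum_eq_zero (fun j _ => ?_)] at h1
    · have h2 := (mul_eq_zero.1 h1).resolve_left (lf_ne hA hH)
      have h3 := D.phiB
      rw [h2, zero_sub, dvd_neg] at h3
      exact lf_not_dvd_Bp hA hH h3
    · by_cases hj : e j = 0
      · rw [homog_zero_apply hA (gen.1 j) (hj ▸ hom j) hH, mul_zero]
      · rw [hf0 j (by omega), zero_mul]
  set X := A.inf id with hX
  set Z := Finset.univ.filter fun j => e j = 0 with hZ
  have hZX : Module.finrank K X ≤ Z.card := zeros_ge hA hom gen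
  set T := ((Zᶜ).erase j1).erase i with hT
  have hTc : T.card + 2 + Z.card = ℓ := by
    have h1 : j1 ∈ Zᶜ := by simp [hZ, hj1]
    have h2 : i ∈ (Zᶜ).erase j1 := by simp [hZ, hij, hi]
    have h3 : T.card + 1 = (Zᶜ.erase j1).card := by rw [hT]; convert Finset.card_erase_add_one h2
    have h4 : (Zᶜ.erase j1).card + 1 = Zᶜ.card := by convert Finset.card_erase_add_one h1
    have h5 : Zᶜ.card + Z.card = Fintype.card (Fin ℓ) := by convert Finset.card_compl_add_card Z
    rw [Fintype.card_fin] at h5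
    omega
  set G : Finset (MvPolynomial (Fin ℓ) K) := insert (lf H) (T.image f) with hG
  have hGc : G.card ≤ T.card + 1 := (Finset.card_insert_le _ _).trans (by gcongr; exact Finset.card_image_le)
  have hGm : Ideal.span (G : Set (MvPolynomial (Fin ℓ) K)) ≤
      RingHom.ker (constantCoeff (σ := Fin ℓ) (R := K)) := by
    rw [Ideal.span_le]
    intro g hg
    simp only [hG, Finset.coe_insert, Finset.coe_image, Set.mem_insert_iff, Set.mem_image] at hg
    rcases hg with rfl | ⟨j, _, rfl⟩
    · exact RingHom.mem_ker.2 (cc_homog (linPoly_homog _) one_ne_zero)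
    · exact RingHom.mem_ker.2 (hcc j)
  have : (RingHom.ker (constantCoeff (σ := Fin ℓ) (R := K))).IsPrime := RingHom.ker_isPrime _
  obtain ⟨P, hPmin, -⟩ := Ideal.exists_minimalPrimes_le hGm
  have hPh := Ideal.height_le_card_of_mem_minimalPrimes_span_finset hPmin
  have hPprime : P.IsPrime := hPmin.1.1
  have hGP : ∀ g ∈ G, g ∈ P := fun g hg => hPmin.1.2 (Ideal.subset_span hg)
  obtain ⟨β, hβX, hβP⟩ : ∃ β : Module.Dual K (Fin ℓ → K), X ≤ LinearMap.ker β ∧ linPoly β ∉ P := by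
    by_contra hcon
    push Not at hcon
    have h1 := Ideal.height_mono (pj_ker_le X hcon)
    have hXl : Module.finrank K X ≤ ℓ := by simpa using X.finrank_le
    have h2 := height_pj (ℓ - Module.finrank K X) X (by omega)
    have h3 : ((ℓ - Module.finrank K X : ℕ) : ℕ∞) ≤ (G.card : ℕ∞) := h2.trans (h1.trans hPh)
    have h4 : ℓ - Module.finrank K X ≤ G.card := by exact_mod_cast h3
    omega
  have hfH : lf H ∈ P := hGP _ (by simp [hG])
  have hfT : ∀ j, e j ≠ 0 → j ≠ j1 → f j ∈ P := by
    intro j hj hjj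
    by_cases hji : j = i
    · subst hji; rw [hf0 _ hi.ge]; exact P.zero_mem
    · apply hGP
      rw [hG, Finset.mem_insert]; right
      exact Finset.mem_image_of_mem _ (by simp [hT, hZ, hj, hjj, hji])
  have hf1 : f j1 ∈ P := by
    have h1 := happ β
    rw [← Finset.add_sum_erase _ _ (Finset.mem_univ j1), hE, applyLin_euler] at h1
    have h2 : ∑ j ∈ Finset.univ.erase j1, f j * applyLin (θ j) β ∈ P := by
      refine P.sum_mem fun j hj => ?_
      by_cases hj0 : e j = 0
      · obtain ⟨w, hw, h⟩ := homog_zero_cD hA (gen.1 j) (hj0 ▸ hom j)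
        have : β w = 0 := hβX hw
        rw [h, applyLin_cD, this, map_zero, mul_zero]; exact P.zero_mem
      · exact P.mul_mem_right _ (hfT j hj0 (Finset.ne_of_mem_erase hj))
    have h3 : f j1 * linPoly β ∈ P := by
      rw [eq_comm, ← eq_sub_iff_add_eq] at h1
      rw [h1]; exact P.sub_mem (P.mul_mem_right _ hfH) h2
    exact (hPprime.mem_or_mem h3).resolve_right hβP
  have hfall : ∀ j, f j ∈ P := by
    intro z
    by_cases hz : e z = 0
    · obtain ⟨ξ, a, ha, hξ, hξ'⟩ := const_dual hom ind hz
      have h1 := happ ξ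
      rw [← Finset.add_sum_erase _ _ (Finset.mem_univ z), hξ] at h1
      have h2 : ∑ j ∈ Finset.univ.erase z, f j * applyLin (θ j) ξ ∈ P := by
        refine P.sum_mem fun j hj => ?_
        by_cases hj0 : e j = 0
        · rw [hξ' j (Finset.ne_of_mem_erase hj) hj0, mul_zero]; exact P.zero_mem
        · refine P.mul_mem_right _ ?_
          by_cases hjj : j = j1
          · rw [hjj]; exact hf1
          · exact hfT j hj0 hjj
      have h3 : f z * C a ∈ P := by
        rw [eq_comm, ← eq_sub_iff_add_eq] at h1
        rw [h1]; exact P.sub_mem (P.mul_mem_right _ hfH) h2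
      refine (hPprime.mem_or_mem h3).resolve_right fun h => ?_
      exact hPprime.ne_top (P.eq_top_of_isUnit_mem h (isUnit_C' ha))
    · by_cases hjj : z = j1
      · rw [hjj]; exact hf1
      · exact hfT z hz hjj
  let F := FractionRing (MvPolynomial (Fin ℓ) K ⧸ P)
  let ev : MvPolynomial (Fin ℓ) K →ₐ[K] F :=
    (Algebra.algHom K (MvPolynomial (Fin ℓ) K ⧸ P) F).comp (Ideal.Quotient.mkₐ K P)
  have hev : ∀ g, ev g = 0 ↔ g ∈ P := by
    intro g
    have : ev g = algebraMap (MvPolynomial (Fin ℓ) K ⧸ P) F (Ideal.Quotient.mk P g) := rfl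
    rw [this, map_eq_zero_iff _ (IsFractionRing.injective _ _), Ideal.Quotient.eq_zero_iff_mem]
  have hev' : ∀ g, aeval (fun i => ev (MvPolynomial.X i)) g = ev g := by
    intro g
    exact (DFunLike.congr_fun (MvPolynomial.aeval_unique ev) g).symm
  obtain ⟨j, hj⟩ := D.nonvanish (F := F) (fun i => ev (MvPolynomial.X i))
    (by rw [hev', hev]; exact hfH) (by
      simp only [hev', hev]
      set B := A.filter fun L => lf L ∈ P with hB
      have hBA : B ⊆ A := Finset.filter_subset _ _
      have hmem : ∀ β : Module.Dual K (Fin ℓ → K), B.inf id ≤ LinearMap.ker β → linPoly β ∈ P := by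
        intro β hβ
        refine linPoly_mem_of_family (fun L : {L // L ∈ B} => frm L.1) (fun L => (Finset.mem_filter.1 L.2).2) ?_
        refine le_trans ?_ hβ
        rw [Finset.inf_eq_iInf]
        refine le_iInf₂ fun L hL => ?_
        refine (iInf_le _ (⟨L, hL⟩ : {L // L ∈ B})).trans ?_
        simp only [frm_ker hA (hBA hL)]; exact le_rfl
      have hloceq : localize A (B.inf id) = B := by
        ext L
        simp only [localize, Finset.mem_filter]
        constructor
        · rintro ⟨hL, hle⟩
          refine Finset.mem_filter.2 ⟨hL, hmem _ ?_⟩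
          rwa [frm_ker hA hL]
        · intro hL
          exact ⟨hBA hL, Finset.inf_le (f := id) hL⟩
      have := hloc B hBA (lt_of_le_of_ne (Finset.inf_mono hBA) fun h => hβP (hmem β (h ▸ hβX)))
        (Finset.inf_le (f := id) (Finset.mem_filter.2 ⟨hH, hfH⟩))
      rwa [hloceq] at this)
  exact hj (by rw [hev', hev]; exact hfall j)


section Cplx
variable {ι : Type} {R N : Type} [CommRing R] [AddCommGroup N] [Module R N]

/-- Koszul sign. -/
def ksg (o : ι → ℕ) (C : Finset ι) (i : ι) : ℤ := (-1) ^ (C.filter fun j => o j < o i).card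

theorem ksg_sq (o : ι → ℕ) (C : Finset ι) (i : ι) : ksg o C i * ksg o C i = 1 := by
  rw [ksg, ← mul_pow]; simp

theorem ksg_erase_self (o : ι → ℕ) (C : Finset ι) (i : ι) : ksg o (C.erase i) i = ksg o C i := by
  unfold ksg
  congr 2
  ext j
  simp only [Finset.mem_filter, Finset.mem_erase]
  constructor
  · rintro ⟨⟨_, h⟩, h2⟩; exact ⟨h, h2⟩
  · rintro ⟨h, h2⟩
    refine ⟨⟨?_, h⟩, h2⟩
    rintro rfl; exact lt_irrefl _ h2

theorem ksg_erase_lt (o : ι → ℕ) (C : Finset ι) {i j : ι} (hi : i ∈ C) (h : o i < o j) :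
    ksg o (C.erase i) j = - ksg o C j := by
  unfold ksg
  have : (C.filter fun k => o k < o j).card = ((C.erase i).filter fun k => o k < o j).card + 1 := by
    rw [Finset.filter_erase, Finset.card_erase_add_one (Finset.mem_filter.2 ⟨hi, h⟩)]
  rw [this, pow_succ]; ring

theorem ksg_erase_gt (o : ι → ℕ) (C : Finset ι) {i j : ι} (h : o j < o i) :
    ksg o (C.erase i) j = ksg o C j := by
  unfold ksg
  congr 2
  rw [Finset.filter_erase, Finset.erase_eq_of_notMem]
  rw [Finset.mem_filter]; rintro ⟨_, h2⟩; omega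

theorem ksg_anti {o : ι → ℕ} (ho : Function.Injective o) {C : Finset ι} {i j : ι} (hi : i ∈ C)
    (hj : j ∈ C) (hij : i ≠ j) :
    ksg o C i * ksg o (C.erase i) j = - (ksg o C j * ksg o (C.erase j) i) := by
  rcases lt_or_gt_of_ne (ho.ne hij) with h | h
  · rw [ksg_erase_lt o C hi h, ksg_erase_gt o C h]; ring
  · rw [ksg_erase_lt o C hj h, ksg_erase_gt o C h]; ring

/-- Differential of the cube complex. -/
def cd (o : ι → ℕ) : (Finset ι → N) →ₗ[R] (Finset ι → N) where
  toFun ω C := ∑ i ∈ C, ksg o C i • ω (C.erase i)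
  map_add' x y := by
    funext C; simp [Finset.sum_add_distrib]
  map_smul' a x := by
    funext C
    simp only [Pi.smul_apply, RingHom.id_apply, Finset.smul_sum]
    exact Finset.sum_congr rfl fun i _ => smul_comm _ _ _

theorem cd_apply (o : ι → ℕ) (ω : Finset ι → N) (C : Finset ι) :
    cd (R := R) o ω C = ∑ i ∈ C, ksg o C i • ω (C.erase i) := rfl

theorem cd_cd {o : ι → ℕ} (ho : Function.Injective o) (ω : Finset ι → N) :
    cd (R := R) o (cd (R := R) o ω) = 0 := by
  funext C
  simp only [cd_apply, Finset.smul_sum, Pi.zero_apply]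
  rw [Finset.sum_sigma']
  refine Finset.sum_involution (fun x _ => ⟨x.2, x.1⟩) ?_ ?_ ?_ ?_
  · rintro ⟨i, j⟩ h
    simp only [Finset.mem_sigma, Finset.mem_erase] at h
    simp only [smul_smul]
    rw [ksg_anti ho h.1 h.2.2 (Ne.symm h.2.1), Finset.erase_right_comm, neg_smul, neg_add_cancel]
  · rintro ⟨i, j⟩ h _ heq
    simp only [Finset.mem_sigma, Finset.mem_erase] at h
    simp only [Sigma.mk.injEq] at heq
    exact h.2.1 heq.1
  · rintro ⟨i, j⟩ h
    simp only [Finset.mem_sigma, Finset.mem_erase] at h ⊢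
    exact ⟨h.2.2, Ne.symm h.2.1, h.1⟩
  · rintro ⟨i, j⟩ _; rfl

/-- Homotopy. -/
def ch (o : ι → ℕ) (i : ι) (ω : Finset ι → N) : Finset ι → N := fun C =>
  if i ∈ C then 0 else ksg o C i • ω (insert i C)

theorem cd_ch {o : ι → ℕ} (ho : Function.Injective o) (i : ι) (ω : Finset ι → N) :
    cd (R := R) o (ch o i ω) + ch o i (cd (R := R) o ω) = ω := by
  funext C
  rw [Pi.add_apply, cd_apply]
  by_cases hi : i ∈ C
  · rw [Finset.sum_eq_single i]
    · simp only [ch, if_pos hi, add_zero, Finset.mem_erase, ne_eq, not_true, false_and, if_false]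
      rw [ksg_erase_self, smul_smul, ksg_sq, one_smul, Finset.insert_erase hi]
    · intro j _ hj
      simp only [ch]
      rw [if_pos (Finset.mem_erase.2 ⟨hj.symm, hi⟩), smul_zero]
    · intro h; exact absurd hi h
  · simp only [ch, if_neg hi]
    rw [cd_apply, Finset.sum_insert hi, smul_add, smul_smul, Finset.erase_insert hi]
    have : ksg o (insert i C) i = ksg o C i := by
      rw [← ksg_erase_self, Finset.erase_insert hi]
    rw [this, ksg_sq, one_smul, Finset.smul_sum, add_comm (ω C), ← add_assoc, ← Finset.sum_add_distrib]
    rw [Finset.sum_eq_zero, zero_add]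
    intro j hj
    have hij : i ≠ j := by rintro rfl; exact hi hj
    rw [if_neg (fun h => hi (Finset.mem_of_mem_erase h)), smul_smul, smul_smul,
      Finset.erase_insert_of_ne hij, ← add_smul]
    have h1 := ksg_anti ho (Finset.mem_insert_self i C) (Finset.mem_insert_of_mem hj) hij
    rw [this, Finset.erase_insert hi, Finset.erase_insert_of_ne hij] at h1
    have h2 : ksg o (insert i (C.erase j)) i = ksg o (C.erase j) i := by
      rw [← ksg_erase_self, Finset.erase_insert (fun h => hi (Finset.mem_of_mem_erase h))]
    rw [h2] at h1
    have : ksg o C j * ksg o (C.erase j) i + ksg o C i * ksg o (insert i C) j = 0 := by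
      have a1 := ksg_sq o C j
      have a2 := ksg_sq o (insert i C) j
      linear_combination (ksg o C j * ksg o (insert i C) j) * h1 - (ksg o C i * ksg o (insert i C) j) * a1
        - (ksg o C j * ksg o (C.erase j) i) * a2
    rw [this, zero_smul]

theorem cd_mem {o : ι → ℕ} {ω : Finset ι → N} {C : Finset ι} (G : AddSubgroup N)
    (h : ∀ i ∈ C, ω (C.erase i) ∈ G) : cd (R := R) o ω C ∈ G :=
  G.sum_mem fun i hi => G.zsmul_mem (h i hi) _
end Cplx

theorem exact_finrank {k V : Type} [Field k] [AddCommGroup V] [Module k V] (d : V →ₗ[k] V)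
    (E O : Submodule k V) [FiniteDimensional k E] [FiniteDimensional k O]
    (h1 : LinearMap.ker d ⊓ E = O.map d) (h2 : LinearMap.ker d ⊓ O = E.map d) :
    Module.finrank k E = Module.finrank k O := by
  have key : ∀ E : Submodule k V, FiniteDimensional k E →
      Module.finrank k (E.map d) + Module.finrank k (LinearMap.ker d ⊓ E : Submodule k V) = Module.finrank k E := by
    intro E _
    have := LinearMap.finrank_range_add_finrank_ker (d.domRestrict E)
    rw [LinearMap.range_domRestrict] at this
    rw [← this]
    congr 1
    have h : LinearMap.ker d ⊓ E = (LinearMap.ker (d.domRestrict E)).map E.subtype := by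
      ext v
      simp only [Submodule.mem_inf, LinearMap.mem_ker, Submodule.mem_map, Submodule.subtype_apply,
        LinearMap.domRestrict_apply]
      constructor
      · rintro ⟨h, h'⟩; exact ⟨⟨v, h'⟩, h, rfl⟩
      · rintro ⟨w, h, rfl⟩; exact ⟨h, w.2⟩
    rw [h]
    exact (LinearEquiv.finrank_eq (Submodule.equivMapOfInjective _ E.injective_subtype _)).symm
  have a := key E inferInstance
  have b := key O inferInstance
  rw [h1] at a
  rw [h2] at b
  omega

theorem finrank_pi_sub {k N J : Type} [Field k] [AddCommGroup N] [Module k N] [Fintype J]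
    (p : J → Submodule k N) [∀ j, FiniteDimensional k (p j)] :
    FiniteDimensional k (Submodule.pi Set.univ p) ∧
    Module.finrank k (Submodule.pi Set.univ p) = ∑ j, Module.finrank k (p j) := by
  let eqv : (Submodule.pi Set.univ p) ≃ₗ[k] (∀ j, p j) :=
    { toFun := fun x j => ⟨x.1 j, x.2 j (Set.mem_univ j)⟩
      invFun := fun y => ⟨fun j => (y j).1, fun j _ => (y j).2⟩
      map_add' := fun _ _ => rfl
      map_smul' := fun _ _ => rfl
      left_inv := fun _ => rfl
      right_inv := fun _ => rfl }
  exact ⟨eqv.symm.finiteDimensional, by rw [eqv.finrank_eq, Module.finrank_pi_fintype]⟩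


theorem finrank_homog (n : ℕ) :
    FiniteDimensional K (homogeneousSubmodule (Fin ℓ) K n) ∧
    (Module.finrank K (homogeneousSubmodule (Fin ℓ) K n) : ℤ) =
      PowerSeries.coeff n ((PowerSeries.mk 1 : PowerSeries ℤ) ^ ℓ) := by
  set T : Finset (Fin ℓ →₀ ℕ) := Finset.finsuppAntidiag Finset.univ n with hT
  have hmem : ∀ d : Fin ℓ →₀ ℕ, d ∈ T ↔ d.degree = n := by
    intro d
    simp [hT, Finset.mem_finsuppAntidiag, Finsupp.degree_eq_sum]
  let Ψ : homogeneousSubmodule (Fin ℓ) K n →ₗ[K] (T → K) :=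
    { toFun := fun p t => coeff t.1 p.1
      map_add' := fun p q => by funext t; simp
      map_smul' := fun a p => by funext t; simp }
  have hbij : Function.Bijective Ψ := by
    constructor
    · intro p q h
      apply Subtype.ext
      ext d
      by_cases hd : d.degree = n
      · exact congrFun h ⟨d, (hmem d).2 hd⟩
      · rw [IsHomogeneous.coeff_eq_zero p.2 hd, IsHomogeneous.coeff_eq_zero q.2 hd]
    · intro g
      refine ⟨⟨∑ t, monomial t.1 (g t), ?_⟩, ?_⟩
      · refine IsHomogeneous.sum _ _ _ fun t _ => ?_
        exact isHomogeneous_monomial _ ((hmem _).1 t.2)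
      · funext t
        show coeff t.1 (∑ s, monomial s.1 (g s)) = g t
        rw [coeff_sum, Finset.sum_eq_single t]
        · simp
        · intro b _ hb
          rw [coeff_monomial, if_neg (fun h => hb (Subtype.ext h))]
        · simp
  let eqv := LinearEquiv.ofBijective Ψ hbij
  refine ⟨eqv.symm.finiteDimensional, ?_⟩
  rw [eqv.finrank_eq, Module.finrank_fintype_fun_eq_card, Fintype.card_coe]
  have h1 : (PowerSeries.mk 1 : PowerSeries ℤ) ^ ℓ = ∏ _j : Fin ℓ, (PowerSeries.mk 1 : PowerSeries ℤ) := by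
    simp
  rw [h1, PowerSeries.coeff_prod]
  simp [hT]

/-- graded piece of a module of derivations -/
def grd (M : Submodule (MvPolynomial (Fin ℓ) K) (Deriv K ℓ)) (n : ℕ) : Submodule K (Deriv K ℓ) where
  carrier := {θ | θ ∈ M ∧ HomogDeriv θ n}
  add_mem' := fun ha hb => ⟨M.add_mem ha.1 hb.1, fun i => (ha.2 i).add (hb.2 i)⟩
  zero_mem' := ⟨M.zero_mem, fun _ => isHomogeneous_zero _ _ _⟩
  smul_mem' := fun c x hx => by
    refine ⟨?_, fun i => ?_⟩
    · rw [← IsScalarTower.algebraMap_smul (MvPolynomial (Fin ℓ) K) c x]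
      exact M.smul_mem _ hx.1
    · exact Submodule.smul_mem (homogeneousSubmodule (Fin ℓ) K n) c (hx.2 i)

theorem mem_grd {M : Submodule (MvPolynomial (Fin ℓ) K) (Deriv K ℓ)} {n : ℕ} {θ : Deriv K ℓ} :
    θ ∈ grd M n ↔ θ ∈ M ∧ HomogDeriv θ n := Iff.rfl

/-- Hilbert function of a module with a homogeneous basis. -/
theorem grd_finrank (M : Submodule (MvPolynomial (Fin ℓ) K) (Deriv K ℓ)) {m : ℕ}
    {θ : Fin m → Deriv K ℓ} {e : Fin m → ℕ} (hom : ∀ i, HomogDeriv (θ i) (e i))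
    (hmem : ∀ i, θ i ∈ M)
    (gen : ∀ η ∈ M, ∃ c : Fin m → MvPolynomial (Fin ℓ) K, η = ∑ i, c i • θ i) (ind : IndepD θ) (n : ℕ) :
    FiniteDimensional K (grd M n) ∧ (Module.finrank K (grd M n) : ℤ) =
      PowerSeries.coeff n ((∑ i, (PowerSeries.X : PowerSeries ℤ) ^ e i) * (PowerSeries.mk 1 : PowerSeries ℤ) ^ ℓ) := by
  let p : Fin m → Submodule K (MvPolynomial (Fin ℓ) K) := fun i =>
    if e i ≤ n then homogeneousSubmodule (Fin ℓ) K (n - e i) else ⊥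
  have hpos : ∀ i, e i ≤ n → p i = homogeneousSubmodule (Fin ℓ) K (n - e i) := fun i h => if_pos h
  have hneg : ∀ i, ¬ e i ≤ n → p i = ⊥ := fun i h => if_neg h
  clear_value p
  have hp : ∀ i, FiniteDimensional K (p i) := by
    intro i
    by_cases h : e i ≤ n
    · rw [hpos i h]; exact (finrank_homog _).1
    · rw [hneg i h]; infer_instance
  obtain ⟨f1, f2⟩ := finrank_pi_sub p
  let Ψ : (Fin m → MvPolynomial (Fin ℓ) K) →ₗ[K] Deriv K ℓ :=
    { toFun := fun c => ∑ i, c i • θ i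
      map_add' := fun x y => by simp [add_smul, Finset.sum_add_distrib]
      map_smul' := fun a x => by simp [Finset.smul_sum] }
  have hinj : Function.Injective Ψ := by
    rw [injective_iff_map_eq_zero]
    intro c hc
    funext i; exact ind c hc i
  have hmap : grd M n = (Submodule.pi Set.univ p).map Ψ := by
    ext η
    rw [mem_grd, Submodule.mem_map]
    constructor
    · rintro ⟨h1, h2⟩
      obtain ⟨c, hc⟩ := gen η h1
      refine ⟨fun j => if e j ≤ n then homogeneousComponent (n - e j) (c j) else 0, ?_, ?_⟩
      · intro i _
        show (if e i ≤ n then homogeneousComponent (n - e i) (c i) else 0) ∈ p i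
        by_cases h : e i ≤ n
        · rw [hpos i h]; simp only [if_pos h]; exact homogeneousComponent_isHomogeneous _ _
        · rw [hneg i h]; simp only [if_neg h]; exact Submodule.zero_mem _
      · have h3 := congrArg (dComp n) hc
        rw [dComp_self h2, dComp_sum, Finset.sum_congr rfl fun j _ => dComp_smul_right (hom j) n (c j)] at h3
        exact h3.symm
    · rintro ⟨c, hc, rfl⟩
      refine ⟨show ∑ i, c i • θ i ∈ M from M.sum_mem fun i _ => M.smul_mem _ (hmem i), fun k => ?_⟩
      show IsHomogeneous ((∑ i, c i • θ i) k) n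
      rw [Finset.sum_apply]
      refine IsHomogeneous.sum _ _ _ fun i _ => ?_
      have hci : c i ∈ p i := hc i (Set.mem_univ i)
      by_cases h : e i ≤ n
      · rw [hpos i h] at hci
        have := IsHomogeneous.mul (show (c i).IsHomogeneous (n - e i) from hci) (hom i k)
        rwa [Nat.sub_add_cancel h] at this
      · rw [hneg i h] at hci
        rw [(Submodule.mem_bot K).1 hci, zero_smul]
        exact isHomogeneous_zero _ _ _
  have eqv := Submodule.equivMapOfInjective Ψ hinj (Submodule.pi Set.univ p)
  rw [hmap]
  refine ⟨eqv.finiteDimensional, ?_⟩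
  rw [← eqv.finrank_eq, f2, Finset.sum_mul, map_sum, Nat.cast_sum]
  refine Finset.sum_congr rfl fun i _ => ?_
  rw [PowerSeries.coeff_X_pow_mul']
  by_cases h : e i ≤ n
  · rw [if_pos h, hpos i h]; exact (finrank_homog (n - e i)).2
  · rw [if_neg h, hneg i h]; simp


theorem dComp_cd {ι : Type} (o : ι → ℕ) (n : ℕ) (η : Finset ι → Deriv K ℓ) (C : Finset ι) :
    dComp n (cd (R := MvPolynomial (Fin ℓ) K) o η C) =
      cd (R := MvPolynomial (Fin ℓ) K) o (fun C => dComp n (η C)) C := by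
  rw [cd_apply, cd_apply, dComp_sum]
  refine Finset.sum_congr rfl fun i _ => ?_
  exact map_zsmul (AddMonoidHom.mk' (dComp n) (dComp_add n)) _ _

section CubeE
variable {ι : Type} [Fintype ι]

theorem cube_exact (M : Finset ι → Submodule (MvPolynomial (Fin ℓ) K) (Deriv K ℓ))
    (hgr : ∀ C n, ∀ θ ∈ M C, dComp n θ ∈ M C) (q : ι → MvPolynomial (Fin ℓ) K)
    (hq : ∀ C i, i ∉ C → ∀ θ ∈ M (insert i C), q i • θ ∈ M C)
    (hN : ∃ N, ∀ n ≥ N, ∀ a : MvPolynomial (Fin ℓ) K, a.IsHomogeneous n → a ∈ Ideal.span (Set.range q))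
    {o : ι → ℕ} (ho : Function.Injective o) :
    ∃ n0, ∀ n ≥ n0, ∀ ω : Finset ι → Deriv K ℓ, (∀ C, ω C ∈ grd (M C) n) →
      cd (R := MvPolynomial (Fin ℓ) K) o ω = 0 →
      ∃ η : Finset ι → Deriv K ℓ, (∀ C, η C ∈ grd (M C) n) ∧
        cd (R := MvPolynomial (Fin ℓ) K) o η = ω := by
  obtain ⟨N, hN⟩ := hN
  set d := cd (R := MvPolynomial (Fin ℓ) K) (N := Deriv K ℓ) o with hd
  set T : Submodule (MvPolynomial (Fin ℓ) K) (Finset ι → Deriv K ℓ) := Submodule.pi Set.univ M with hT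
  have memT : ∀ ω, ω ∈ T ↔ ∀ C, ω C ∈ M C := fun ω => ⟨fun h C => h C (Set.mem_univ C), fun h C _ => h C⟩
  set B := T.map d with hB
  have hQB : ∀ a ∈ Ideal.span (Set.range q), ∀ ω ∈ T, d ω = 0 → a • ω ∈ B := by
    intro a ha ω hω hdω
    induction ha using Submodule.span_induction with
    | mem x h =>
      obtain ⟨i, rfl⟩ := h
      refine ⟨q i • ch o i ω, ?_, ?_⟩
      · refine (memT _).2 fun C => ?_
        show q i • (if i ∈ C then 0 else ksg o C i • ω (insert i C)) ∈ M C
        by_cases hi : i ∈ C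
        · rw [if_pos hi, smul_zero]; exact Submodule.zero_mem _
        · rw [if_neg hi, smul_comm]
          exact (M C).toAddSubgroup.zsmul_mem (hq C i hi _ ((memT _).1 hω _)) _
      · have h1 := cd_ch (R := MvPolynomial (Fin ℓ) K) ho i ω
        have h2 : ch o i (d ω) = 0 := by
          rw [hdω]; funext C; simp [ch]
        rw [← hd, h2, add_zero] at h1
        rw [map_smul, h1]
    | zero => rw [zero_smul]; exact B.zero_mem
    | add x y _ _ hx hy => rw [add_smul]; exact B.add_mem hx hy
    | smul c x _ hx => rw [smul_eq_mul, mul_smul]; exact B.smul_mem _ hx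
  let G : ℕ → Set (Finset ι → Deriv K ℓ) := fun k =>
    {ω | ω ∈ T ∧ d ω = 0 ∧ ∃ m ≤ k, ∀ C, HomogDeriv (ω C) m}
  let Zk : ℕ →o Submodule (MvPolynomial (Fin ℓ) K) (Finset ι → Deriv K ℓ) :=
    { toFun := fun k => Submodule.span _ (G k)
      monotone' := by
        intro k k' hk
        apply Submodule.span_mono
        rintro ω ⟨h1, h2, m, hm, h3⟩
        exact ⟨h1, h2, m, hm.trans hk, h3⟩ }
  obtain ⟨k0, hk0⟩ := monotone_stabilizes_iff_noetherian.2
    (inferInstance : IsNoetherian (MvPolynomial (Fin ℓ) K) (Finset ι → Deriv K ℓ)) Zk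
  refine ⟨k0 + N, fun n hn ω hω hdω => ?_⟩
  have hωT : ω ∈ T := (memT _).2 fun C => (hω C).1
  have h1 : ω ∈ Zk k0 := by
    rw [hk0 n (by omega)]
    exact Submodule.subset_span ⟨hωT, hdω, n, le_rfl, fun C => (hω C).2⟩
  have h2 : (fun C => dComp n (ω C)) ∈ B := by
    have h1' : ω ∈ Submodule.span (MvPolynomial (Fin ℓ) K) (G k0) := h1
    refine Submodule.closure_induction (p := fun ζ _ => (fun C => dComp n (ζ C)) ∈ B) ?_ ?_ ?_ h1'
    · have : (fun C => dComp n ((0 : Finset ι → Deriv K ℓ) C)) = 0 := by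
        funext C i; simp [dComp]
      rw [this]; exact B.zero_mem
    · intro x y _ _ hx hy
      have : (fun C => dComp n ((x + y) C)) = (fun C => dComp n (x C)) + fun C => dComp n (y C) := by
        funext C; exact dComp_add n _ _
      rw [this]; exact B.add_mem hx hy
    · rintro r x ⟨hxT, hdx, m, hm, hxm⟩
      have : (fun C => dComp n ((r • x) C)) = homogeneousComponent (n - m) r • x := by
        funext C
        show dComp n (r • x C) = (homogeneousComponent (n - m) r : MvPolynomial (Fin ℓ) K) • x C
        rw [dComp_smul_right (hxm C), if_pos (by omega)]
      rw [this]
      exact hQB _ (hN (n - m) (by omega) _ (homogeneousComponent_isHomogeneous _ _)) x hxT hdx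
  have h3 : (fun C => dComp n (ω C)) = ω := by
    funext C; exact dComp_self (hω C).2
  rw [h3] at h2
  obtain ⟨η, hη, hdη⟩ := h2
  refine ⟨fun C => dComp n (η C), fun C => ⟨hgr C n _ ((memT _).1 hη C), dComp_homog _ _⟩, ?_⟩
  funext C
  rw [hd, ← dComp_cd, ← hd, hdη, dComp_self (hω C).2]

theorem cube_euler (M : Finset ι → Submodule (MvPolynomial (Fin ℓ) K) (Deriv K ℓ))
    (hgr : ∀ C n, ∀ θ ∈ M C, dComp n θ ∈ M C) (hmono : ∀ C, ∀ i ∈ C, M (C.erase i) ≤ M C)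
    (q : ι → MvPolynomial (Fin ℓ) K)
    (hq : ∀ C i, i ∉ C → ∀ θ ∈ M (insert i C), q i • θ ∈ M C)
    (hN : ∃ N, ∀ n ≥ N, ∀ a : MvPolynomial (Fin ℓ) K, a.IsHomogeneous n → a ∈ Ideal.span (Set.range q))
    (hfd : ∀ C n, FiniteDimensional K (grd (M C) n)) :
    ∃ n0, ∀ n ≥ n0, ∑ C : Finset ι, (-1 : ℤ) ^ C.card * (Module.finrank K (grd (M C) n) : ℤ) = 0 := by
  set o : ι → ℕ := fun i => (Fintype.equivFin ι i).1
  have ho : Function.Injective o := fun i j h => (Fintype.equivFin ι).injective (Fin.ext h)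
  obtain ⟨n0, hn0⟩ := cube_exact M hgr q hq hN ho
  refine ⟨n0, fun n hn => ?_⟩
  have hex := hn0 n hn
  let p : ℕ → Finset ι → Submodule K (Deriv K ℓ) := fun b C =>
    if C.card % 2 = b then grd (M C) n else ⊥
  have hpos : ∀ b C, C.card % 2 = b → p b C = grd (M C) n := fun b C h => if_pos h
  have hneg : ∀ b C, ¬ C.card % 2 = b → p b C = ⊥ := fun b C h => if_neg h
  clear_value p
  have hp : ∀ b C, FiniteDimensional K (p b C) := by
    intro b C
    by_cases h : C.card % 2 = b
    · rw [hpos b C h]; exact hfd C n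
    · rw [hneg b C h]; infer_instance
  let dK : (Finset ι → Deriv K ℓ) →ₗ[K] (Finset ι → Deriv K ℓ) :=
    (cd (R := MvPolynomial (Fin ℓ) K) o).restrictScalars K
  have hdK : ∀ ω, dK ω = cd (R := MvPolynomial (Fin ℓ) K) o ω := fun _ => rfl
  have key : ∀ b b', b + b' = 1 → LinearMap.ker dK ⊓ Submodule.pi Set.univ (p b) =
      (Submodule.pi Set.univ (p b')).map dK := by
    intro b b' hbb
    ext ω
    constructor
    · rintro ⟨h1, h2⟩
      have h2' : ∀ C, ω C ∈ p b C := fun C => h2 C (Set.mem_univ C)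
      obtain ⟨η, hη, hdη⟩ := hex ω (fun C => by
        by_cases h : C.card % 2 = b
        · rw [← hpos b C h]; exact h2' C
        · have := h2' C
          rw [hneg b C h, Submodule.mem_bot] at this
          rw [this]; exact Submodule.zero_mem _) h1
      refine ⟨fun C => if C.card % 2 = b' then η C else 0, fun C _ => ?_, ?_⟩
      · show (if C.card % 2 = b' then η C else 0) ∈ p b' C
        by_cases h : C.card % 2 = b'
        · rw [if_pos h, hpos b' C h]; exact hη C
        · rw [if_neg h]; exact Submodule.zero_mem _
      · funext C
        rw [hdK, cd_apply]
        by_cases h : C.card % 2 = b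
        · rw [← hdη, cd_apply]
          refine Finset.sum_congr rfl fun i hi => ?_
          have := Finset.card_erase_add_one hi
          rw [if_pos (by omega)]
        · have h3 := h2' C
          rw [hneg b C h, Submodule.mem_bot] at h3
          rw [h3]
          refine Finset.sum_eq_zero fun i hi => ?_
          have := Finset.card_erase_add_one hi
          rw [if_neg (by omega), smul_zero]
    · rintro ⟨η, hη, rfl⟩
      have hη' : ∀ C, η C ∈ p b' C := fun C => hη C (Set.mem_univ C)
      refine ⟨?_, fun C _ => ?_⟩
      · exact LinearMap.mem_ker.2 (cd_cd (R := MvPolynomial (Fin ℓ) K) ho η)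
      · show cd (R := MvPolynomial (Fin ℓ) K) o η C ∈ p b C
        refine cd_mem (p b C).toAddSubgroup fun i hi => ?_
        have hc := Finset.card_erase_add_one hi
        have h3 := hη' (C.erase i)
        by_cases h : C.card % 2 = b
        · rw [hpos _ _ (by omega)] at h3
          rw [hpos _ _ h]
          exact ⟨hmono C i hi h3.1, h3.2⟩
        · rw [hneg _ _ (by omega), Submodule.mem_bot] at h3
          rw [h3]; exact Submodule.zero_mem _
  have f0 := finrank_pi_sub (p 0)
  have f1 := finrank_pi_sub (p 1)
  have := f0.1
  have := f1.1
  have h := exact_finrank dK _ _ (key 0 1 rfl) (key 1 0 rfl)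
  rw [f0.2, f1.2] at h
  have h' : ∑ C, (Module.finrank K (p 0 C) : ℤ) - ∑ C, (Module.finrank K (p 1 C) : ℤ) = 0 := by
    rw [sub_eq_zero]; exact_mod_cast h
  rw [← h', ← Finset.sum_sub_distrib]
  refine Finset.sum_congr rfl fun C _ => ?_
  rcases Nat.mod_two_eq_zero_or_one C.card with hc | hc
  · rw [hpos 0 C hc, hneg 1 C (by omega), (Nat.even_iff.2 hc).neg_one_pow]; simp
  · rw [hpos 1 C hc, hneg 0 C (by omega), (Nat.odd_iff.2 hc).neg_one_pow]; simp
end CubeE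


/-- chosen exponents -/
def ex (B : Finset (Submodule K (Fin ℓ → K))) : Fin ℓ → ℕ :=
  if h : IsFree B then h.choose else 0

theorem ex_spec {B : Finset (Submodule K (Fin ℓ → K))} (h : IsFree B) : IsFreeExp B (ex B) := by
  unfold ex; rw [dif_pos h]; exact h.choose_spec

/-- `g · D(B)` -/
def gD (g : MvPolynomial (Fin ℓ) K) (B : Finset (Submodule K (Fin ℓ → K))) :
    Submodule (MvPolynomial (Fin ℓ) K) (Deriv K ℓ) :=
  (DM B).map (LinearMap.lsmul (MvPolynomial (Fin ℓ) K) (Deriv K ℓ) g)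

theorem mem_gD {g : MvPolynomial (Fin ℓ) K} {B : Finset (Submodule K (Fin ℓ → K))} {θ : Deriv K ℓ} :
    θ ∈ gD g B ↔ ∃ η ∈ DM B, g • η = θ := Iff.rfl

theorem gD_finrank {g : MvPolynomial (Fin ℓ) K} {d : ℕ} (hg : g.IsHomogeneous d) (hg0 : g ≠ 0)
    {B : Finset (Submodule K (Fin ℓ → K))} (hB : IsFree B) (n : ℕ) :
    FiniteDimensional K (grd (gD g B) n) ∧ (Module.finrank K (grd (gD g B) n) : ℤ) =
      PowerSeries.coeff n (((PowerSeries.X : PowerSeries ℤ) ^ d *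
        ∑ i, (PowerSeries.X : PowerSeries ℤ) ^ ex B i) * (PowerSeries.mk 1 : PowerSeries ℤ) ^ ℓ) := by
  obtain ⟨θ, hom, gen, ind⟩ := ex_spec hB
  have := grd_finrank (gD g B) (θ := fun i => g • θ i) (e := fun i => d + ex B i)
    (fun i k => hg.mul (hom i k)) (fun i => mem_gD.2 ⟨θ i, gen.1 i, rfl⟩) (by
      rintro _ ⟨η, hη, rfl⟩
      obtain ⟨c, rfl⟩ := gen.2 η hη
      refine ⟨c, ?_⟩
      show g • ∑ i, c i • θ i = _
      rw [Finset.smul_sum]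
      exact Finset.sum_congr rfl fun i _ => smul_comm _ _ _) (by
      intro c hc i
      refine ind c ?_ i
      have h2 : g • ∑ i, c i • θ i = 0 := by
        rw [← hc, Finset.smul_sum]
        exact Finset.sum_congr rfl fun i _ => smul_comm _ _ _
      exact (smul_eq_zero.1 h2).resolve_left hg0) n
  rw [Finset.mul_sum]
  simpa only [pow_add] using this

theorem gD_dComp {g : MvPolynomial (Fin ℓ) K} {d : ℕ} (hg : g.IsHomogeneous d) 
    {B : Finset (Submodule K (Fin ℓ → K))} (n : ℕ) {θ : Deriv K ℓ} (h : θ ∈ gD g B) :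
    dComp n θ ∈ gD g B := by
  obtain ⟨η, hη, rfl⟩ := h
  show dComp n (g • η) ∈ _
  rw [dComp_smul_left hg]
  split_ifs
  · exact ⟨_, dComp_mem _ hη, rfl⟩
  · exact Submodule.zero_mem _

theorem vanish_ps {A : Finset (Submodule K (Fin ℓ → K))} (hA : IsArrangement A) (hf : IsFree A)
    {ι : Type} [Fintype ι] (X0 : Submodule K (Fin ℓ → K)) (Y : ι → Submodule K (Fin ℓ → K))
    (γ : ι → MvPolynomial (Fin ℓ) K) (g : ι → ℕ) (hγ : ∀ i, (γ i).IsHomogeneous (g i))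
    (hγ0 : ∀ i, γ i ≠ 0)
    (hP : ∀ P : Ideal (MvPolynomial (Fin ℓ) K), P.IsPrime →
      (∀ i, γ i * QQ (A.filter fun L => ¬ Y i ≤ L) ∈ P) → ∀ k, (X k : MvPolynomial (Fin ℓ) K) ∈ P) :
    ∃ n0, ∀ n ≥ n0, PowerSeries.coeff n ((∑ C : Finset ι, (-1 : PowerSeries ℤ) ^ C.card *
      ((PowerSeries.X : PowerSeries ℤ) ^ (∑ i ∈ Cᶜ, g i) *
        ∑ j, (PowerSeries.X : PowerSeries ℤ) ^ ex (localize A (X0 ⊔ C.sup Y)) j)) *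
          (PowerSeries.mk 1 : PowerSeries ℤ) ^ ℓ) = 0 := by
  set q : ι → MvPolynomial (Fin ℓ) K := fun i => γ i * QQ (A.filter fun L => ¬ Y i ≤ L) with hq
  set M : Finset ι → Submodule (MvPolynomial (Fin ℓ) K) (Deriv K ℓ) := fun C =>
    gD (∏ i ∈ Cᶜ, γ i) (localize A (X0 ⊔ C.sup Y)) with hM
  have hgh : ∀ C : Finset ι, (∏ i ∈ Cᶜ, γ i).IsHomogeneous (∑ i ∈ Cᶜ, g i) := fun C =>
    IsHomogeneous.prod _ _ _ fun i _ => hγ i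
  have hg0 : ∀ C : Finset ι, (∏ i ∈ Cᶜ, γ i) ≠ 0 := fun C => Finset.prod_ne_zero_iff.2 fun i _ => hγ0 i
  have hfl : ∀ C : Finset ι, IsFree (localize A (X0 ⊔ C.sup Y)) := fun C => free_localize hA hf _
  have hc1 : ∀ (C : Finset ι) i, i ∉ C → ∏ j ∈ Cᶜ, γ j = (∏ j ∈ (insert i C)ᶜ, γ j) * γ i := by
    intro C i hi
    have : Cᶜ = insert i (insert i C)ᶜ := by
      ext j; simp only [Finset.mem_compl, Finset.mem_insert]
      by_cases h : j = i
      · subst h; simp [hi]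
      · simp [h]
    rw [this, Finset.prod_insert (by simp), mul_comm]
  have hmono : ∀ C, ∀ i ∈ C, M (C.erase i) ≤ M C := by
    rintro C i hi _ ⟨η, hη, rfl⟩
    refine ⟨γ i • η, Submodule.smul_mem _ _ (DM_anti ?_ hη), ?_⟩
    · intro L hL
      simp only [localize, Finset.mem_filter] at hL ⊢
      refine ⟨hL.1, le_trans (sup_le_sup_left (Finset.sup_mono (Finset.erase_subset _ _)) _) hL.2⟩
    · show (∏ j ∈ Cᶜ, γ j) • γ i • η = (∏ j ∈ (C.erase i)ᶜ, γ j) • η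
      rw [hc1 (C.erase i) i (by simp), Finset.insert_erase hi, mul_smul]
  have hqM : ∀ C i, i ∉ C → ∀ θ ∈ M (insert i C), q i • θ ∈ M C := by
    rintro C i hi _ ⟨η, hη, rfl⟩
    refine ⟨QQ (A.filter fun L => ¬ Y i ≤ L) • η, ?_, ?_⟩
    · refine (mem_DM).2 ((inD_iff (loc_arr hA _) _).2 fun L hL => ?_)
      rw [applyLin_smul]
      by_cases h : Y i ≤ L
      · refine ((inD_iff (loc_arr hA _) _).1 (mem_DM.1 hη) L ?_).mul_left _
        simp only [localize, Finset.mem_filter, Finset.sup_insert] at hL ⊢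
        exact ⟨hL.1, sup_le (le_sup_left.trans hL.2) (sup_le h (le_sup_right.trans hL.2))⟩
      · exact (Finset.dvd_prod_of_mem lf (Finset.mem_filter.2 ⟨loc_sub _ _ hL, h⟩)).mul_right _
    · show (∏ j ∈ Cᶜ, γ j) • QQ _ • η = q i • (∏ j ∈ (insert i C)ᶜ, γ j) • η
      rw [hc1 C i hi, hq, smul_smul, smul_smul]; congr 1; ring
  have hN : ∃ N, ∀ n ≥ N, ∀ a : MvPolynomial (Fin ℓ) K, a.IsHomogeneous n → a ∈ Ideal.span (Set.range q) := by
    have h1 : idealOfVars (Fin ℓ) K ≤ (Ideal.span (Set.range q)).radical := by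
      rw [Ideal.radical_eq_sInf]
      refine le_sInf ?_
      rintro P ⟨hle, hpr⟩
      unfold idealOfVars
      rw [Ideal.span_le]
      rintro _ ⟨k, rfl⟩
      exact hP P hpr (fun i => hle (Ideal.subset_span ⟨i, rfl⟩)) k
    obtain ⟨N, hN⟩ := Ideal.exists_pow_le_of_le_radical_of_fg h1 (IsNoetherian.noetherian _)
    refine ⟨N, fun n hn a ha => hN ((mem_pow_idealOfVars_iff' _ _).2 fun x hx => ?_)⟩
    exact ha.coeff_eq_zero (by omega)
  obtain ⟨n0, h0⟩ := cube_euler M (fun C n θ h => gD_dComp (hgh C) n h) hmono q hqM hN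
    (fun C n => (gD_finrank (hgh C) (hg0 C) (hfl C) n).1)
  refine ⟨n0, fun n hn => ?_⟩
  rw [← h0 n hn, Finset.sum_mul, map_sum]
  refine Finset.sum_congr rfl fun C _ => ?_
  rw [(gD_finrank (hgh C) (hg0 C) (hfl C) n).2]
  rcases Nat.even_or_odd C.card with h | h <;> simp [h.neg_one_pow]


/-- Euler operator on univariate polynomials -/
def eop : Polynomial ℤ →ₗ[ℤ] Polynomial ℤ :=
  (LinearMap.mulLeft ℤ (Polynomial.X : Polynomial ℤ)).comp Polynomial.derivative

theorem eop_apply (p : Polynomial ℤ) : eop p = Polynomial.X * Polynomial.derivative p := rfl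

theorem eop_pow (n k : ℕ) : (eop ^ k) (Polynomial.X ^ n) = Polynomial.C ((n : ℤ) ^ k) * Polynomial.X ^ n := by
  induction k with
  | zero => simp
  | succ k ih =>
    rw [pow_succ', Module.End.mul_apply, ih, eop_apply, Polynomial.derivative_C_mul_X_pow]
    rcases n with _ | n
    · simp
    · simp only [Nat.add_sub_cancel, pow_succ, map_mul]; ring

theorem eop_dvd (k : ℕ) : ∀ (r : ℕ) (p : Polynomial ℤ), (Polynomial.X - 1) ^ (r + k) ∣ p →
    (Polynomial.X - 1) ^ r ∣ (eop ^ k) p := by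
  induction k with
  | zero => intro r p h; simpa using h
  | succ k ih =>
    intro r p h
    rw [pow_succ, Module.End.mul_apply]
    refine ih r _ ?_
    obtain ⟨c, rfl⟩ := h
    rw [eop_apply, Polynomial.derivative_mul, ← add_assoc, Polynomial.derivative_pow]
    rw [pow_succ]
    simp only [Nat.add_sub_cancel]
    refine Dvd.dvd.mul_left (dvd_add ?_ ?_) _
    · exact Dvd.dvd.mul_right (Dvd.dvd.mul_right (Dvd.dvd.mul_left dvd_rfl _) _) _
    · exact Dvd.dvd.mul_right (Dvd.intro _ rfl) _

theorem moment {p : Polynomial ℤ} {r k : ℕ} (h : (Polynomial.X - 1) ^ r ∣ p) (hk : k < r) :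
    ((eop ^ k) p).eval 1 = 0 := by
  have h1 : (Polynomial.X - 1) ^ 1 ∣ (eop ^ k) p :=
    eop_dvd k 1 p (dvd_trans (pow_dvd_pow _ (by omega)) h)
  obtain ⟨c, hc⟩ := h1
  rw [hc]; simp

theorem ps_dvd {G : Polynomial ℤ} {m r ℓ' : ℕ} (hm : m + r = ℓ')
    (h : ∃ n0, ∀ n ≥ n0, PowerSeries.coeff n (((((Polynomial.X - 1) ^ m * G : Polynomial ℤ)) : PowerSeries ℤ) *
      (PowerSeries.mk 1 : PowerSeries ℤ) ^ ℓ') = 0) : (Polynomial.X - 1) ^ r ∣ G := by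
  obtain ⟨n0, h0⟩ := h
  set F := ((((Polynomial.X - 1) ^ m * G : Polynomial ℤ)) : PowerSeries ℤ) *
      (PowerSeries.mk 1 : PowerSeries ℤ) ^ ℓ' with hF
  have h1 : F = ((F.trunc n0 : Polynomial ℤ) : PowerSeries ℤ) := by
    ext n
    rw [Polynomial.coeff_coe, PowerSeries.coeff_trunc]
    split_ifs with h
    · rfl
    · exact h0 n (by omega)
  set p := F.trunc n0
  have h2 : (((Polynomial.X - 1) ^ m * G : Polynomial ℤ) : PowerSeries ℤ) =
      ((p * (1 - Polynomial.X) ^ ℓ' : Polynomial ℤ) : PowerSeries ℤ) := by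
    rw [Polynomial.coe_mul p, ← h1, hF, mul_assoc]
    have : (((1 - Polynomial.X) ^ ℓ' : Polynomial ℤ) : PowerSeries ℤ) = (1 - PowerSeries.X) ^ ℓ' := by
      simp
    rw [this, ← mul_pow, PowerSeries.mk_one_mul_one_sub_eq_one, one_pow, mul_one]
  have h3 := Polynomial.coe_injective ℤ h2
  have hne : (Polynomial.X - 1 : Polynomial ℤ) ^ m ≠ 0 := pow_ne_zero _ (Polynomial.X_sub_C_ne_zero 1)
  refine ⟨p * (-1) ^ ℓ', mul_left_cancel₀ hne ?_⟩
  rw [h3, ← hm, ← neg_sub, neg_pow, pow_add (Polynomial.X - 1 : Polynomial ℤ)]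
  ring

theorem sum_compl_pow {J : Type} [Fintype J] :
    ∑ D : Finset J, (-1 : Polynomial ℤ) ^ D.card * Polynomial.X ^ (Dᶜ).card =
      (Polynomial.X - 1) ^ Fintype.card J := by
  have := Fintype.sum_pow_mul_eq_add_pow J (-1 : Polynomial ℤ) Polynomial.X
  rw [show (Polynomial.X - 1 : Polynomial ℤ) = -1 + Polynomial.X by ring, ← this]
  refine Finset.sum_congr rfl fun D _ => ?_
  rw [Finset.card_compl]

/-- coordinates on a subspace -/
theorem exists_coords (X0 : Submodule K (Fin ℓ → K)) :
    ∃ φ : Fin (Module.finrank K X0) → Module.Dual K (Fin ℓ → K), (∀ j, φ j ≠ 0) ∧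
      ∀ v ∈ X0, (∀ j, φ j v = 0) → v = 0 := by
  let b := Module.finBasis K X0
  have key : ∀ j (v : X0), ((b.coord j).comp (LinearMap.codRestrict X0 (pj X0) (pj_mem X0))) v.1 = b.coord j v := by
    intro j v
    show b.coord j _ = _
    congr 1
    exact Subtype.ext (pj_self X0 v.2)
  refine ⟨fun j => (b.coord j).comp (LinearMap.codRestrict X0 (pj X0) (pj_mem X0)), fun j h => ?_, ?_⟩
  · have h1 := key j (b j)
    have h2 := LinearMap.congr_fun h (b j).1
    rw [h1] at h2
    simp at h2
  · intro v hv h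
    have : (⟨v, hv⟩ : X0) = 0 := by
      apply (b.ext_elem)
      intro j
      have := h j
      rw [key j ⟨v, hv⟩] at this
      simpa using this
    exact congrArg Subtype.val this

theorem mem_lat {A : Finset (Submodule K (Fin ℓ → K))} {Z : Submodule K (Fin ℓ → K)} :
    Z ∈ latticeOf ⊤ A ↔ ∃ B ⊆ A, B.inf id = Z := by
  simp [latticeOf]

theorem vanish_poly {A : Finset (Submodule K (Fin ℓ → K))} (hA : IsArrangement A) (hf : IsFree A)
    {r : ℕ} (hr : Module.finrank K (A.inf id : Submodule K (Fin ℓ → K)) + r = ℓ) :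
    (Polynomial.X - 1) ^ r ∣ ∑ C : Finset ((latticeOf ⊤ A).erase (A.inf id) : Finset (Submodule K (Fin ℓ → K))),
      (-1 : Polynomial ℤ) ^ C.card *
        ∑ j, (Polynomial.X : Polynomial ℤ) ^ ex (localize A (A.inf id ⊔ C.sup Subtype.val)) j := by
  have hc0 : ∃ m, m = Module.finrank K (A.inf id : Submodule K (Fin ℓ → K)) ∧
      ∃ φ : Fin m → Module.Dual K (Fin ℓ → K), (∀ j, φ j ≠ 0) ∧
      ∀ v ∈ (A.inf id : Submodule K (Fin ℓ → K)), (∀ j, φ j v = 0) → v = 0 := ⟨_, rfl, exists_coords _⟩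
  obtain ⟨m, hm, φ, hφ0, hφ⟩ := hc0
  rw [← hm] at hr
  set X0 := (A.inf id : Submodule K (Fin ℓ → K)) with hX0
  set I := (latticeOf ⊤ A).erase X0 with hI
  let J := Fin m
  let Y : I ⊕ J → Submodule K (Fin ℓ → K) := Sum.elim Subtype.val (fun _ => X0)
  let γ : I ⊕ J → MvPolynomial (Fin ℓ) K := Sum.elim (fun _ => 1) (fun j => linPoly (φ j))
  let g : I ⊕ J → ℕ := Sum.elim (fun _ => 0) (fun _ => 1)
  refine ps_dvd hr ?_
  have main := vanish_ps hA hf X0 Y γ g (by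
      rintro (i | j)
      · exact isHomogeneous_one _ _
      · exact linPoly_homog _) (by
      rintro (i | j)
      · exact one_ne_zero
      · exact linPoly_ne_zero (hφ0 j)) (by
      intro P hPr hq k
      set B := A.filter fun L => lf L ∈ P with hB
      by_cases hY : B.inf id = X0
      · rw [← linPoly_proj]
        refine linPoly_mem_of_family (ι := B ⊕ J) (Sum.elim (fun L => frm L.1) φ) ?_ ?_
        · rintro (L | j)
          · exact (Finset.mem_filter.1 L.2).2
          · have h1 := hq (Sum.inr j)
            have h2 : (A.filter fun L => ¬ X0 ≤ L) = ∅ := by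
              refine Finset.filter_eq_empty_iff.2 fun L hL => ?_
              rw [not_not]; exact Finset.inf_le (f := id) hL
            change linPoly (φ j) * QQ (A.filter fun L => ¬ X0 ≤ L) ∈ P at h1
            rw [h2] at h1
            simpa [QQ] using h1
        · intro v hv
          rw [Submodule.mem_iInf] at hv
          have h0 : v = 0 := by
            refine hφ v ?_ fun j => hv (Sum.inr j)
            rw [← hY, Submodule.mem_finsetInf]
            intro L hL
            have := hv (Sum.inl ⟨L, hL⟩)
            change v ∈ LinearMap.ker (frm L) at this
            rwa [frm_ker hA (Finset.mem_filter.1 hL).1] at this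
          rw [h0]; exact Submodule.zero_mem _
      · exfalso
        have hmem : B.inf id ∈ I := Finset.mem_erase.2 ⟨hY, mem_lat.2 ⟨B, Finset.filter_subset _ _, rfl⟩⟩
        have h1 := hq (Sum.inl ⟨_, hmem⟩)
        change 1 * QQ (A.filter fun L => ¬ B.inf id ≤ L) ∈ P at h1
        rw [one_mul] at h1
        obtain ⟨L, hL, hLP⟩ := (hPr.prod_mem_iff).1 h1
        rw [Finset.mem_filter] at hL
        exact hL.2 (Finset.inf_le (f := id) (Finset.mem_filter.2 ⟨hL.1, hLP⟩)))
  convert main using 5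
  have hX1 : (Polynomial.X - 1 : Polynomial ℤ) ^ m = ∑ D : Finset J, (-1 : Polynomial ℤ) ^ D.card * Polynomial.X ^ (Dᶜ).card := by
    have := (sum_compl_pow (J := Fin m)).symm
    rw [Fintype.card_fin] at this
    convert this
  refine congrArg (fun F : PowerSeries ℤ => PowerSeries.coeff _ (F * (PowerSeries.mk 1 : PowerSeries ℤ) ^ ℓ)) ?_
  rw [hX1, Finset.sum_mul_sum]
  rw [← (Finset.sumEquiv (α := I) (β := J)).symm.toEquiv.sum_comp, Fintype.sum_prod_type, Finset.sum_comm]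
  rw [← Polynomial.coeToPowerSeries.ringHom_apply]
  simp only [map_sum, map_mul, map_pow, map_neg, map_one, Polynomial.coeToPowerSeries.ringHom_apply, Polynomial.coe_X]
  refine Finset.sum_congr rfl fun C _ => Finset.sum_congr rfl fun D _ => ?_
  have e1 : (Finset.disjSum C D).card = C.card + D.card := Finset.card_disjSum _ _
  have e2 : ∑ i ∈ (Finset.disjSum C D)ᶜ, g i = (Dᶜ).card := by
    have : (Finset.disjSum C D)ᶜ = Finset.disjSum Cᶜ Dᶜ := by
      ext (x | x) <;> simp
    rw [this, Finset.sum_disjSum]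
    simp [g]
  have e3 : X0 ⊔ (Finset.disjSum C D).sup Y = X0 ⊔ C.sup Subtype.val := by
    apply le_antisymm
    · refine sup_le le_sup_left (Finset.sup_le ?_)
      rintro (x | x) hx
      · exact le_sup_of_le_right (Finset.le_sup (f := Subtype.val) (Finset.inl_mem_disjSum.1 hx))
      · exact le_sup_left
    · refine sup_le le_sup_left (Finset.sup_le fun x hx => ?_)
      exact le_sup_of_le_right (Finset.le_sup (f := Y) (Finset.inl_mem_disjSum.2 hx))
  have e0 : (Finset.sumEquiv (α := I) (β := J)).symm.toEquiv (C, D) = Finset.disjSum C D := rfl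
  rw [e0, e1, e3]
  have e4 : ∀ T : Finset (I ⊕ J), T = (Finset.disjSum C D)ᶜ → ∑ i ∈ T, g i = (Dᶜ).card := fun T hT => by
    rw [hT, e2]
  rw [e4 _ (by ext x; simp only [Finset.mem_compl]), pow_add]
  ring

theorem vanish_sum {A : Finset (Submodule K (Fin ℓ → K))} (hA : IsArrangement A) (hf : IsFree A)
    {k : ℕ} (hk : Module.finrank K (A.inf id : Submodule K (Fin ℓ → K)) + k < ℓ) :
    ∑ C ∈ ((latticeOf ⊤ A).erase (A.inf id)).powerset,
      (-1 : ℤ) ^ C.card * ∑ j, (ex (localize A (A.inf id ⊔ C.sup id)) j : ℤ) ^ k = 0 := by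
  have h1 := vanish_poly hA hf (r := ℓ - Module.finrank K (A.inf id : Submodule K (Fin ℓ → K))) (by omega)
  have h2 := moment h1 (k := k) (by omega)
  rw [map_sum, Polynomial.eval_finsetSum] at h2
  rw [← h2]
  refine Finset.sum_nbij' (fun D => D.subtype (· ∈ (latticeOf ⊤ A).erase (A.inf id)))
    (fun C => C.map (Function.Embedding.subtype _)) ?_ ?_ ?_ ?_ ?_
  · intros; exact Finset.mem_univ _
  · intro C _
    rw [Finset.mem_powerset]
    intro x hx
    obtain ⟨y, -, rfl⟩ := Finset.mem_map.1 hx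
    exact y.2
  · intro D hD
    exact Finset.subtype_map_of_mem fun x hx => Finset.mem_powerset.1 hD hx
  · intro C _
    ext x; simp
  · intro D hD
    have hD' := Finset.subtype_map_of_mem (p := (· ∈ (latticeOf ⊤ A).erase (A.inf id))) (s := D) fun x hx => Finset.mem_powerset.1 hD hx
    set C := D.subtype (· ∈ (latticeOf ⊤ A).erase (A.inf id))
    rw [← hD', Finset.card_map, Finset.sup_map]
    have e1 : (-1 : Polynomial ℤ) ^ C.card = Polynomial.C ((-1) ^ C.card) := by simp
    rw [e1, ← Polynomial.smul_eq_C_mul, map_smul, map_sum, Polynomial.eval_smul, Polynomial.eval_finsetSum, smul_eq_mul]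
    congr 1
    refine Finset.sum_congr rfl fun j _ => ?_
    rw [eop_pow]
    simp


/-- codimension -/
def cdm (Z : Submodule K (Fin ℓ → K)) : ℕ := ℓ - Module.finrank K Z

theorem fr_le (Z : Submodule K (Fin ℓ → K)) : Module.finrank K Z ≤ ℓ := by
  have := Submodule.finrank_le Z; rwa [Module.finrank_fin_fun] at this

theorem cdm_top : cdm (⊤ : Submodule K (Fin ℓ → K)) = 0 := by
  rw [cdm, finrank_top, Module.finrank_fin_fun]; omega

theorem cdm_anti {Y Z : Submodule K (Fin ℓ → K)} (h : Y ≤ Z) : cdm Z ≤ cdm Y := by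
  have := Submodule.finrank_mono h; unfold cdm; omega

theorem cdm_inf (Y Z : Submodule K (Fin ℓ → K)) : cdm (Y ⊓ Z) ≤ cdm Y + cdm Z := by
  have h1 := Submodule.finrank_sup_add_finrank_inf_eq Y Z
  have h2 := fr_le (Y ⊔ Z)
  have h3 := fr_le Y
  have h4 := fr_le Z
  unfold cdm; omega

theorem eq_top_of_cdm {Z : Submodule K (Fin ℓ → K)} (h : cdm Z = 0) : Z = ⊤ := by
  apply Submodule.eq_top_of_finrank_eq
  have := fr_le Z
  rw [Module.finrank_fin_fun]; unfold cdm at h; omega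

theorem top_mem_lat (A : Finset (Submodule K (Fin ℓ → K))) : (⊤ : Submodule K (Fin ℓ → K)) ∈ latticeOf ⊤ A :=
  mem_lat.2 ⟨∅, by simp, by simp⟩

theorem inf_mem_lat {A : Finset (Submodule K (Fin ℓ → K))} {Y Z : Submodule K (Fin ℓ → K)}
    (hY : Y ∈ latticeOf ⊤ A) (hZ : Z ∈ latticeOf ⊤ A) : Y ⊓ Z ∈ latticeOf ⊤ A := by
  obtain ⟨B, hB, rfl⟩ := mem_lat.1 hY
  obtain ⟨C, hC, rfl⟩ := mem_lat.1 hZ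
  exact mem_lat.2 ⟨B ∪ C, Finset.union_subset hB hC, Finset.inf_union⟩

theorem loc_inf {A : Finset (Submodule K (Fin ℓ → K))} {X : Submodule K (Fin ℓ → K)}
    (hX : X ∈ latticeOf ⊤ A) : (localize A X).inf id = X := by
  obtain ⟨B, hB, rfl⟩ := mem_lat.1 hX
  apply le_antisymm
  · refine Finset.le_inf fun L hL => Finset.inf_le (f := id) ?_
    exact Finset.mem_filter.2 ⟨hB hL, Finset.inf_le (f := id) hL⟩
  · exact Finset.le_inf fun L hL => (Finset.mem_filter.1 hL).2

theorem loc_loc {A : Finset (Submodule K (Fin ℓ → K))} {X W : Submodule K (Fin ℓ → K)} (h : X ≤ W) :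
    localize (localize A X) W = localize A W := by
  ext L
  simp only [localize, Finset.mem_filter]
  exact ⟨fun h => ⟨h.1.1, h.2⟩, fun h2 => ⟨⟨h2.1, h.trans h2.2⟩, h2.2⟩⟩

theorem lat_loc {A : Finset (Submodule K (Fin ℓ → K))} {X : Submodule K (Fin ℓ → K)} :
    latticeOf ⊤ (localize A X) = (latticeOf ⊤ A).filter fun Z => X ≤ Z := by
  ext Z
  rw [Finset.mem_filter, mem_lat, mem_lat]
  constructor
  · rintro ⟨B, hB, rfl⟩
    exact ⟨⟨B, hB.trans (loc_sub _ _), rfl⟩, Finset.le_inf fun L hL => (Finset.mem_filter.1 (hB hL)).2⟩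
  · rintro ⟨⟨B, hB, rfl⟩, h⟩
    exact ⟨B, fun L hL => Finset.mem_filter.2 ⟨hB hL, h.trans (Finset.inf_le (f := id) hL)⟩, rfl⟩

/-- sum over flats above `W` -/
def ups (A : Finset (Submodule K (Fin ℓ → K))) (f : Submodule K (Fin ℓ → K) → ℚ)
    (W : Submodule K (Fin ℓ → K)) : ℚ := ∑ Z ∈ (latticeOf ⊤ A).filter (fun Z => W ≤ Z), f Z

/-- locality -/
def Lcl (A : Finset (Submodule K (Fin ℓ → K))) (k : ℕ) (h : Submodule K (Fin ℓ → K) → ℚ) : Prop :=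
  ∃ f, (∀ Z ∈ latticeOf ⊤ A, k < cdm Z → f Z = 0) ∧ ∀ W ∈ latticeOf ⊤ A, h W = ups A f W

theorem ups_eq {A : Finset (Submodule K (Fin ℓ → K))} (f : Submodule K (Fin ℓ → K) → ℚ)
    {W : Submodule K (Fin ℓ → K)} (hW : W ∈ latticeOf ⊤ A) :
    ups A f W = f W + ∑ Z ∈ (latticeOf ⊤ A).filter (fun Z => W < Z), f Z := by
  have : (latticeOf ⊤ A).filter (fun Z => W ≤ Z) = insert W ((latticeOf ⊤ A).filter (fun Z => W < Z)) := by
    ext Z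
    simp only [Finset.mem_filter, Finset.mem_insert]
    constructor
    · rintro ⟨h1, h2⟩
      rcases h2.eq_or_lt with h | h
      · exact Or.inl h.symm
      · exact Or.inr ⟨h1, h⟩
    · rintro (rfl | ⟨h1, h2⟩)
      · exact ⟨hW, le_rfl⟩
      · exact ⟨h1, h2.le⟩
  rw [ups, this, Finset.sum_insert (by simp)]

theorem ups_exists (A : Finset (Submodule K (Fin ℓ → K))) (h : Submodule K (Fin ℓ → K) → ℚ) :
    ∃ f, ∀ W ∈ latticeOf ⊤ A, h W = ups A f W := by
  let F : (X : Submodule K (Fin ℓ → K)) → ((Y : Submodule K (Fin ℓ → K)) → Y > X → ℚ) → ℚ :=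
    fun X rec => h X - ∑ Z ∈ ((latticeOf ⊤ A).filter (fun Z => X < Z)).attach, rec Z.1 (Finset.mem_filter.1 Z.2).2
  have wf : WellFounded ((· > ·) : Submodule K (Fin ℓ → K) → Submodule K (Fin ℓ → K) → Prop) := wellFounded_gt
  refine ⟨wf.fix F, fun W hW => ?_⟩
  rw [ups_eq _ hW, wf.fix_eq F W]
  show h W = h W - ∑ Z ∈ ((latticeOf ⊤ A).filter (fun Z => W < Z)).attach, wf.fix F Z.1 + _
  rw [Finset.sum_attach _ (fun Z => wf.fix F Z)]
  ring

theorem Lcl.mono {A : Finset (Submodule K (Fin ℓ → K))} {j k : ℕ} {h : Submodule K (Fin ℓ → K) → ℚ}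
    (hh : Lcl A j h) (hjk : j ≤ k) : Lcl A k h := by
  obtain ⟨f, h1, h2⟩ := hh
  exact ⟨f, fun Z hZ hk => h1 Z hZ (by omega), h2⟩

theorem Lcl.congr {A : Finset (Submodule K (Fin ℓ → K))} {k : ℕ} {h h' : Submodule K (Fin ℓ → K) → ℚ}
    (hh : Lcl A k h) (e : ∀ W ∈ latticeOf ⊤ A, h' W = h W) : Lcl A k h' := by
  obtain ⟨f, h1, h2⟩ := hh
  exact ⟨f, h1, fun W hW => (e W hW).trans (h2 W hW)⟩

theorem Lcl.smul {A : Finset (Submodule K (Fin ℓ → K))} {k : ℕ} {h : Submodule K (Fin ℓ → K) → ℚ}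
    (hh : Lcl A k h) (c : ℚ) : Lcl A k (fun W => c * h W) := by
  obtain ⟨f, h1, h2⟩ := hh
  refine ⟨fun Z => c * f Z, fun Z hZ hk => by simp [h1 Z hZ hk], fun W hW => ?_⟩
  show c * h W = _
  rw [h2 W hW, ups, ups, Finset.mul_sum]

theorem Lcl.sum {A : Finset (Submodule K (Fin ℓ → K))} {k : ℕ} {ι : Type*} (s : Finset ι)
    {h : ι → Submodule K (Fin ℓ → K) → ℚ}
    (hh : ∀ i ∈ s, Lcl A k (h i)) : Lcl A k (fun W => ∑ i ∈ s, h i W) := by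
  choose! f h1 h2 using hh
  refine ⟨fun Z => ∑ i ∈ s, f i Z, fun Z hZ hk => Finset.sum_eq_zero fun i hi => h1 i hi Z hZ hk, fun W hW => ?_⟩
  simp only [ups]
  rw [Finset.sum_comm]
  exact Finset.sum_congr rfl fun i hi => h2 i hi W hW

theorem Lcl.const (A : Finset (Submodule K (Fin ℓ → K))) (c : ℚ) : Lcl A 0 (fun _ => c) := by
  refine ⟨fun Z => if Z = ⊤ then c else 0, fun Z hZ hk => ?_, fun W hW => ?_⟩
  · simp only
    rw [if_neg]; rintro rfl; rw [cdm_top] at hk; omega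
  · rw [ups, Finset.sum_ite_eq', if_pos]
    exact Finset.mem_filter.2 ⟨top_mem_lat A, le_top⟩

theorem Lcl.mul {A : Finset (Submodule K (Fin ℓ → K))} {j k : ℕ} {h h' : Submodule K (Fin ℓ → K) → ℚ}
    (hh : Lcl A j h) (hh' : Lcl A k h') : Lcl A (j + k) (fun W => h W * h' W) := by
  obtain ⟨f, h1, h2⟩ := hh
  obtain ⟨f', h1', h2'⟩ := hh'
  refine ⟨fun Z => ∑ p ∈ ((latticeOf ⊤ A) ×ˢ (latticeOf ⊤ A)).filter (fun p => p.1 ⊓ p.2 = Z), f p.1 * f' p.2,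
    fun Z hZ hk => Finset.sum_eq_zero fun p hp => ?_, fun W hW => ?_⟩
  · rw [Finset.mem_filter, Finset.mem_product] at hp
    have := cdm_inf p.1 p.2
    rw [hp.2] at this
    by_cases hj : j < cdm p.1
    · rw [h1 _ hp.1.1 hj, zero_mul]
    · rw [h1' _ hp.1.2 (by omega), mul_zero]
  · show h W * h' W = _
    rw [h2 W hW, h2' W hW]
    simp only [ups]
    rw [Finset.sum_mul_sum, ← Finset.sum_product']
    rw [← Finset.sum_fiberwise_of_maps_to (t := (latticeOf ⊤ A).filter (fun Z => W ≤ Z)) (g := fun p => p.1 ⊓ p.2)]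
    · refine Finset.sum_congr rfl fun Z hZ => ?_
      refine Finset.sum_congr ?_ fun _ _ => rfl
      rw [Finset.mem_filter] at hZ
      ext p
      simp only [Finset.mem_filter, Finset.mem_product]
      constructor
      · rintro ⟨⟨a, b⟩, c⟩; exact ⟨⟨a.1, b.1⟩, c⟩
      · rintro ⟨⟨a, b⟩, c⟩
        have hc : W ≤ p.1 ⊓ p.2 := c ▸ hZ.2
        exact ⟨⟨⟨a, hc.trans inf_le_left⟩, ⟨b, hc.trans inf_le_right⟩⟩, c⟩
    · intro p hp
      simp only [Finset.mem_filter, Finset.mem_product] at hp ⊢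
      exact ⟨inf_mem_lat hp.1.1 hp.2.1, le_inf hp.1.2 hp.2.2⟩

theorem Lcl.zero {A : Finset (Submodule K (Fin ℓ → K))} {k : ℕ} {h : Submodule K (Fin ℓ → K) → ℚ}
    (hh : Lcl A k h) {X : Submodule K (Fin ℓ → K)} (hX : X ∈ latticeOf ⊤ A) (hk : k < cdm X)
    (h0 : ∀ Z ∈ latticeOf ⊤ A, X < Z → h Z = 0) : h X = 0 := by
  obtain ⟨f, h1, h2⟩ := hh
  have hf : ∀ Z : Submodule K (Fin ℓ → K), Z ∈ latticeOf ⊤ A → X < Z → f Z = 0 := by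
    intro Z
    induction Z using WellFoundedGT.induction with
    | ind Z ih =>
      intro hZ hXZ
      have e := h2 Z hZ
      rw [h0 Z hZ hXZ, ups_eq _ hZ, Finset.sum_eq_zero, add_zero] at e
      · exact e.symm
      · intro Y hY
        rw [Finset.mem_filter] at hY
        exact ih Y hY.2 hY.1 (hXZ.trans hY.2)
  rw [h2 X hX, ups_eq _ hX, h1 X hX hk, zero_add]
  refine Finset.sum_eq_zero fun Y hY => ?_
  rw [Finset.mem_filter] at hY
  exact hf Y hY.1 hY.2


theorem ups_Lambda {A : Finset (Submodule K (Fin ℓ → K))} (f : Submodule K (Fin ℓ → K) → ℚ)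
    {X : Submodule K (Fin ℓ → K)} (hX : X ∈ latticeOf ⊤ A) :
    ∑ C ∈ (((latticeOf ⊤ A).filter fun Z => X ≤ Z).erase X).powerset,
      (-1 : ℚ) ^ C.card * ups A f (X ⊔ C.sup id) = f X := by
  set I := ((latticeOf ⊤ A).filter fun Z => X ≤ Z).erase X with hI
  have h1 : ∀ C ∈ I.powerset, (-1 : ℚ) ^ C.card * ups A f (X ⊔ C.sup id) =
      ∑ Z ∈ (latticeOf ⊤ A).filter fun Z => X ≤ Z,
        if C ⊆ I.filter (fun Y => Y ≤ Z) then (-1 : ℚ) ^ C.card * f Z else 0 := by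
    intro C hC
    rw [Finset.mem_powerset] at hC
    rw [ups, Finset.mul_sum, ← Finset.sum_filter]
    refine Finset.sum_congr ?_ fun _ _ => rfl
    ext Z
    simp only [Finset.mem_filter, sup_le_iff, Finset.sup_le_iff]
    constructor
    · rintro ⟨a, b, c⟩
      exact ⟨⟨a, b⟩, fun Y hY => Finset.mem_filter.2 ⟨hC hY, c Y hY⟩⟩
    · rintro ⟨⟨a, b⟩, c⟩
      exact ⟨a, b, fun Y hY => (Finset.mem_filter.1 (c hY)).2⟩
  rw [Finset.sum_congr rfl h1, Finset.sum_comm]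
  have h2 : ∀ Z ∈ (latticeOf ⊤ A).filter fun Z => X ≤ Z,
      ∑ C ∈ I.powerset, (if C ⊆ I.filter (fun Y => Y ≤ Z) then (-1 : ℚ) ^ C.card * f Z else 0) =
        if Z = X then f Z else 0 := by
    intro Z hZ
    rw [← Finset.sum_filter, ← Finset.sum_mul]
    have e : (I.powerset.filter fun C => C ⊆ I.filter (fun Y => Y ≤ Z)) = (I.filter (fun Y => Y ≤ Z)).powerset := by
      ext C
      simp only [Finset.mem_filter, Finset.mem_powerset]
      exact ⟨fun h => h.2, fun h => ⟨h.trans (Finset.filter_subset _ _), h⟩⟩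
    rw [e]
    by_cases h : Z = X
    · have : I.filter (fun Y => Y ≤ Z) = ∅ := by
        rw [Finset.filter_eq_empty_iff]
        intro Y hY hle
        rw [hI, Finset.mem_erase, Finset.mem_filter] at hY
        exact hY.1 (le_antisymm (h ▸ hle) hY.2.2)
      rw [this, if_pos h]; simp
    · have hne : (I.filter (fun Y => Y ≤ Z)).Nonempty :=
        ⟨Z, Finset.mem_filter.2 ⟨Finset.mem_erase.2 ⟨h, hZ⟩, le_rfl⟩⟩
      have := Finset.sum_powerset_neg_one_pow_card_of_nonempty hne
      have h3 : ∑ C ∈ (I.filter (fun Y => Y ≤ Z)).powerset, (-1 : ℚ) ^ C.card = 0 := by exact_mod_cast this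
      rw [h3, zero_mul, if_neg h]
  rw [Finset.sum_congr rfl h2, Finset.sum_ite_eq', if_pos]
  exact Finset.mem_filter.2 ⟨hX, le_rfl⟩

/-- closure of `W` -/
theorem cl_props (A : Finset (Submodule K (Fin ℓ → K))) (W : Submodule K (Fin ℓ → K)) :
    (localize A W).inf id ∈ latticeOf ⊤ A ∧ localize A ((localize A W).inf id) = localize A W ∧
    ∀ Z ∈ latticeOf ⊤ A, ((localize A W).inf id ≤ Z ↔ W ≤ Z) := by
  have hW : W ≤ (localize A W).inf id := Finset.le_inf fun L hL => (Finset.mem_filter.1 hL).2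
  refine ⟨mem_lat.2 ⟨_, loc_sub _ _, rfl⟩, ?_, ?_⟩
  · ext L
    have e : ∀ Y, L ∈ localize A Y ↔ L ∈ A ∧ Y ≤ L := fun Y => by rw [localize, Finset.mem_filter]
    rw [e, e]
    constructor
    · rintro ⟨a, b⟩; exact ⟨a, hW.trans b⟩
    · rintro ⟨a, b⟩; exact ⟨a, Finset.inf_le (f := id) (Finset.mem_filter.2 ⟨a, b⟩)⟩
  · intro Z hZ
    refine ⟨fun h => hW.trans h, fun h => ?_⟩
    rw [← loc_inf hZ]
    refine Finset.le_inf fun L hL => Finset.inf_le (f := id) ?_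
    rw [localize, Finset.mem_filter] at hL ⊢
    exact ⟨hL.1, h.trans hL.2⟩

/-- power sums of exponents of localizations -/
def pw (A : Finset (Submodule K (Fin ℓ → K))) (k : ℕ) (W : Submodule K (Fin ℓ → K)) : ℚ :=
  ∑ j, (ex (localize A W) j : ℚ) ^ k

theorem pw_Lcl {A : Finset (Submodule K (Fin ℓ → K))} (hA : IsArrangement A) (hf : IsFree A) (k : ℕ) :
    Lcl A k (pw A k) := by
  obtain ⟨f, hfu⟩ := ups_exists A (pw A k)
  refine ⟨f, fun X hX hk => ?_, hfu⟩
  have hext : ∀ W, pw A k W = ups A f W := by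
    intro W
    obtain ⟨h1, h2, h3⟩ := cl_props A W
    have := hfu _ h1
    rw [pw, h2] at this
    rw [pw, this, ups, ups]
    refine Finset.sum_congr ?_ fun _ _ => rfl
    exact Finset.filter_congr fun Z hZ => h3 Z hZ
  rw [← ups_Lambda f hX]
  have hli := loc_inf hX
  have hv := vanish_sum (loc_arr hA X) (free_localize hA hf X) (k := k) (by
    rw [hli]; unfold cdm at hk; omega)
  rw [hli, lat_loc] at hv
  have hv' : ((∑ C ∈ (((latticeOf ⊤ A).filter fun Z => X ≤ Z).erase X).powerset,
      (-1 : ℤ) ^ C.card * ∑ j, (ex (localize (localize A X) (X ⊔ C.sup id)) j : ℤ) ^ k : ℤ) : ℚ) = 0 := by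
    rw [hv]; simp
  rw [← hv']
  push_cast
  refine Finset.sum_congr rfl fun C _ => ?_
  rw [← hext, pw, loc_loc le_sup_left]

/-- elementary symmetric functions of exponents of localizations -/
def es (A : Finset (Submodule K (Fin ℓ → K))) (k : ℕ) (W : Submodule K (Fin ℓ → K)) : ℚ :=
  aeval (fun j => (ex (localize A W) j : ℚ)) (esymm (Fin ℓ) ℚ k)

theorem es_eq (A : Finset (Submodule K (Fin ℓ → K))) (k : ℕ) (W : Submodule K (Fin ℓ → K)) :
    es A k W = ∑ t ∈ Finset.powersetCard k Finset.univ, ∏ i ∈ t, (ex (localize A W) i : ℚ) := by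
  simp [es, esymm]

theorem es_Lcl {A : Finset (Submodule K (Fin ℓ → K))} (hA : IsArrangement A) (hf : IsFree A) (k : ℕ) :
    Lcl A k (es A k) := by
  induction k using Nat.strong_induction_on with
  | _ k ih =>
    rcases Nat.eq_zero_or_pos k with rfl | hk
    · exact (Lcl.const A 1).congr fun W _ => by simp [es]
    · have hN : ∀ W, es A k W = ((-1) ^ (k + 1) * (k : ℚ)⁻¹) * ∑ a ∈ Finset.HasAntidiagonal.antidiagonal k with a.1 < k,
          ((-1) ^ a.1 * (es A a.1 W * pw A a.2 W)) := by
        intro W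
        have h1 := congrArg (aeval (fun j => (ex (localize A W) j : ℚ))) (mul_esymm_eq_sum (Fin ℓ) ℚ k)
        simp only [map_mul, map_natCast, map_pow, map_neg, map_one, map_sum] at h1
        have h2 : ∀ m, aeval (fun j => (ex (localize A W) j : ℚ)) (psum (Fin ℓ) ℚ m) = pw A m W := by
          intro m; simp [psum, pw]
        simp only [h2] at h1
        have hk' : (k : ℚ) ≠ 0 := by positivity
        have h3 : es A k W = (k : ℚ)⁻¹ * ((k : ℚ) * es A k W) := by field_simp
        rw [h3]
        unfold es
        rw [h1, ← mul_assoc, mul_comm ((k : ℚ)⁻¹)]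
        congr 1
        refine Finset.sum_congr rfl fun a _ => by ring
      refine Lcl.congr ?_ fun W _ => hN W
      refine Lcl.smul (Lcl.sum _ fun a ha => ?_) _
      rw [Finset.mem_filter, Finset.HasAntidiagonal.mem_antidiagonal] at ha
      refine Lcl.smul ?_ _
      have := (ih a.1 ha.2).mul (pw_Lcl hA hf a.2)
      rwa [ha.1] at this

/-- Betti numbers of localizations -/
def bt (A : Finset (Submodule K (Fin ℓ → K))) (k : ℕ) (W : Submodule K (Fin ℓ → K)) : ℚ :=
  ups A (fun Z => if cdm Z = k then (-1) ^ k * (mob ⊤ (latticeOf ⊤ A) Z : ℚ) else 0) W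

theorem bt_Lcl (A : Finset (Submodule K (Fin ℓ → K))) (k : ℕ) : Lcl A k (bt A k) :=
  ⟨_, fun Z _ hk => if_neg (by omega), fun _ _ => rfl⟩

theorem mob_top (L : Finset (Submodule K (Fin ℓ → K))) : mob ⊤ L ⊤ = 1 := by
  rw [mob, if_pos rfl]

theorem mob_sum {A : Finset (Submodule K (Fin ℓ → K))} {X : Submodule K (Fin ℓ → K)}
    (hX : X ∈ latticeOf ⊤ A) (h : X ≠ ⊤) : ups A (fun Z => (mob ⊤ (latticeOf ⊤ A) Z : ℚ)) X = 0 := by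
  rw [ups_eq _ hX, mob, if_neg h, Finset.sum_attach _ (fun Z => mob ⊤ (latticeOf ⊤ A) Z)]
  push_cast; ring

theorem es_prod (A : Finset (Submodule K (Fin ℓ → K))) (W : Submodule K (Fin ℓ → K)) (t : ℚ) :
    ∏ i, (1 + (ex (localize A W) i : ℚ) * t) = ∑ k ∈ Finset.range (ℓ + 1), es A k W * t ^ k := by
  rw [Finset.prod_one_add, Finset.sum_powerset, Finset.card_univ, Fintype.card_fin]
  refine Finset.sum_congr rfl fun k _ => ?_
  rw [es_eq, Finset.sum_mul]
  refine Finset.sum_congr rfl fun s hs => ?_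
  rw [Finset.prod_mul_distrib, Finset.prod_const, (Finset.mem_powersetCard.1 hs).2]

theorem bt_sum (A : Finset (Submodule K (Fin ℓ → K))) (W : Submodule K (Fin ℓ → K)) (t : ℚ) :
    ups A (fun Z => (mob ⊤ (latticeOf ⊤ A) Z : ℚ) * (-t) ^ cdm Z) W =
      ∑ k ∈ Finset.range (ℓ + 1), bt A k W * t ^ k := by
  simp only [bt, ups, Finset.sum_mul]
  rw [Finset.sum_comm]
  refine Finset.sum_congr rfl fun Z _ => ?_
  rw [Finset.sum_eq_single (cdm Z)]
  · rw [if_pos rfl, neg_pow]; ring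
  · intro b _ hb; rw [if_neg (Ne.symm hb), zero_mul]
  · intro h; exfalso; apply h; rw [Finset.mem_range]; unfold cdm; omega

theorem es_bt {A : Finset (Submodule K (Fin ℓ → K))} (hA : IsArrangement A) (hf : IsFree A)
    (X : Submodule K (Fin ℓ → K)) : X ∈ latticeOf ⊤ A → ∀ k, es A k X = bt A k X := by
  induction X using WellFoundedGT.induction with
  | ind X ih =>
    intro hX
    have hli := loc_inf hX
    have hfX := free_localize hA hf X
    have hlt : ∀ k, k < cdm X → es A k X = bt A k X := by
      intro k hk
      have h1 : Lcl A k (fun W => es A k W - bt A k W) := by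
        have := Lcl.sum (A := A) (k := k) (Finset.univ : Finset (Fin 2))
          (h := fun i W => if i = 0 then es A k W else (-1) * bt A k W) (by
            intro i _
            fin_cases i
            · simpa using es_Lcl hA hf k
            · simpa using (bt_Lcl A k).smul (-1))
        refine this.congr fun W _ => ?_
        simp [Fin.sum_univ_two]; ring
      have := h1.zero hX hk fun Z hZ hXZ => sub_eq_zero.2 (ih Z hXZ hZ k)
      exact sub_eq_zero.1 this
    have hgt : ∀ k, cdm X < k → es A k X = bt A k X := by
      intro k hk
      obtain ⟨θ, hom, gen, -⟩ := ex_spec hfX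
      have hz := zeros_ge (loc_arr hA X) hom gen
      rw [hli] at hz
      have e1 : es A k X = 0 := by
        rw [es_eq]
        refine Finset.sum_eq_zero fun t ht => ?_
        have htc := (Finset.mem_powersetCard.1 ht).2
        by_contra hne
        replace hne := Finset.prod_ne_zero_iff.1 hne
        have hd : Disjoint t (Finset.univ.filter fun j => ex (localize A X) j = 0) := by
          rw [Finset.disjoint_left]
          intro i hi hi'
          refine hne i hi ?_
          rw [(Finset.mem_filter.1 hi').2]; simp
        have h1 := Finset.card_le_univ (t.disjUnion _ hd)
        rw [Finset.card_disjUnion, Fintype.card_fin] at h1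
        unfold cdm at hk
        omega
      have e2 : bt A k X = 0 := by
        refine Finset.sum_eq_zero fun Z hZ => if_neg ?_
        have := cdm_anti (Finset.mem_filter.1 hZ).2
        omega
      rw [e1, e2]
    have hne : ∀ k, k ≠ cdm X → es A k X = bt A k X := fun k hk =>
      (lt_or_gt_of_ne hk).elim (hlt k) (hgt k)
    intro k
    by_cases hk : k = cdm X
    swap
    · exact hne k hk
    subst hk
    by_cases hT : X = ⊤
    · subst hT
      rw [cdm_top, bt, ups_eq _ (top_mem_lat A), if_pos cdm_top, mob_top, Finset.sum_eq_zero]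
      · simp [es]
      · intro Z hZ
        exact absurd (Finset.mem_filter.1 hZ).2 not_top_lt
    · have hnon : (localize A X).Nonempty := by
        rw [Finset.nonempty_iff_ne_empty]
        intro h0
        rw [h0] at hli
        exact hT (by rw [← hli]; simp)
      obtain ⟨θ, -, -, -, j, hj, -⟩ := euler_basis (loc_arr hA X) hnon (ex_spec hfX)
      have s1 : ∑ k ∈ Finset.range (ℓ + 1), es A k X * (-1) ^ k = 0 := by
        rw [← es_prod]
        refine Finset.prod_eq_zero (Finset.mem_univ j) ?_
        rw [hj]; norm_num
      have s2 : ∑ k ∈ Finset.range (ℓ + 1), bt A k X * (-1) ^ k = 0 := by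
        rw [← bt_sum, ← mob_sum hX hT]
        simp
      have s3 : ∑ k ∈ Finset.range (ℓ + 1), (es A k X - bt A k X) * (-1) ^ k = 0 := by
        simp only [sub_mul, Finset.sum_sub_distrib, s1, s2, sub_zero]
      rw [Finset.sum_eq_single (cdm X)] at s3
      · have := (mul_eq_zero.1 s3).resolve_right (pow_ne_zero _ (by norm_num))
        exact sub_eq_zero.1 this
      · intro b _ hb; rw [hne b hb]; simp
      · intro h; exfalso; apply h; rw [Finset.mem_range]; unfold cdm; omega

theorem loc_self (A : Finset (Submodule K (Fin ℓ → K))) : localize A (A.inf id) = A :=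
  Finset.filter_true_of_mem fun _ hL => Finset.inf_le (f := id) hL

/-- Terao's factorization theorem. -/
theorem factorization {A : Finset (Submodule K (Fin ℓ → K))} (hA : IsArrangement A) (hf : IsFree A) (t : ℚ) :
    poincareEval A t = ∏ i, (1 + (ex A i : ℚ) * t) := by
  have h := es_prod A (A.inf id) t
  rw [loc_self] at h
  rw [h, Finset.sum_congr rfl fun k _ => by rw [es_bt hA hf (A.inf id) (mem_lat.2 ⟨A, subset_rfl, rfl⟩) k], ← bt_sum]
  unfold poincareEval ups
  rw [Finset.filter_true_of_mem]
  · rfl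
  · intro Z hZ
    obtain ⟨B, hB, rfl⟩ := mem_lat.1 hZ
    exact Finset.inf_mono hB


theorem cast_dd {A : Finset (Submodule K (Fin ℓ → K))} {H : Submodule K (Fin ℓ → K)} (hH : H ∈ A) :
    ((A.card : ℚ) - ((restrict A H).card : ℚ)) = ((dd A H + 1 : ℕ) : ℚ) := by
  have h1 := Finset.card_erase_add_one hH
  have h2 := card_restrict_le A H
  have h3 : A.card = dd A H + 1 + (restrict A H).card := by unfold dd; omega
  rw [h3]; push_cast; ring

theorem mem_restr_lat {A : Finset (Submodule K (Fin ℓ → K))} {H X : Submodule K (Fin ℓ → K)}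
    (hX : X ∈ latticeOf ⊤ A) (hXH : X ≤ H) : X ∈ latticeOf H (restrict A H) := by
  obtain ⟨C, hC, rfl⟩ := mem_lat.1 hX
  refine Finset.mem_image.2 ⟨(C.erase H).image (fun L => L ⊓ H), ?_, ?_⟩
  · exact Finset.mem_powerset.2 (Finset.image_subset_image (Finset.erase_subset_erase _ hC))
  · apply le_antisymm
    · refine Finset.le_inf fun L hL => ?_
      by_cases h : L = H
      · subst h; exact inf_le_left
      · have : ((C.erase H).image (fun L => L ⊓ H)).inf id ≤ L ⊓ H :=
          Finset.inf_le (f := id) (Finset.mem_image_of_mem _ (Finset.mem_erase.2 ⟨h, hL⟩))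
        exact inf_le_right.trans (this.trans inf_le_left)
    · refine le_inf hXH (Finset.le_inf fun Y hY => ?_)
      obtain ⟨L, hL, rfl⟩ := Finset.mem_image.1 hY
      exact le_inf (Finset.inf_le (f := id) (Finset.mem_of_mem_erase hL)) hXH

theorem erase_loc (A : Finset (Submodule K (Fin ℓ → K))) (H X : Submodule K (Fin ℓ → K)) :
    localize (A.erase H) X = (localize A X).erase H := by
  unfold localize; rw [Finset.filter_erase]

theorem root_iff {A : Finset (Submodule K (Fin ℓ → K))} (hA : IsArrangement A) (hf : IsFree A) (c : ℕ) (hc : c ≠ 0) :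
    poincareEval A (-((c : ℚ)⁻¹)) = 0 ↔ ∃ i, ex A i = c := by
  have hc' : (c : ℚ) ≠ 0 := by exact_mod_cast hc
  rw [factorization hA hf, Finset.prod_eq_zero_iff]
  constructor
  · rintro ⟨i, -, h⟩
    refine ⟨i, ?_⟩
    field_simp at h
    have : (ex A i : ℚ) = c := by linarith
    exact_mod_cast this
  · rintro ⟨i, h⟩
    refine ⟨i, Finset.mem_univ i, ?_⟩
    rw [h]; field_simp; ring

theorem main_aux {A : Finset (Submodule K (Fin ℓ → K))}
    (hA : IsArrangement A) (hEss : Essential A) (hfree : IsFree A)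
    {H : Submodule K (Fin ℓ → K)} (hH : H ∈ A) :
    IsFree (A.erase H) ↔
      ∀ X ∈ latticeOf H (restrict A H),
        -((((localize A X).card : ℚ) - ((restrict (localize A X) H).card : ℚ))⁻¹) ≠ 0 ∧
        poincareEval (localize A X)
          (-((((localize A X).card : ℚ) - ((restrict (localize A X) H).card : ℚ))⁻¹)) = 0 := by
  constructor
  · intro hd X hX
    have hXH : X ≤ H := by
      obtain ⟨B, -, rfl⟩ := Finset.mem_image.1 hX
      exact inf_le_left
    have hHX : H ∈ localize A X := Finset.mem_filter.2 ⟨hH, hXH⟩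
    have hfX := free_localize hA hfree X
    have hdX := free_localize (erase_arr hA H) hd X
    rw [erase_loc] at hdX
    rw [cast_dd hHX]
    refine ⟨neg_ne_zero.2 (inv_ne_zero (by positivity)), ?_⟩
    rw [root_iff (loc_arr hA X) hfX _ (by omega)]
    exact exp_of_del_free (loc_arr hA X) hHX (ex_spec hfX) hdX
  · intro h
    have key : ∀ X : Submodule K (Fin ℓ → K), X ∈ latticeOf ⊤ A → X ≤ H → IsFree ((localize A X).erase H) := by
      intro X
      induction X using WellFoundedGT.induction with
      | ind X ih =>
        intro hX hXH
        have hHX : H ∈ localize A X := Finset.mem_filter.2 ⟨hH, hXH⟩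
        have hfX := free_localize hA hfree X
        have h2 := (h X (mem_restr_lat hX hXH)).2
        rw [cast_dd hHX, root_iff (loc_arr hA X) hfX _ (by omega)] at h2
        refine back_step (loc_arr hA X) hHX (ex_spec hfX) h2 fun B hB hlt hle => ?_
        rw [loc_inf hX] at hlt
        rw [loc_loc hlt.le]
        exact ih _ hlt (mem_lat.2 ⟨B, hB.trans (loc_sub _ _), rfl⟩) hle
    have h1 := key (A.inf id) (mem_lat.2 ⟨A, subset_rfl, rfl⟩) (Finset.inf_le (f := id) hH)
    rwa [loc_self] at h1

/-- Theorem `A4`: let `A` be free and `H ∈ A`. Then `A' = A \ {H}`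
is free iff for every `X ∈ L(A^H)`, the number `s_X = -(|A_X| - |A_X^H|)⁻¹` is a
non-zero root of the Poincaré polynomial `π(A_X;t)`. -/
theorem deletion_combinatorial_criterion {K : Type} [Field K] {ℓ : ℕ}
    (A : Finset (Submodule K (Fin ℓ → K)))
    (hA : IsArrangement A) (hEss : Essential A) (hfree : IsFree A)
    (H : Submodule K (Fin ℓ → K)) (hH : H ∈ A) :
    IsFree (A.erase H) ↔
      ∀ X ∈ latticeOf H (restrict A H),
        -((((localize A X).card : ℚ) - ((restrict (localize A X) H).card : ℚ))⁻¹) ≠ 0 ∧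
        poincareEval (localize A X)
          (-((((localize A X).card : ℚ) - ((restrict (localize A X) H).card : ℚ))⁻¹)) = 0 := by
  exact main_aux hA hEss hfree hH

end ArrPOG
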